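/- arXiv:math/0607692 — 2 statements merged into one kernel-verified Lean document; each statement's English description precedes it below -/
import Mathlib

section
/- Let α > 1 and β be real numbers, and let σ ∈ {+1, −1} be fixed. Then for every ε > 0, for all sufficiently large primes p, there exists a positive integer n with n ≤ p^{1/(4√e) + ε} such that (⌊αn + β⌋ | p) = σ, provided α is irrational. -/
section Stepanov

open Polynomial

variable {p : ℕ} [Fact p.Prime]

/-- The linear operators `E k` with `(f ^ e * r)^{(k)} = f ^ (e - k) * E k r` for `k ≤ e`. -/
noncomputable def powDerivOp (f : (ZMod p)[X]) (e : ℕ) : ℕ → (ZMod p)[X] →ₗ[ZMod p] (ZMod p)[X]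
  | 0 => LinearMap.id
  | k + 1 => LinearMap.mulLeft (ZMod p) (C ((e : ZMod p) - k) * derivative f) ∘ₗ powDerivOp f e k +
      LinearMap.mulLeft (ZMod p) f ∘ₗ derivative ∘ₗ powDerivOp f e k

lemma powDerivOp_succ_apply (f : (ZMod p)[X]) (e k : ℕ) (r : (ZMod p)[X]) :
    powDerivOp f e (k + 1) r = C ((e : ZMod p) - k) * derivative f * powDerivOp f e k r +
      f * derivative (powDerivOp f e k r) := by
  simp [powDerivOp, mul_assoc]

lemma iterate_derivative_pow_mul (f : (ZMod p)[X]) (e : ℕ) (r : (ZMod p)[X]) (k : ℕ) (hk : k ≤ e) :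
    derivative^[k] (f ^ e * r) = f ^ (e - k) * powDerivOp f e k r := by
  induction k with
  | zero => simp [powDerivOp]
  | succ k ih =>
    rw [Function.iterate_succ_apply', ih (by omega), powDerivOp_succ_apply]
    obtain ⟨t, rfl⟩ : ∃ t, e = k + 1 + t := ⟨e - (k + 1), by omega⟩
    have h1 : k + 1 + t - k = t + 1 := by omega
    have h2 : k + 1 + t - (k + 1) = t := by omega
    rw [h1, h2, derivative_mul, derivative_pow_succ]
    have : ((k + 1 + t : ℕ) : ZMod p) - k = t + 1 := by push_cast; ring
    rw [this]
    ring

lemma powDerivOp_mem_degreeLT (f : (ZMod p)[X]) (e n : ℕ) (r : (ZMod p)[X])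
    (hr : r ∈ degreeLT (ZMod p) n) (k : ℕ) :
    powDerivOp f e k r ∈ degreeLT (ZMod p) (n + k * f.natDegree) := by
  induction k with
  | zero => simpa [powDerivOp] using hr
  | succ k ih =>
    rw [mem_degreeLT] at ih ⊢
    rw [powDerivOp_succ_apply]
    set s := powDerivOp f e k r
    by_cases hs : s = 0
    · simp only [hs, mul_zero, derivative_zero, add_zero, degree_zero]
      exact WithBot.bot_lt_coe _
    have hsn : s.natDegree < n + k * f.natDegree := by
      rwa [degree_eq_natDegree hs, Nat.cast_lt] at ih
    have hb : (C ((e : ZMod p) - k) * derivative f * s + f * derivative s).natDegree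
        ≤ f.natDegree + s.natDegree := by
      refine natDegree_add_le_of_degree_le ?_ ?_
      · refine natDegree_mul_le.trans ?_
        have h1 : (C ((e : ZMod p) - k) * derivative f).natDegree ≤ f.natDegree :=
          (natDegree_C_mul_le _ _).trans ((natDegree_derivative_le f).trans (Nat.sub_le _ _))
        omega
      · refine natDegree_mul_le.trans ?_
        have := natDegree_derivative_le s
        omega
    refine lt_of_le_of_lt degree_le_natDegree ?_
    rw [Nat.cast_lt]
    have : (k + 1) * f.natDegree = k * f.natDegree + f.natDegree := by ring
    omega

lemma iterate_derivative_mul_X_pow_char (h : (ZMod p)[X]) (j k : ℕ) :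
    derivative^[k] (h * X ^ (p * j)) = derivative^[k] h * X ^ (p * j) := by
  induction k with
  | zero => rfl
  | succ k ih =>
    rw [Function.iterate_succ_apply', ih, Function.iterate_succ_apply', derivative_mul,
      derivative_X_pow]
    simp

lemma mul_card_le_natDegree (R : (ZMod p)[X]) (hR : R ≠ 0) (l : ℕ) (hl : l ≤ p)
    (s : Finset (ZMod p)) (h : ∀ x ∈ s, ∀ k < l, (derivative^[k] R).IsRoot x) :
    l * s.card ≤ R.natDegree := by
  classical
  rcases Nat.eq_zero_or_pos l with rfl | hl0
  · simp
  have hx : ∀ x ∈ s, l ≤ R.roots.count x := by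
    intro x hx
    rw [count_roots]
    have := lt_rootMultiplicity_of_isRoot_iterate_derivative_of_mem_nonZeroDivisors
      (p := R) (t := x) (n := l - 1) hR (fun m hm => h x hx m (by omega)) (by
        apply mem_nonZeroDivisors_of_ne_zero
        rw [Ne, CharP.cast_eq_zero_iff (ZMod p) p, (Fact.out : p.Prime).dvd_factorial]
        omega)
    omega
  calc l * s.card = ∑ x ∈ s, l := by simp [mul_comm]
    _ ≤ ∑ x ∈ s, R.roots.count x := Finset.sum_le_sum hx
    _ ≤ ∑ x ∈ s ∪ R.roots.toFinset, R.roots.count x :=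
        Finset.sum_le_sum_of_subset Finset.subset_union_left
    _ = R.roots.card := Multiset.sum_count_eq_card (fun a ha => by simp_all)
    _ ≤ R.natDegree := card_roots' R

/-- Stepanov's inequality for the number of solutions of `f(x) ^ ((p-1)/2) = a`. -/
theorem stepanov_card_le (f : (ZMod p)[X]) (c h l J : ℕ) (hp : p = 2 * c + 1)
    (hf : f.natDegree = 2 * h + 1) (hhc : h < c) (hl : l ≤ p) (a : ZMod p)
    (hdim : l * (c - h + l * (2 * h + 1) + J) < 2 * J * (c - h)) :
    l * (Finset.univ.filter fun x : ZMod p => f.eval x ^ c = a).card ≤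
      (2 * h + 1) * (l + c) + (c - h) + p * J := by
  classical
  set D := c - h with hD
  set T := D + l * (2 * h + 1) + J with hT
  have hf0 : f ≠ 0 := by rintro rfl; simp at hf
  let e : Fin J ⊕ Fin J → ℕ := Sum.elim (fun _ => l) (fun _ => l + c)
  let w : Fin J ⊕ Fin J → ZMod p := Sum.elim (fun _ => 1) (fun _ => a)
  let j : Fin J ⊕ Fin J → ℕ := Sum.elim (fun i => i) (fun i => i)
  have hj : ∀ i, j i < J := by rintro (i | i) <;> simp [j]
  let σ : ℕ → (Fin J ⊕ Fin J → degreeLT (ZMod p) D) →ₗ[ZMod p] (ZMod p)[X] := fun k =>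
    ∑ i, LinearMap.mulLeft (ZMod p) (C (w i) * X ^ j i) ∘ₗ powDerivOp f (e i) k ∘ₗ
      (degreeLT (ZMod p) D).subtype ∘ₗ LinearMap.proj i
  have hσ : ∀ k v, σ k v = ∑ i, C (w i) * X ^ j i * powDerivOp f (e i) k (v i : (ZMod p)[X]) := by
    intro k v; simp [σ, LinearMap.sum_apply, mul_assoc]
  let Φ : (Fin J ⊕ Fin J → degreeLT (ZMod p) D) →ₗ[ZMod p] (Fin l → Fin T → ZMod p) :=
    LinearMap.pi fun k => LinearMap.pi fun t => lcoeff (ZMod p) t ∘ₗ σ k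
  have hker : LinearMap.ker Φ ≠ ⊥ := by
    have hfd : FiniteDimensional (ZMod p) (degreeLT (ZMod p) D) :=
      LinearEquiv.finiteDimensional (degreeLTEquiv (ZMod p) D).symm
    have hfr : Module.finrank (ZMod p) (degreeLT (ZMod p) D) = D := by
      rw [(degreeLTEquiv (ZMod p) D).finrank_eq]; simp
    apply LinearMap.ker_ne_bot_of_finrank_lt
    rw [Module.finrank_pi_fintype (ZMod p) (M := fun _ : Fin l => Fin T → ZMod p),
      Module.finrank_pi_fintype (ZMod p) (M := fun _ : Fin J ⊕ Fin J => degreeLT (ZMod p) D)]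
    simp only [hfr, Module.finrank_fintype_fun_eq_card, Fintype.card_fin, Finset.sum_const,
      Finset.card_univ, Fintype.card_sum, smul_eq_mul]
    linarith
  obtain ⟨v, hvmem, hv0⟩ := Submodule.exists_mem_ne_zero_of_ne_bot hker
  have hσ0 : ∀ k < l, σ k v = 0 := by
    intro k hk
    have hdeg : σ k v ∈ degreeLT (ZMod p) T := by
      rw [hσ]
      refine Submodule.sum_mem _ fun i _ => ?_
      have h1 := powDerivOp_mem_degreeLT f (e i) D (v i) (v i).2 k
      rw [mem_degreeLT] at h1 ⊢
      by_cases hs : powDerivOp f (e i) k (v i : (ZMod p)[X]) = 0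
      · rw [hs]; simp only [mul_zero, degree_zero]; exact WithBot.bot_lt_coe _
      rw [degree_eq_natDegree hs, Nat.cast_lt] at h1
      refine lt_of_le_of_lt degree_le_natDegree ?_
      rw [Nat.cast_lt]
      refine lt_of_le_of_lt natDegree_mul_le ?_
      have h2 : (C (w i) * X ^ j i).natDegree ≤ j i := natDegree_C_mul_X_pow_le _ _
      have h3 := hj i
      have h4 : k * f.natDegree ≤ l * (2 * h + 1) := by rw [hf]; exact Nat.mul_le_mul_right _ hk.le
      omega
    ext t
    by_cases ht : t < T
    · have := congrFun (congrFun (LinearMap.mem_ker.1 hvmem) ⟨k, hk⟩) ⟨t, ht⟩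
      simpa [Φ] using this
    · rw [mem_degreeLT] at hdeg
      rw [coeff_zero]
      exact coeff_eq_zero_of_degree_lt (lt_of_lt_of_le hdeg (by exact_mod_cast not_lt.1 ht))
  let term : Fin J ⊕ Fin J → (ZMod p)[X] := fun i => f ^ e i * (v i : (ZMod p)[X]) * X ^ (p * j i)
  set R := ∑ i, term i with hRdef
  have hvd : ∀ i, (v i : (ZMod p)[X]) ≠ 0 → (v i : (ZMod p)[X]).natDegree < D := by
    intro i hi
    have := (v i).2
    rwa [mem_degreeLT, degree_eq_natDegree hi, Nat.cast_lt] at this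
  have hterm : ∀ i, (v i : (ZMod p)[X]) ≠ 0 → term i ≠ 0 ∧
      (term i).natDegree = (2 * h + 1) * e i + (v i : (ZMod p)[X]).natDegree + p * j i := by
    intro i hi
    have h1 : f ^ e i ≠ 0 := pow_ne_zero _ hf0
    have h2 : (X ^ (p * j i) : (ZMod p)[X]) ≠ 0 := pow_ne_zero _ X_ne_zero
    refine ⟨mul_ne_zero (mul_ne_zero h1 hi) h2, ?_⟩
    rw [natDegree_mul (mul_ne_zero h1 hi) h2, natDegree_mul h1 hi, natDegree_pow, natDegree_pow, hf]
    simp [mul_comm]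
  have hvterm : ∀ i, term i ≠ 0 → (v i : (ZMod p)[X]) ≠ 0 := by
    intro i hi h0; exact hi (by simp [term, h0])
  have hmc : (2 * h + 1) * c = h * p + D := by
    have : c = D + h := by omega
    rw [hp, this]; ring
  have hdegR : R.degree = Finset.univ.sup fun i => (term i).degree := by
    apply degree_sum_eq_of_disjoint
    rintro i ⟨-, hi⟩ i' ⟨-, hi'⟩ hne heq
    simp only [Function.comp] at heq
    rw [degree_eq_natDegree hi, degree_eq_natDegree hi', Nat.cast_inj,
      (hterm i (hvterm i hi)).2, (hterm i' (hvterm i' hi')).2] at heq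
    have d1 := hvd i (hvterm i hi)
    have d2 := hvd i' (hvterm i' hi')
    apply hne
    have key : ∀ x y u u' : ℕ, x < p → y < p → x + p * u = y + p * u' → u = u' := by
      intro x y u u' hx hy hxy
      have hp0 : 0 < p := by omega
      have := congrArg (· / p) hxy
      simpa [Nat.add_mul_div_left _ _ hp0, Nat.div_eq_of_lt hx, Nat.div_eq_of_lt hy] using this
    have key' : ∀ x y u u' : ℕ, x < p → y < p → x + p * u = y + p * u' → x = y := by
      intro x y u u' hx hy hxy
      have := key x y u u' hx hy hxy
      subst this
      omega
    rcases i with i | i <;> rcases i' with i' | i' <;> simp only [e, j, Sum.elim_inl, Sum.elim_inr] at heq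
    · congr 1; ext
      exact key (v (Sum.inl i) : (ZMod p)[X]).natDegree (v (Sum.inl i') : (ZMod p)[X]).natDegree _ _
        (by omega) (by omega) (by linarith)
    · exfalso
      have := key' (v (Sum.inl i) : (ZMod p)[X]).natDegree (D + (v (Sum.inr i') : (ZMod p)[X]).natDegree)
        i (h + i') (by omega) (by omega) (by linarith [mul_comm h p])
      omega
    · exfalso
      have := key' (v (Sum.inl i') : (ZMod p)[X]).natDegree (D + (v (Sum.inr i) : (ZMod p)[X]).natDegree)
        i' (h + i) (by omega) (by omega) (by linarith [mul_comm h p])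
      omega
    · congr 1; ext
      exact key (v (Sum.inr i) : (ZMod p)[X]).natDegree (v (Sum.inr i') : (ZMod p)[X]).natDegree _ _
        (by omega) (by omega) (by linarith)
  have hR0 : R ≠ 0 := by
    obtain ⟨i, hi⟩ : ∃ i, v i ≠ 0 := by
      by_contra! hcon; exact hv0 (funext hcon)
    have hi' : (v i : (ZMod p)[X]) ≠ 0 := by simpa using hi
    intro h0
    rw [h0, degree_zero] at hdegR
    have : (term i).degree ≤ ⊥ := hdegR ▸ Finset.le_sup (f := fun i => (term i).degree) (Finset.mem_univ i)
    exact (hterm i hi').1 (degree_eq_bot.1 (le_bot_iff.1 this))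
  have hRdeg : R.natDegree ≤ (2 * h + 1) * (l + c) + D + p * J := by
    refine natDegree_sum_le_of_forall_le _ _ fun i _ => ?_
    by_cases hi : (v i : (ZMod p)[X]) = 0
    · simp [term, hi]
    rw [(hterm i hi).2]
    have h1 := hvd i hi
    have h2 : e i ≤ l + c := by rcases i with i | i <;> simp [e]
    have h3 := hj i
    gcongr
  refine (mul_card_le_natDegree R hR0 l hl _ ?_).trans hRdeg
  intro x hx k hk
  rw [Finset.mem_filter] at hx
  have hxa := hx.2
  rw [IsRoot, hRdef, iterate_derivative_sum, eval_finsetSum]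
  have : ∀ i, eval x (derivative^[k] (term i)) =
      f.eval x ^ (l - k) * eval x (C (w i) * X ^ j i * powDerivOp f (e i) k (v i : (ZMod p)[X])) := by
    intro i
    have hke : k ≤ e i := by rcases i with i | i <;> simp [e] <;> omega
    rw [iterate_derivative_mul_X_pow_char, iterate_derivative_pow_mul _ _ _ _ hke]
    simp only [eval_mul, eval_pow, eval_C, eval_X]
    rw [pow_mul, ZMod.pow_card]
    rcases i with i | i
    · simp only [e, w, j, Sum.elim_inl]; ring
    · simp only [e, w, j, Sum.elim_inr]
      rw [show l + c - k = (l - k) + c by omega, pow_add, hxa]; ring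
  simp_rw [this]
  rw [← Finset.mul_sum, ← eval_finsetSum, ← hσ, hσ0 k hk]
  simp

end Stepanov

section CompleteSums

open Polynomial

set_option maxHeartbeats 1000000 in
lemma card_quadraticChar_eq_le {p : ℕ} [Fact p.Prime] (f : (ZMod p)[X]) (h : ℕ)
    (hf : f.natDegree = 2 * h + 1) (hp : (8 * h + 10) ^ 2 ≤ p) (s : ℤ) :
    ((Finset.univ.filter fun x : ZMod p => quadraticChar (ZMod p) (f.eval x) = s).card : ℝ) ≤
      p / 2 + (14 * h + 15) * √p := by
  have hp2 : p ≠ 2 := by rintro rfl; nlinarith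
  obtain ⟨c, hc⟩ := (Fact.out : p.Prime).odd_of_ne_two hp2
  set l := Nat.sqrt p with hl
  have hl1 : l * l ≤ p := Nat.sqrt_le p
  have hl2 : p < (l + 1) * (l + 1) := Nat.lt_succ_sqrt p
  have hl3 : 8 * h + 10 ≤ l := by rw [hl, Nat.le_sqrt']; exact hp
  have hhc : h < c := by nlinarith
  set K := 4 * h + 5 with hK
  set J := l / 2 + K with hJ
  have hJ1 : l + 8 * h + 9 ≤ 2 * J := by omega
  have hJ2 : J ≤ l := by omega
  have hJ3 : 2 * J ≤ l + 8 * h + 10 := by omega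
  obtain ⟨D, hD⟩ : ∃ D, c = h + D := ⟨c - h, by omega⟩
  have hDc : c - h = D := by omega
  have hD4 : p ≤ 4 * D := by nlinarith
  have hdim : l * (c - h + l * (2 * h + 1) + J) < 2 * J * (c - h) := by
    rw [hDc]
    have h1 : l * J ≤ p := (Nat.mul_le_mul_left _ hJ2).trans hl1
    have h2 : l * l * (2 * h + 1) ≤ p * (2 * h + 1) := Nat.mul_le_mul_right _ hl1
    have h3 : (l + 8 * h + 9) * D ≤ 2 * J * D := Nat.mul_le_mul_right _ hJ1
    have h4 : p * (2 * h + 2) ≤ 4 * D * (2 * h + 2) := Nat.mul_le_mul_right _ hD4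
    have h5 : 0 < D := by omega
    nlinarith
  have key := stepanov_card_le f c h l J hc hf hhc (by nlinarith) (s : ZMod p) hdim
  have hsub : (Finset.univ.filter fun x : ZMod p => quadraticChar (ZMod p) (f.eval x) = s).card ≤
      (Finset.univ.filter fun x : ZMod p => f.eval x ^ c = (s : ZMod p)).card := by
    apply Finset.card_le_card
    intro x hx
    simp only [Finset.mem_filter, Finset.mem_univ, true_and] at hx ⊢
    have hch : ringChar (ZMod p) ≠ 2 := by rwa [ZMod.ringChar_zmod_n]
    have := quadraticChar_eq_pow_of_char_ne_two' hch (f.eval x)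
    rw [hx, ZMod.card, show p / 2 = c by omega] at this
    exact this.symm
  set N := (Finset.univ.filter fun x : ZMod p => quadraticChar (ZMod p) (f.eval x) = s).card
  have key2 : l * N ≤ (2 * h + 1) * (l + c) + (c - h) + p * J :=
    (Nat.mul_le_mul_left _ hsub).trans key
  rw [hDc] at key2
  have hDle : D ≤ c := by omega
  have key3 : 2 * (l * N) ≤ 2 * (2 * h + 1) * l + (2 * h + 2) * p + p * (l + 8 * h + 10) := by
    have h1 : p * (2 * J) ≤ p * (l + 8 * h + 10) := Nat.mul_le_mul_left _ hJ3
    nlinarith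
  have key4 : 2 * ((l : ℝ) * N) ≤ 2 * (2 * h + 1) * l + (2 * h + 2) * p + p * (l + 8 * h + 10) := by
    exact_mod_cast key3
  have hl0 : (10 : ℝ) ≤ l := by exact_mod_cast (by omega : 10 ≤ l)
  have hsq : √(p : ℝ) ^ 2 = p := Real.sq_sqrt (by positivity)
  have hs1 : √(p : ℝ) ≤ l + 1 := by
    apply Real.sqrt_le_iff.2
    refine ⟨by positivity, ?_⟩
    have : (p : ℝ) < (l + 1) * (l + 1) := by exact_mod_cast hl2
    nlinarith
  have hs2 : (l : ℝ) ≤ √p := by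
    apply Real.le_sqrt_of_sq_le
    have : (l : ℝ) * l ≤ p := by exact_mod_cast hl1
    nlinarith
  set q := √(p : ℝ)
  have hpl : (p : ℝ) ≤ (q * l) * (11 / 10) := by
    rw [← hsq]; nlinarith
  have hh : (0 : ℝ) ≤ h := by positivity
  have h6 : (10 * (h : ℝ) + 12) * p ≤ (10 * h + 12) * ((q * l) * (11 / 10)) := by gcongr
  have h7 : (4 * (h : ℝ) + 2) * l ≤ (4 * h + 2) * l * (q / 10) := by
    have : (1 : ℝ) ≤ q / 10 := by linarith
    have h8 : 0 ≤ (4 * (h : ℝ) + 2) * l := by positivity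
    nlinarith
  have h9 : (l : ℝ) * (2 * N) ≤ l * (p + 2 * (14 * h + 15) * q) := by
    have h10 : 0 ≤ (h : ℝ) * (l * q) := by positivity
    have h11 : 0 ≤ (l * q : ℝ) := by positivity
    linarith
  have := le_of_mul_le_mul_left h9 (by linarith)
  linarith

/-- The square-root bound for quadratic character sums of odd degree polynomials. -/
theorem abs_sum_quadraticChar_le {p : ℕ} [Fact p.Prime] (f : (ZMod p)[X]) (h : ℕ)
    (hf : f.natDegree = 2 * h + 1) :
    |∑ x : ZMod p, (quadraticChar (ZMod p) (f.eval x) : ℝ)| ≤ (30 * h + 31) * √p := by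
  classical
  have hsq : √(p : ℝ) ^ 2 = p := Real.sq_sqrt (by positivity)
  have hq0 : 0 ≤ √(p : ℝ) := Real.sqrt_nonneg _
  have hh : (0 : ℝ) ≤ h := by positivity
  have hf0 : f ≠ 0 := by rintro rfl; simp at hf
  by_cases hp : (8 * h + 10) ^ 2 ≤ p
  · have h1 := card_quadraticChar_eq_le f h hf hp 1
    have h2 := card_quadraticChar_eq_le f h hf hp (-1)
    have h0 : (Finset.univ.filter fun x : ZMod p => quadraticChar (ZMod p) (f.eval x) = 0).card
        ≤ 2 * h + 1 := by
      rw [← hf]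
      refine le_trans ?_ (card_roots' f)
      refine le_trans (Finset.card_le_card ?_) (Multiset.toFinset_card_le _)
      intro x hx
      simp only [Finset.mem_filter, Finset.mem_univ, true_and, quadraticChar_eq_zero_iff] at hx
      simpa [hf0] using hx
    have h0' : ((Finset.univ.filter fun x : ZMod p =>
        quadraticChar (ZMod p) (f.eval x) = 0).card : ℝ) ≤ 2 * h + 1 := by exact_mod_cast h0
    have htri : ∀ x : ZMod p, quadraticChar (ZMod p) (f.eval x) = 0 ∨
        quadraticChar (ZMod p) (f.eval x) = 1 ∨ quadraticChar (ZMod p) (f.eval x) = -1 := by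
      intro x
      by_cases hx : f.eval x = 0
      · left; simp [hx]
      · right; exact quadraticChar_dichotomy hx
    have hsum : ∑ x : ZMod p, (quadraticChar (ZMod p) (f.eval x) : ℝ) =
        (Finset.univ.filter fun x : ZMod p => quadraticChar (ZMod p) (f.eval x) = 1).card -
        (Finset.univ.filter fun x : ZMod p => quadraticChar (ZMod p) (f.eval x) = -1).card := by
      rw [Finset.card_filter, Finset.card_filter]
      push_cast
      rw [← Finset.sum_sub_distrib]
      refine Finset.sum_congr rfl fun x _ => ?_
      rcases htri x with h | h | h <;> simp [h]
    have htot : (p : ℝ) = 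
        (Finset.univ.filter fun x : ZMod p => quadraticChar (ZMod p) (f.eval x) = 0).card +
        (Finset.univ.filter fun x : ZMod p => quadraticChar (ZMod p) (f.eval x) = 1).card +
        (Finset.univ.filter fun x : ZMod p => quadraticChar (ZMod p) (f.eval x) = -1).card := by
      rw [Finset.card_filter, Finset.card_filter, Finset.card_filter]
      push_cast
      rw [← Finset.sum_add_distrib, ← Finset.sum_add_distrib]
      rw [Finset.sum_congr rfl (g := fun _ => (1 : ℝ))]
      · simp
      intro x _
      rcases htri x with h | h | h <;> simp [h]
    have hq1 : 1 ≤ √(p : ℝ) := by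
      rw [Real.one_le_sqrt]; exact_mod_cast (Fact.out : p.Prime).one_le
    rw [hsum, abs_le]
    constructor <;> nlinarith
  · have hb : |∑ x : ZMod p, (quadraticChar (ZMod p) (f.eval x) : ℝ)| ≤ p := by
      refine (Finset.abs_sum_le_sum_abs _ _).trans ?_
      refine (Finset.sum_le_card_nsmul _ _ 1 ?_).trans (by simp)
      intro x _
      by_cases hx : f.eval x = 0
      · simp [hx]
      · rcases quadraticChar_dichotomy hx with h | h <;> simp [h]
    have hq : √(p : ℝ) ≤ 8 * h + 10 := by
      apply Real.sqrt_le_iff.2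
      refine ⟨by positivity, ?_⟩
      exact_mod_cast (not_le.1 hp).le
    nlinarith

lemma natDegree_prod_one_add_C_mul_X {F ι : Type*} [Field F] [DecidableEq F] (s : Finset ι)
    (d : ι → F) :
    (∏ i ∈ s, (1 + C (d i) * X) : F[X]).natDegree = (s.filter fun i => d i ≠ 0).card := by
  rw [natDegree_prod, Finset.card_filter]
  · refine Finset.sum_congr rfl fun i _ => ?_
    by_cases h : d i = 0
    · simp [h]
    · rw [if_pos h, add_comm, ← C_1, natDegree_linear h]
  · intro i _ h
    have := congrArg (coeff · 0) h
    simp at this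

/-- Complete sums of products of shifted quadratic characters, when some shift occurs an odd number
of times among an even number of shifts. -/
theorem abs_sum_prod_quadraticChar_le {p : ℕ} [Fact p.Prime] {ι : Type*} [Fintype ι]
    (hι : Even (Fintype.card ι)) (b : ι → ZMod p) (c : ZMod p)
    (hc : Odd (Finset.univ.filter fun i => b i = c).card) :
    |∑ u : ZMod p, ∏ i, (quadraticChar (ZMod p) (u + b i) : ℝ)| ≤
      (15 * Fintype.card ι + 32) * √p := by
  classical
  set f : (ZMod p)[X] := ∏ i, (1 + C (b i - c) * X) with hf
  have hdeg : f.natDegree = (Finset.univ.filter fun i => b i ≠ c).card := by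
    rw [hf, natDegree_prod_one_add_C_mul_X]
    simp only [sub_ne_zero]
  have hsplit : (Finset.univ.filter fun i => b i = c).card +
      (Finset.univ.filter fun i => b i ≠ c).card = Fintype.card ι := by
    rw [Finset.card_filter_add_card_filter_not, Finset.card_univ]
  have hodd : Odd f.natDegree := by
    rw [hdeg]
    by_contra hcon
    rw [Nat.not_odd_iff_even] at hcon
    rw [← hsplit] at hι
    exact (Nat.not_even_iff_odd.2 (hc.add_even hcon)) hι
  obtain ⟨h, hh⟩ := hodd
  have key := abs_sum_quadraticChar_le f h hh
  let e : ZMod p ≃ ZMod p := (Equiv.inv (ZMod p)).trans (Equiv.subRight c)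
  have he : ∀ t, e t = t⁻¹ - c := fun t => rfl
  have hterm : ∀ t : ZMod p, ∏ i, (quadraticChar (ZMod p) (e t + b i) : ℝ) =
      (quadraticChar (ZMod p) (f.eval t) : ℝ) - if t = 0 then 1 else 0 := by
    intro t
    by_cases ht : t = 0
    · subst ht
      obtain ⟨i, hi⟩ := Finset.card_pos.1 hc.pos
      rw [Finset.prod_eq_zero (Finset.mem_univ i)]
      · simp [hf, eval_prod]
      · simp only [Finset.mem_filter, Finset.mem_univ, true_and] at hi
        simp [he, hi]
    · rw [if_neg ht, sub_zero, hf, eval_prod, map_prod]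
      push_cast
      have : ∀ i, (quadraticChar (ZMod p) (e t + b i) : ℝ) =
          (quadraticChar (ZMod p) t⁻¹ : ℝ) *
            (quadraticChar (ZMod p) (eval t (1 + C (b i - c) * X)) : ℝ) := by
        intro i
        rw [← Int.cast_mul, ← map_mul, he]
        congr 2
        simp only [eval_add, eval_one, eval_mul, eval_C, eval_X]
        field_simp
        ring
      simp_rw [this]
      rw [Finset.prod_mul_distrib, Finset.prod_const, Finset.card_univ]
      obtain ⟨k, hk⟩ := hι
      have h1 : (quadraticChar (ZMod p) t⁻¹ : ℝ) ^ 2 = 1 := by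
        exact_mod_cast quadraticChar_sq_one (inv_ne_zero ht)
      rw [hk, ← two_mul, pow_mul, h1, one_pow, one_mul]
  rw [← e.sum_comp]
  simp_rw [hterm]
  rw [Finset.sum_sub_distrib]
  simp only [Finset.sum_ite_eq', Finset.mem_univ, if_true]
  have hq1 : 1 ≤ √(p : ℝ) := by
    rw [Real.one_le_sqrt]; exact_mod_cast (Fact.out : p.Prime).one_le
  have hhle : (2 * h + 1 : ℝ) ≤ Fintype.card ι := by
    have : 2 * h + 1 ≤ Fintype.card ι := by rw [← hh, hdeg]; omega
    exact_mod_cast this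
  rw [abs_le] at key ⊢
  constructor <;> nlinarith

end CompleteSums

section Moments

/-- Tuples of length `2 * r` in which every value occurs an even number of times. -/
lemma card_tuples_even_le {α : Type*} [DecidableEq α] (S : Finset α) (r : ℕ) (hr : 0 < r)
    [DecidablePred fun b : Fin (2 * r) → α =>
      ∀ c, Even (Finset.univ.filter fun i => b i = c).card] :
    ((Fintype.piFinset fun _ : Fin (2 * r) => S).filter fun b =>
      ∀ c, Even (Finset.univ.filter fun i => b i = c).card).card ≤ S.card ^ r * r ^ (2 * r) := by
  have hsub : ((Fintype.piFinset fun _ : Fin (2 * r) => S).filter fun b =>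
      ∀ c, Even (Finset.univ.filter fun i => b i = c).card) ⊆
      ((Fintype.piFinset fun _ : Fin r => S) ×ˢ (Finset.univ : Finset (Fin (2 * r) → Fin r))).image
        fun x => x.1 ∘ x.2 := by
    intro b hb
    simp only [Finset.mem_filter, Fintype.mem_piFinset] at hb
    obtain ⟨hbS, hev⟩ := hb
    set I := Finset.univ.image b with hI
    have hcard : 2 * I.card ≤ 2 * r := by
      have h1 : (Finset.univ : Finset (Fin (2 * r))).card =
          ∑ c ∈ I, (Finset.univ.filter fun i => b i = c).card :=
        Finset.card_eq_sum_card_image b _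
      rw [Finset.card_univ, Fintype.card_fin] at h1
      rw [h1, mul_comm, ← smul_eq_mul]
      refine Finset.card_nsmul_le_sum _ _ _ fun c hc => ?_
      obtain ⟨i, -, hi⟩ := Finset.mem_image.1 hc
      have hpos : 0 < (Finset.univ.filter fun i => b i = c).card :=
        Finset.card_pos.2 ⟨i, by simp [hi]⟩
      obtain ⟨k, hk⟩ := hev c
      omega
    have hIS : ∀ c ∈ I, c ∈ S := by
      intro c hc
      obtain ⟨i, -, hi⟩ := Finset.mem_image.1 hc
      exact hi ▸ hbS i
    have hle : I.card ≤ r := by omega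
    let g : I → Fin r := fun c => Fin.castLE hle (I.equivFin c)
    have hg : Function.Injective g := fun x y h => by
      simpa [g] using h
    have hbI : ∀ i, b i ∈ I := fun i => Finset.mem_image_of_mem b (Finset.mem_univ i)
    have hne : Nonempty I := ⟨⟨b ⟨0, by omega⟩, hbI _⟩⟩
    refine Finset.mem_image.2 ⟨(fun k => ((Function.invFun g k : I) : α), fun i => g ⟨b i, hbI i⟩), ?_, ?_⟩
    · simp only [Finset.mem_product, Fintype.mem_piFinset, Finset.mem_univ, and_true]
      exact fun k => hIS _ (Function.invFun g k).2
    · funext i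
      simp [Function.leftInverse_invFun hg _]
  refine (Finset.card_le_card hsub).trans (Finset.card_image_le.trans ?_)
  simp [Finset.card_product, Fintype.card_piFinset]

lemma abs_quadraticChar_le_one {p : ℕ} [Fact p.Prime] (x : ZMod p) :
    |(quadraticChar (ZMod p) x : ℝ)| ≤ 1 := by
  by_cases hx : x = 0
  · simp [hx]
  · rcases quadraticChar_dichotomy hx with h | h <;> simp [h]

/-- The `(2 * r)`-th moment of short sums of the quadratic character. -/
theorem sum_pow_quadraticChar_le {p : ℕ} [Fact p.Prime] (S : Finset (ZMod p)) (r : ℕ)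
    (hr : 0 < r) :
    ∑ u : ZMod p, (∑ b ∈ S, (quadraticChar (ZMod p) (u + b) : ℝ)) ^ (2 * r) ≤
      r ^ (2 * r) * (S.card : ℝ) ^ r * p + (S.card : ℝ) ^ (2 * r) * ((30 * r + 32) * √p) := by
  classical
  set χ : ZMod p → ℝ := fun x => (quadraticChar (ZMod p) x : ℝ)
  have h1 : ∑ u : ZMod p, (∑ b ∈ S, χ (u + b)) ^ (2 * r) =
      ∑ b ∈ Fintype.piFinset fun _ : Fin (2 * r) => S, ∑ u : ZMod p, ∏ i, χ (u + b i) := by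
    rw [Finset.sum_comm]
    refine Finset.sum_congr rfl fun u _ => ?_
    rw [Finset.sum_pow']
  change ∑ u : ZMod p, (∑ b ∈ S, χ (u + b)) ^ (2 * r) ≤ _
  rw [h1, ← Finset.sum_filter_add_sum_filter_not _
    (fun b => ∀ c, Even (Finset.univ.filter fun i => b i = c).card)]
  refine add_le_add ?_ ?_
  · refine (Finset.sum_le_card_nsmul _ _ (p : ℝ) ?_).trans ?_
    · intro b _
      refine (Finset.sum_le_card_nsmul _ _ 1 ?_).trans (by simp)
      intro u _
      refine (le_abs_self _).trans ?_
      rw [Finset.abs_prod]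
      exact Finset.prod_le_one (fun _ _ => abs_nonneg _) fun i _ => abs_quadraticChar_le_one _
    · rw [nsmul_eq_mul]
      have := card_tuples_even_le S r hr
      refine mul_le_mul_of_nonneg_right ?_ (Nat.cast_nonneg _)
      calc _ ≤ ((S.card ^ r * r ^ (2 * r) : ℕ) : ℝ) := by exact_mod_cast this
        _ = _ := by push_cast; ring
  · refine (Finset.sum_le_card_nsmul _ _ ((30 * r + 32) * √p) ?_).trans ?_
    · intro b hb
      rw [Finset.mem_filter] at hb
      obtain ⟨c, hc⟩ := not_forall.1 hb.2
      rw [Nat.not_even_iff_odd] at hc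
      have := abs_sum_prod_quadraticChar_le (p := p) (ι := Fin (2 * r)) (by simp) b c hc
      refine (le_abs_self _).trans (this.trans (le_of_eq ?_))
      simp only [Fintype.card_fin]
      push_cast
      ring
    · rw [nsmul_eq_mul]
      refine mul_le_mul_of_nonneg_right ?_ (by positivity)
      have : ((Fintype.piFinset fun _ : Fin (2 * r) => S).filter fun b =>
          ¬ ∀ c, Even (Finset.univ.filter fun i => b i = c).card).card ≤ S.card ^ (2 * r) :=
        (Finset.card_filter_le _ _).trans (by simp [Fintype.card_piFinset])
      exact_mod_cast this

end Moments

section Burgess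

open Finset

/-- Multiplicative energy of the product of two initial intervals. -/
lemma card_mul_eq_mul_le (A X : ℕ) :
    (((((Icc 1 A ×ˢ Icc 1 X) ×ˢ (Icc 1 A ×ˢ Icc 1 X)).filter fun z =>
      z.1.2 * z.2.1 = z.2.2 * z.1.1).card : ℕ) : ℝ) ≤ 2 * (A * X * (1 + Real.log A)) := by
  classical
  set U : Finset (Σ _ : ℕ, ℕ × ℕ × ℕ) :=
    (Icc 1 A).sigma fun v => Icc 1 v ×ˢ Icc 1 (A / v) ×ˢ Icc 1 (X / v) with hU
  let φ : (Σ _ : ℕ, ℕ × ℕ × ℕ) → (ℕ × ℕ) × (ℕ × ℕ) := fun x =>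
    ((x.2.2.1 * x.2.1, x.2.2.2 * x.2.1), (x.2.2.1 * x.1, x.2.2.2 * x.1))
  have hsub : (((Icc 1 A ×ˢ Icc 1 X) ×ˢ (Icc 1 A ×ˢ Icc 1 X)).filter fun z =>
      z.1.2 * z.2.1 = z.2.2 * z.1.1) ⊆ U.image φ ∪ U.image (Prod.swap ∘ φ) := by
    rintro ⟨⟨a, n⟩, ⟨a', n'⟩⟩ hz
    simp only [mem_filter, mem_product, mem_Icc] at hz
    obtain ⟨⟨⟨⟨ha1, ha2⟩, hn1, hn2⟩, ⟨ha1', ha2'⟩, hn1', hn2'⟩, heq⟩ := hz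
    obtain ⟨d, u, v, hdpos, hco, hu, hv⟩ := Nat.exists_coprime' (m := a) (n := a')
      (Nat.gcd_pos_of_pos_left _ ha1)
    have hu' : a = d * u := by rw [mul_comm]; exact hu
    have hv' : a' = d * v := by rw [mul_comm]; exact hv
    have hupos : 0 < u := Nat.pos_of_ne_zero (by rintro rfl; simp at hu'; omega)
    have hvpos : 0 < v := Nat.pos_of_ne_zero (by rintro rfl; simp at hv'; omega)
    have heq' : n * v = n' * u := by
      rw [hu', hv'] at heq
      apply Nat.eq_of_mul_eq_mul_left hdpos
      linarith
    obtain ⟨k, hk⟩ : u ∣ n := hco.dvd_of_dvd_mul_right ⟨n', by rw [heq', mul_comm]⟩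
    have hk' : n' = k * v := by
      apply Nat.eq_of_mul_eq_mul_right hupos
      rw [← heq', hk]; ring
    have hkpos : 0 < k := Nat.pos_of_ne_zero (by rintro rfl; simp at hk; omega)
    rw [mem_union, mem_image, mem_image]
    rcases le_total u v with huv | huv
    · left
      refine ⟨⟨v, u, d, k⟩, ?_, ?_⟩
      · simp only [hU, mem_sigma, mem_product, mem_Icc]
        refine ⟨⟨hvpos, ?_⟩, ⟨hupos, huv⟩, ⟨hdpos, ?_⟩, hkpos, ?_⟩
        · nlinarith
        · rw [Nat.le_div_iff_mul_le hvpos, ← hv']; exact ha2'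
        · rw [Nat.le_div_iff_mul_le hvpos, ← hk']; exact hn2'
      · simp [φ, hu', hv', hk, hk', mul_comm]
    · right
      refine ⟨⟨u, v, d, k⟩, ?_, ?_⟩
      · simp only [hU, mem_sigma, mem_product, mem_Icc]
        refine ⟨⟨hupos, ?_⟩, ⟨hvpos, huv⟩, ⟨hdpos, ?_⟩, hkpos, ?_⟩
        · nlinarith
        · rw [Nat.le_div_iff_mul_le hupos, ← hu']; exact ha2
        · rw [Nat.le_div_iff_mul_le hupos, mul_comm, ← hk]; exact hn2
      · simp [φ, hu', hv', hk, hk', mul_comm]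
  have hUcard : (U.card : ℝ) ≤ A * X * (1 + Real.log A) := by
    rw [hU, card_sigma]
    simp only [card_product, Nat.card_Icc, Nat.add_sub_cancel]
    push_cast
    calc ∑ v ∈ Icc 1 A, (v : ℝ) * ((A / v : ℕ) * (X / v : ℕ))
        ≤ ∑ v ∈ Icc 1 A, (A * X : ℝ) * (v : ℝ)⁻¹ := by
          refine sum_le_sum fun v hv => ?_
          have hv1 : (0 : ℝ) < v := by exact_mod_cast (mem_Icc.1 hv).1
          have h1 : ((A / v : ℕ) : ℝ) ≤ A / v := Nat.cast_div_le
          have h2 : ((X / v : ℕ) : ℝ) ≤ X / v := Nat.cast_div_le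
          calc (v : ℝ) * ((A / v : ℕ) * (X / v : ℕ)) ≤ v * ((A / v) * (X / v)) := by gcongr
            _ = _ := by field_simp
      _ = A * X * ∑ v ∈ Icc 1 A, (v : ℝ)⁻¹ := by rw [mul_sum]
      _ ≤ A * X * (1 + Real.log A) := by
          have := harmonic_le_one_add_log A
          rw [harmonic_eq_sum_Icc] at this
          push_cast at this
          gcongr
  calc _ ≤ (((U.image φ ∪ U.image (Prod.swap ∘ φ)).card : ℕ) : ℝ) := by
        exact_mod_cast card_le_card hsub
    _ ≤ ((U.card + U.card : ℕ) : ℝ) := by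
        exact_mod_cast (card_union_le _ _).trans (add_le_add card_image_le card_image_le)
    _ ≤ _ := by push_cast; linarith

/-- Hölder's inequality for sums over the fibres of a map. -/
lemma sum_comp_pow_le {ι κ : Type*} [Fintype κ] [DecidableEq κ] (Z : Finset ι) (u : ι → κ)
    (g : κ → ℝ) (hg : ∀ x, 0 ≤ g x) (r : ℕ) (hr : 0 < r) :
    (∑ z ∈ Z, g (u z)) ^ (2 * r) ≤ (Z.card : ℝ) ^ (2 * (r - 1)) *
      (((Z ×ˢ Z).filter fun z => u z.1 = u z.2).card * ∑ x, g x ^ (2 * r)) := by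
  classical
  obtain ⟨k, rfl⟩ : ∃ k, r = k + 1 := ⟨r - 1, by omega⟩
  have h1 : (∑ z ∈ Z, g (u z)) ^ (k + 1) ≤ (Z.card : ℝ) ^ k * ∑ z ∈ Z, g (u z) ^ (k + 1) := by
    rcases Z.eq_empty_or_nonempty with rfl | hZ
    · simp
    have hZ0 : (0 : ℝ) < Z.card := by exact_mod_cast hZ.card_pos
    have := pow_sum_div_card_le_sum_pow (s := Z) (f := fun z => g (u z)) (fun z _ => hg _) k
    rwa [div_le_iff₀ (by positivity), mul_comm] at this
  set v : κ → ℝ := fun x => ((Z.filter fun z => u z = x).card : ℝ) with hv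
  have h2 : ∑ z ∈ Z, g (u z) ^ (k + 1) = ∑ x, v x * g x ^ (k + 1) := by
    rw [← sum_fiberwise Z u]
    refine sum_congr rfl fun x _ => ?_
    rw [sum_congr rfl (g := fun _ => g x ^ (k + 1))]
    · simp [hv]
    · intro z hz
      rw [(mem_filter.1 hz).2]
  have h3 : ∑ x, v x ^ 2 = ((Z ×ˢ Z).filter fun z => u z.1 = u z.2).card := by
    have : ∀ x, v x ^ 2 = ∑ z ∈ Z ×ˢ Z, if u z.1 = x ∧ u z.2 = x then (1 : ℝ) else 0 := by
      intro x
      rw [hv, sq, sum_product]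
      simp only [card_filter]
      push_cast
      rw [sum_mul_sum]
      refine sum_congr rfl fun z _ => sum_congr rfl fun z' _ => ?_
      by_cases h1 : u z = x <;> by_cases h2 : u z' = x <;> simp [h1, h2]
    simp_rw [this]
    rw [sum_comm, card_filter]
    push_cast
    refine sum_congr rfl fun z _ => ?_
    by_cases h : u z.1 = u z.2
    · simp [h]
    · rw [if_neg h]
      refine sum_eq_zero fun x _ => if_neg ?_
      rintro ⟨h1, h2⟩
      exact h (h1.trans h2.symm)
  have h4 : (∑ x, v x * g x ^ (k + 1)) ^ 2 ≤ (∑ x, v x ^ 2) * ∑ x, (g x ^ (k + 1)) ^ 2 :=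
    sum_mul_sq_le_sq_mul_sq _ _ _
  rw [h2] at h1
  have h0 : 0 ≤ (∑ z ∈ Z, g (u z)) ^ (k + 1) := pow_nonneg (sum_nonneg fun z _ => hg _) _
  calc (∑ z ∈ Z, g (u z)) ^ (2 * (k + 1)) = ((∑ z ∈ Z, g (u z)) ^ (k + 1)) ^ 2 := by
        rw [← pow_mul, mul_comm]
    _ ≤ ((Z.card : ℝ) ^ k * ∑ x, v x * g x ^ (k + 1)) ^ 2 := pow_le_pow_left₀ h0 h1 2
    _ = (Z.card : ℝ) ^ (2 * k) * (∑ x, v x * g x ^ (k + 1)) ^ 2 := by rw [mul_pow, ← pow_mul, mul_comm k]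
    _ ≤ (Z.card : ℝ) ^ (2 * k) * ((∑ x, v x ^ 2) * ∑ x, (g x ^ (k + 1)) ^ 2) := by gcongr
    _ = _ := by
        rw [h3]
        simp only [Nat.add_sub_cancel, ← pow_mul, mul_comm (k + 1) 2]

lemma abs_sum_sub_sum_shift_le (f : ℕ → ℝ) (hf : ∀ n, |f n| ≤ 1) (X h : ℕ) :
    |∑ n ∈ Icc 1 X, f n - ∑ n ∈ Icc 1 X, f (n + h)| ≤ 2 * h := by
  induction h with
  | zero => simp
  | succ h ih =>
    have h1 : ∑ n ∈ Icc 1 X, f (n + h) - ∑ n ∈ Icc 1 X, f (n + (h + 1)) =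
        f (1 + h) - f (X + 1 + h) := by
      clear ih
      induction X with
      | zero => simp
      | succ X ih =>
        rw [sum_Icc_succ_top (by omega), sum_Icc_succ_top (by omega)]
        have : X + 1 + (h + 1) = X + 1 + 1 + h := by ring
        rw [this]
        linarith
    have h2 := hf (1 + h)
    have h3 := hf (X + 1 + h)
    push_cast
    rw [abs_le] at *
    constructor <;> linarith

lemma sum_Icc_abs_pow_le {p : ℕ} [Fact p.Prime] (A B X r : ℕ) (hr : 0 < r) (hAX : A * X < p)
    (hA : A < p) (hB : B < p) :
    (∑ z ∈ Icc 1 A ×ˢ Icc 1 X, |∑ b ∈ Icc 1 B,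
      (quadraticChar (ZMod p) ((z.2 + z.1 * b : ℕ) : ZMod p) : ℝ)|) ^ (2 * r) ≤
    ((A * X : ℕ) : ℝ) ^ (2 * (r - 1)) * (2 * (A * X * (1 + Real.log A)) *
      (r ^ (2 * r) * (B : ℝ) ^ r * p + (B : ℝ) ^ (2 * r) * ((30 * r + 32) * √p))) := by
  classical
  set Z := Icc 1 A ×ˢ Icc 1 X with hZ
  set S : Finset (ZMod p) := (Icc 1 B).image fun b : ℕ => (b : ZMod p) with hS
  have hinj : Set.InjOn (fun b : ℕ => (b : ZMod p)) (Icc 1 B) := by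
    intro b hb b' hb' h
    simp only [coe_Icc, Set.mem_Icc] at hb hb'
    have := (ZMod.natCast_eq_natCast_iff' b b' p).1 h
    rwa [Nat.mod_eq_of_lt (by omega), Nat.mod_eq_of_lt (by omega)] at this
  have hScard : S.card = B := by rw [hS, card_image_of_injOn hinj]; simp
  let u : ℕ × ℕ → ZMod p := fun z => (z.2 : ZMod p) / z.1
  let g : ZMod p → ℝ := fun x => |∑ b ∈ S, (quadraticChar (ZMod p) (x + b) : ℝ)|
  have ha0 : ∀ a ∈ Icc 1 A, (a : ZMod p) ≠ 0 := by
    intro a ha h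
    rw [mem_Icc] at ha
    rw [ZMod.natCast_eq_zero_iff] at h
    exact absurd (Nat.le_of_dvd ha.1 h) (by omega)
  have hterm : ∀ z ∈ Z, |∑ b ∈ Icc 1 B,
      (quadraticChar (ZMod p) ((z.2 + z.1 * b : ℕ) : ZMod p) : ℝ)| = g (u z) := by
    intro z hz
    have hz0 := ha0 z.1 (mem_product.1 hz).1
    have : ∀ b : ℕ, (quadraticChar (ZMod p) ((z.2 + z.1 * b : ℕ) : ZMod p) : ℝ) =
        (quadraticChar (ZMod p) (z.1 : ZMod p) : ℝ) * (quadraticChar (ZMod p) (u z + b) : ℝ) := by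
      intro b
      rw [← Int.cast_mul, ← map_mul]
      congr 2
      simp only [u]
      push_cast
      field_simp
    simp_rw [this]
    rw [← mul_sum, abs_mul]
    have h1 : |(quadraticChar (ZMod p) (z.1 : ZMod p) : ℝ)| = 1 := by
      rcases quadraticChar_dichotomy hz0 with h | h <;> simp [h]
    rw [h1, one_mul]
    simp only [g, hS]
    rw [sum_image hinj]
  rw [sum_congr rfl hterm]
  refine (sum_comp_pow_le Z u g (fun x => abs_nonneg _) r hr).trans ?_
  have hZc : Z.card = A * X := by simp [hZ, card_product]
  rw [hZc]
  have hE : (((Z ×ˢ Z).filter fun z => u z.1 = u z.2).card : ℝ) ≤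
      2 * (A * X * (1 + Real.log A)) := by
    refine le_trans ?_ (card_mul_eq_mul_le A X)
    rw [Nat.cast_le]
    refine card_le_card fun z hz => ?_
    rw [mem_filter] at hz ⊢
    refine ⟨hz.1, ?_⟩
    obtain ⟨hz1, hz2⟩ := hz
    simp only [hZ, mem_product] at hz1
    simp only [u] at hz2
    rw [div_eq_div_iff (ha0 _ hz1.1.1) (ha0 _ hz1.2.1)] at hz2
    have h1 : ((z.1.2 * z.2.1 : ℕ) : ZMod p) = ((z.2.2 * z.1.1 : ℕ) : ZMod p) := by
      push_cast; exact hz2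
    rw [ZMod.natCast_eq_natCast_iff'] at h1
    simp only [mem_Icc] at hz1
    rwa [Nat.mod_eq_of_lt, Nat.mod_eq_of_lt] at h1
    · exact lt_of_le_of_lt (Nat.mul_le_mul hz1.2.2.2 hz1.1.1.2) (by rwa [mul_comm])
    · exact lt_of_le_of_lt (Nat.mul_le_mul hz1.1.2.2 hz1.2.1.2) (by rwa [mul_comm])
  have hM := sum_pow_quadraticChar_le S r hr
  rw [hScard] at hM
  have hM' : ∑ x, g x ^ (2 * r) = ∑ u : ZMod p,
      (∑ b ∈ S, (quadraticChar (ZMod p) (u + b) : ℝ)) ^ (2 * r) := by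
    refine sum_congr rfl fun x _ => ?_
    simp only [g]
    rw [pow_mul, sq_abs, ← pow_mul]
  rw [hM']
  refine mul_le_mul_of_nonneg_left ?_ (by positivity)
  refine mul_le_mul hE hM ?_ ?_
  · exact sum_nonneg fun x _ => by rw [pow_mul]; positivity
  · exact (Nat.cast_nonneg _).trans hE

end Burgess

section BurgessAsymptotic

open Finset

lemma half_le_natFloor {t : ℝ} (ht : 1 ≤ t) : t / 2 ≤ (⌊t⌋₊ : ℝ) := by
  have h1 : (1 : ℝ) ≤ (⌊t⌋₊ : ℝ) := by exact_mod_cast (Nat.one_le_floor_iff t).2 ht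
  have h2 := Nat.lt_floor_add_one t
  linarith

lemma abs_sum_le_of_shifts {p : ℕ} [Fact p.Prime] (A B X : ℕ) :
    (A * B : ℝ) * |∑ n ∈ Icc 1 X, (quadraticChar (ZMod p) (n : ZMod p) : ℝ)| ≤
      ∑ z ∈ Icc 1 A ×ˢ Icc 1 X, |∑ b ∈ Icc 1 B,
        (quadraticChar (ZMod p) ((z.2 + z.1 * b : ℕ) : ZMod p) : ℝ)| + 2 * (A * B) ^ 2 := by
  set f : ℕ → ℝ := fun n => (quadraticChar (ZMod p) (n : ZMod p) : ℝ) with hf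
  set T := ∑ n ∈ Icc 1 X, f n with hT
  have h1 : ∀ a ∈ Icc 1 A, ∀ b ∈ Icc 1 B, |T - ∑ n ∈ Icc 1 X, f (n + a * b)| ≤ 2 * (A * B) := by
    intro a ha b hb
    refine (abs_sum_sub_sum_shift_le f (fun n => abs_quadraticChar_le_one _) X (a * b)).trans ?_
    have h1 : (a : ℝ) ≤ A := by exact_mod_cast (mem_Icc.1 ha).2
    have h2 : (b : ℝ) ≤ B := by exact_mod_cast (mem_Icc.1 hb).2
    push_cast
    gcongr
  have h2 : (A * B : ℝ) * T = ∑ a ∈ Icc 1 A, ∑ b ∈ Icc 1 B, (T - ∑ n ∈ Icc 1 X, f (n + a * b)) +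
      ∑ z ∈ Icc 1 A ×ˢ Icc 1 X, ∑ b ∈ Icc 1 B, f (z.2 + z.1 * b) := by
    rw [sum_product, ← sum_add_distrib]
    have : ∀ a ∈ Icc 1 A, ∑ b ∈ Icc 1 B, (T - ∑ n ∈ Icc 1 X, f (n + a * b)) +
        ∑ n ∈ Icc 1 X, ∑ b ∈ Icc 1 B, f (n + a * b) = B * T := by
      intro a _
      rw [sum_comm (s := Icc 1 X), ← sum_add_distrib]
      simp
    rw [sum_congr rfl this]
    simp
    ring
  have h3 : |∑ a ∈ Icc 1 A, ∑ b ∈ Icc 1 B, (T - ∑ n ∈ Icc 1 X, f (n + a * b))| ≤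
      2 * (A * B) ^ 2 := by
    refine (abs_sum_le_sum_abs _ _).trans ?_
    refine (sum_le_card_nsmul _ _ (B * (2 * (A * B)) : ℝ) fun a ha => ?_).trans (le_of_eq ?_)
    · refine (abs_sum_le_sum_abs _ _).trans ?_
      refine (sum_le_card_nsmul _ _ (2 * (A * B) : ℝ) fun b hb => h1 a ha b hb).trans (le_of_eq ?_)
      simp
    · simp; ring
  have h4 : |∑ z ∈ Icc 1 A ×ˢ Icc 1 X, ∑ b ∈ Icc 1 B, f (z.2 + z.1 * b)| ≤
      ∑ z ∈ Icc 1 A ×ˢ Icc 1 X, |∑ b ∈ Icc 1 B, f (z.2 + z.1 * b)| := abs_sum_le_sum_abs _ _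
  have h5 : (A * B : ℝ) * |T| = |(A * B : ℝ) * T| := by
    rw [abs_mul, abs_of_nonneg (by positivity : (0 : ℝ) ≤ A * B)]
  rw [h5, h2]
  refine (abs_add_le _ _).trans ?_
  linarith

/-- Burgess' bound for sums of the Legendre symbol over initial intervals. -/
theorem burgess_initial (δ η : ℝ) (hδ : 0 < δ) (hδ' : δ ≤ 1 / 4) (hη : 0 < η) :
    ∃ p₀ : ℕ, ∀ p : ℕ, p₀ ≤ p → ∀ _ : Fact p.Prime,
      |∑ n ∈ Icc 1 ⌊(p : ℝ) ^ (1 / 4 + δ)⌋₊, (quadraticChar (ZMod p) (n : ZMod p) : ℝ)| ≤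
        η * ⌊(p : ℝ) ^ (1 / 4 + δ)⌋₊ := by
  obtain ⟨r, hr0, hrδ⟩ : ∃ r : ℕ, 0 < r ∧ 1 / (2 * (r : ℝ)) ≤ δ / 2 := by
    obtain ⟨r, hr⟩ := exists_nat_gt (1 / δ)
    have hr0 : (0 : ℝ) < r := lt_trans (by positivity) hr
    refine ⟨r, by exact_mod_cast hr0, ?_⟩
    rw [div_lt_iff₀ hδ] at hr
    rw [div_le_div_iff₀ (by positivity) (by norm_num)]
    nlinarith
  set C : ℝ := r ^ (2 * r) * 4 ^ r + (30 * r + 32) with hC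
  have hC0 : 0 < C := by positivity
  set κ : ℝ := min (η / 8) ((η / 2) ^ (2 * r) / (8 * C * (1 + 2 / δ))) with hκ
  have hκ0 : 0 < κ := by positivity
  have hlim := tendsto_rpow_neg_atTop (half_pos hδ)
  have hev : ∀ᶠ y : ℝ in Filter.atTop, y ^ (-(δ / 2)) ≤ κ ∧ 1 < y :=
    ((hlim.eventually (gt_mem_nhds hκ0)).mono fun y hy => le_of_lt hy).and
      (Filter.eventually_gt_atTop 1)
  obtain ⟨p₀, hp₀⟩ := Filter.eventually_atTop.1 (tendsto_natCast_atTop_atTop.eventually hev)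
  refine ⟨p₀, fun p hp _ => ?_⟩
  obtain ⟨hyκ, hy1⟩ := hp₀ p hp
  set y : ℝ := (p : ℝ) with hy
  have hy0 : 0 < y := by linarith
  set A := ⌊y ^ (1 / 4 : ℝ)⌋₊ with hA
  set X := ⌊y ^ (1 / 4 + δ)⌋₊ with hX
  set B := ⌊y ^ (1 / (2 * (r : ℝ)))⌋₊ with hB
  have hr0' : (0 : ℝ) < r := by exact_mod_cast hr0
  have hA1 : (A : ℝ) ≤ y ^ (1 / 4 : ℝ) := Nat.floor_le (by positivity)
  have hX1 : (X : ℝ) ≤ y ^ (1 / 4 + δ) := Nat.floor_le (by positivity)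
  have hB1 : (B : ℝ) ≤ y ^ (1 / (2 * (r : ℝ))) := Nat.floor_le (by positivity)
  have hA2 : y ^ (1 / 4 : ℝ) / 2 ≤ A := half_le_natFloor (Real.one_le_rpow hy1.le (by norm_num))
  have hX2 : y ^ (1 / 4 + δ) / 2 ≤ X := half_le_natFloor (Real.one_le_rpow hy1.le (by linarith))
  have hB2 : y ^ (1 / (2 * (r : ℝ))) / 2 ≤ B :=
    half_le_natFloor (Real.one_le_rpow hy1.le (by positivity))
  have hA0 : (0 : ℝ) < A := lt_of_lt_of_le (by positivity) hA2
  have hX0 : (0 : ℝ) < X := lt_of_lt_of_le (by positivity) hX2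
  have hB0 : (0 : ℝ) < B := lt_of_lt_of_le (by positivity) hB2
  have hAXle : (A * X : ℝ) ≤ y ^ (1 / 2 + δ) := by
    calc (A * X : ℝ) ≤ y ^ (1 / 4 : ℝ) * y ^ (1 / 4 + δ) := by gcongr
      _ = y ^ (1 / 2 + δ) := by rw [← Real.rpow_add hy0]; congr 1; ring
  have hAXge : y ^ (1 / 2 + δ) / 4 ≤ (A * X : ℝ) := by
    calc y ^ (1 / 2 + δ) / 4 = (y ^ (1 / 4 : ℝ) / 2) * (y ^ (1 / 4 + δ) / 2) := by
          rw [show (1 / 2 + δ : ℝ) = 1 / 4 + (1 / 4 + δ) by ring, Real.rpow_add hy0]; ring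
      _ ≤ A * X := by gcongr
  have hlt : ∀ s : ℝ, s < 1 → y ^ s < y := fun s hs => by
    simpa using Real.rpow_lt_rpow_of_exponent_lt hy1 hs
  have hAX : A * X < p := by
    have : (A * X : ℝ) < p := hAXle.trans_lt (hlt _ (by linarith))
    exact_mod_cast this
  have hAp : A < p := by
    have : (A : ℝ) < p := hA1.trans_lt (hlt _ (by norm_num))
    exact_mod_cast this
  have hBp : B < p := by
    have : (B : ℝ) < p := hB1.trans_lt (hlt _ (by linarith))
    exact_mod_cast this
  have hW := sum_Icc_abs_pow_le A B X r hr0 hAX hAp hBp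
  have hT := abs_sum_le_of_shifts (p := p) A B X
  set W := ∑ z ∈ Icc 1 A ×ˢ Icc 1 X, |∑ b ∈ Icc 1 B,
        (quadraticChar (ZMod p) ((z.2 + z.1 * b : ℕ) : ZMod p) : ℝ)| with hWdef
  have hW0 : 0 ≤ W := sum_nonneg fun z _ => abs_nonneg _
  have hWle : W ≤ (A * X * B) * (η / 2) := by
    have hBr : (B : ℝ) ^ r ≤ √y := by
      calc (B : ℝ) ^ r ≤ (y ^ (1 / (2 * (r : ℝ)))) ^ r := by gcongr
        _ = √y := by
          rw [← Real.rpow_natCast, ← Real.rpow_mul hy0.le, Real.sqrt_eq_rpow]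
          congr 1; field_simp
    have hyB : y ≤ 4 ^ r * (B : ℝ) ^ (2 * r) := by
      calc y = (y ^ (1 / (2 * (r : ℝ)))) ^ (2 * r) := by
            rw [← Real.rpow_natCast, ← Real.rpow_mul hy0.le]
            push_cast
            rw [one_div_mul_cancel (by positivity), Real.rpow_one]
        _ ≤ (2 * B) ^ (2 * r) := by
            gcongr; linarith
        _ = 4 ^ r * (B : ℝ) ^ (2 * r) := by rw [mul_pow, pow_mul 2 2 r]; norm_num
    have hmom : r ^ (2 * r) * (B : ℝ) ^ r * y + (B : ℝ) ^ (2 * r) * ((30 * r + 32) * √y) ≤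
        C * √y * (B : ℝ) ^ (2 * r) := by
      have : r ^ (2 * r) * (B : ℝ) ^ r * y ≤ r ^ (2 * r) * √y * (4 ^ r * (B : ℝ) ^ (2 * r)) := by
        gcongr
      rw [hC]
      linarith
    have hlogA : 1 + Real.log A ≤ (1 + 2 / δ) * y ^ (δ / 2) := by
      have h1 : Real.log A ≤ Real.log y :=
        Real.log_le_log hA0 (by rw [hy]; exact_mod_cast hAp.le)
      have h2 : Real.log y ≤ y ^ (δ / 2) / (δ / 2) := Real.log_le_rpow_div hy0.le (by positivity)
      have h3 : 1 ≤ y ^ (δ / 2) := Real.one_le_rpow hy1.le (by positivity)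
      have h4 : y ^ (δ / 2) / (δ / 2) = 2 / δ * y ^ (δ / 2) := by field_simp
      linarith
    have hlogA0 : 0 ≤ 1 + Real.log A := by
      have : 0 ≤ Real.log A := Real.log_natCast_nonneg A
      linarith
    have hsmall : 2 * (1 + Real.log A) * (C * √y) ≤ (A * X) * (η / 2) ^ (2 * r) := by
      have h1 : y ^ (-(δ / 2)) * (8 * C * (1 + 2 / δ)) ≤ (η / 2) ^ (2 * r) := by
        rw [← le_div_iff₀ (by positivity)]
        exact hyκ.trans (min_le_right _ _)
      have h2 : y ^ (1 / 2 + δ) * y ^ (-(δ / 2)) = √y * y ^ (δ / 2) := by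
        rw [Real.sqrt_eq_rpow, ← Real.rpow_add hy0, ← Real.rpow_add hy0]; congr 1; ring
      calc 2 * (1 + Real.log A) * (C * √y) ≤ 2 * ((1 + 2 / δ) * y ^ (δ / 2)) * (C * √y) := by gcongr
        _ = 2 * (1 + 2 / δ) * C * (√y * y ^ (δ / 2)) := by ring
        _ = (y ^ (1 / 2 + δ) / 4) * (y ^ (-(δ / 2)) * (8 * C * (1 + 2 / δ))) := by rw [← h2]; ring
        _ ≤ (A * X) * (η / 2) ^ (2 * r) := by gcongr
    have hpow : W ^ (2 * r) ≤ ((A * X * B) * (η / 2)) ^ (2 * r) := by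
      have hsplit : ((A : ℝ) * X) ^ (2 * (r - 1)) * ((A * X) * (A * X)) = (A * X) ^ (2 * r) := by
        rw [← sq, ← pow_add]; congr 1; omega
      calc W ^ (2 * r) ≤ ((A * X : ℕ) : ℝ) ^ (2 * (r - 1)) * (2 * (A * X * (1 + Real.log A)) *
            (C * √y * (B : ℝ) ^ (2 * r))) := by
            refine hW.trans ?_
            gcongr
        _ = ((A : ℝ) * X) ^ (2 * (r - 1)) * ((A * X) * (2 * (1 + Real.log A) * (C * √y))) *
            (B : ℝ) ^ (2 * r) := by push_cast; ring
        _ ≤ ((A : ℝ) * X) ^ (2 * (r - 1)) * ((A * X) * ((A * X) * (η / 2) ^ (2 * r))) *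
            (B : ℝ) ^ (2 * r) := by gcongr
        _ = (((A : ℝ) * X) ^ (2 * (r - 1)) * ((A * X) * (A * X))) * (η / 2) ^ (2 * r) *
            (B : ℝ) ^ (2 * r) := by ring
        _ = _ := by rw [hsplit]; simp only [mul_pow]; ring
    exact le_of_pow_le_pow_left₀ (by omega) (by positivity) hpow
  have hAB : 2 * (A * B : ℝ) ≤ X * (η / 2) := by
    have h1 : y ^ (-(δ / 2)) ≤ η / 8 := hyκ.trans (min_le_left _ _)
    have h2 : y ^ (1 / 4 + δ / 2) = y ^ (1 / 4 + δ) * y ^ (-(δ / 2)) := by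
      rw [← Real.rpow_add hy0]; congr 1; ring
    calc 2 * (A * B : ℝ) ≤ 2 * (y ^ (1 / 4 : ℝ) * y ^ (1 / (2 * (r : ℝ)))) := by gcongr
      _ ≤ 2 * (y ^ (1 / 4 : ℝ) * y ^ (δ / 2)) := by
          gcongr
          exact hy1.le
      _ = 2 * (y ^ (1 / 4 + δ) * y ^ (-(δ / 2))) := by rw [← h2, ← Real.rpow_add hy0]
      _ ≤ 2 * (y ^ (1 / 4 + δ) * (η / 8)) := by gcongr
      _ = (y ^ (1 / 4 + δ) / 2) * (η / 2) := by ring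
      _ ≤ X * (η / 2) := by gcongr
  have hABpos : 0 < (A * B : ℝ) := by positivity
  refine le_of_mul_le_mul_left (hT.trans ?_) hABpos
  calc W + 2 * (A * B : ℝ) ^ 2 ≤ (A * X * B) * (η / 2) + (A * B) * (2 * (A * B)) := by
        rw [sq]; linarith
    _ ≤ (A * X * B) * (η / 2) + (A * B) * (X * (η / 2)) := by gcongr
    _ = A * B * (η * X) := by ring

end BurgessAsymptotic

section Mertens

open Finset ArithmeticFunction

theorem sum_vonMangoldt_mul_div (n : ℕ) :
    ∑ k ∈ Ioc 0 n, Λ k * ((n / k : ℕ) : ℝ) = Real.log (n.factorial : ℝ) := by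
  rw [← ArithmeticFunction.sum_Ioc_mul_zeta_eq_sum, vonMangoldt_mul_zeta]
  induction n with
  | zero => simp
  | succ n ih =>
    rw [← Finset.insert_Ioc_right_eq_Ioc_add_one (by omega), sum_insert (by simp), ih,
      Nat.factorial_succ, Nat.cast_mul, Real.log_mul (by positivity) (by positivity), log_apply]

theorem abs_sum_vonMangoldt_div_sub_le {n : ℕ} (hn : 1 ≤ n) :
    |∑ k ∈ Ioc 0 n, (Λ k / k - (k : ℝ)⁻¹)| ≤ 6 := by
  have hn0 : (0 : ℝ) < n := by exact_mod_cast hn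
  have hid := sum_vonMangoldt_mul_div n
  have hpsi : ∑ k ∈ Ioc 0 n, Λ k ≤ 6 * n := by
    have h := Chebyshev.psi_le_const_mul_self hn0.le
    rw [Chebyshev.psi, Nat.floor_natCast] at h
    have h4 : Real.log 4 ≤ 2 := by
      rw [show (4 : ℝ) = 2 ^ 2 by norm_num, Real.log_pow]
      have := Real.log_two_lt_d9
      push_cast; linarith
    nlinarith
  have hup : Real.log (n.factorial : ℝ) ≤ n * ∑ k ∈ Ioc 0 n, Λ k / k := by
    rw [← hid, mul_sum]
    refine sum_le_sum fun k hk => ?_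
    have : ((n / k : ℕ) : ℝ) ≤ n / k := Nat.cast_div_le
    calc Λ k * ((n / k : ℕ) : ℝ) ≤ Λ k * (n / k) := by gcongr
      _ = n * (Λ k / k) := by ring
  have hlow : n * ∑ k ∈ Ioc 0 n, Λ k / k ≤ Real.log (n.factorial : ℝ) + 6 * n := by
    rw [← hid]
    refine le_trans ?_ (add_le_add_right hpsi _)
    rw [mul_sum, ← sum_add_distrib]
    refine sum_le_sum fun k hk => ?_
    have hk0 : 0 < k := (mem_Ioc.1 hk).1
    have h1 : (n : ℝ) / k ≤ ((n / k : ℕ) : ℝ) + 1 := by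
      rw [← Nat.floor_div_eq_div (K := ℝ)]
      exact (Nat.lt_floor_add_one _).le
    calc n * (Λ k / k) = Λ k * (n / k) := by ring
      _ ≤ Λ k * (((n / k : ℕ) : ℝ) + 1) := by gcongr
      _ = _ := by ring
  have hfac : Real.log (n.factorial : ℝ) ≤ n * Real.log n := by
    rw [← Real.log_pow]
    apply Real.log_le_log (by positivity)
    exact_mod_cast Nat.factorial_le_pow n
  have hst : n * Real.log n - n ≤ Real.log (n.factorial : ℝ) := by
    have h := Stirling.le_log_factorial_stirling (n := n) (by omega)
    have h1 : 0 ≤ Real.log n := Real.log_natCast_nonneg n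
    have h2 : 0 ≤ Real.log (2 * Real.pi) := Real.log_nonneg (by nlinarith [Real.pi_gt_three])
    linarith
  have hH1 := log_add_one_le_harmonic n
  have hH2 := harmonic_le_one_add_log n
  have hHe : ((harmonic n : ℚ) : ℝ) = ∑ k ∈ Ioc 0 n, (k : ℝ)⁻¹ := by
    rw [harmonic_eq_sum_Icc]; push_cast; rfl
  rw [hHe] at hH1 hH2
  have hlm : Real.log n ≤ Real.log ((n + 1 : ℕ) : ℝ) := by gcongr; omega
  rw [sum_sub_distrib]
  have a1 : Real.log n - 1 ≤ ∑ k ∈ Ioc 0 n, Λ k / k := by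
    refine le_of_mul_le_mul_left ?_ hn0
    linarith
  have a2 : ∑ k ∈ Ioc 0 n, Λ k / k ≤ Real.log n + 6 := by
    refine le_of_mul_le_mul_left ?_ hn0
    linarith
  rw [abs_le]
  constructor <;> linarith

theorem inv_mul_log_le_log_log_sub {x : ℕ} (hx : 2 ≤ x) :
    ((x : ℝ) + 1)⁻¹ / Real.log (x + 1) ≤
      Real.log (Real.log (x + 1)) - Real.log (Real.log x) := by
  have hx2 : (2 : ℝ) ≤ x := by exact_mod_cast hx
  have hl : 0 < Real.log x := Real.log_pos (by linarith)
  have hl' : 0 < Real.log (x + 1) := Real.log_pos (by linarith)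
  have h1 : ((x : ℝ) + 1)⁻¹ ≤ Real.log (x + 1) - Real.log x := by
    have := Real.one_sub_inv_le_log_of_pos (x := ((x : ℝ) + 1) / x) (by positivity)
    rw [Real.log_div (by positivity) (by positivity)] at this
    refine le_trans (le_of_eq ?_) this
    field_simp; ring
  have h2 := Real.one_sub_inv_le_log_of_pos (x := Real.log (x + 1) / Real.log x) (by positivity)
  rw [Real.log_div (by positivity) (by positivity)] at h2
  refine le_trans ?_ h2
  rw [inv_div, div_le_iff₀ hl']
  refine h1.trans (le_of_eq ?_)
  field_simp

theorem sum_vonMangoldt_div_mul_log_le {y x : ℕ} (hy : 2 ≤ y) (hyx : y ≤ x) :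
    ∑ k ∈ Ioc y x, Λ k / k / Real.log k ≤
      Real.log (Real.log x) - Real.log (Real.log y) +
        (∑ k ∈ Ioc 0 x, (Λ k / k - (k : ℝ)⁻¹)) / Real.log x -
        (∑ k ∈ Ioc 0 y, (Λ k / k - (k : ℝ)⁻¹)) / Real.log y +
        6 * (1 / Real.log y - 1 / Real.log x) := by
  induction x, hyx using Nat.le_induction with
  | base => simp
  | succ x hyx ih =>
    have hx2 : (2 : ℝ) ≤ x := by exact_mod_cast hy.trans hyx
    have hl : 0 < Real.log x := Real.log_pos (by linarith)
    have hll : Real.log x ≤ Real.log (x + 1) := Real.log_le_log (by linarith) (by linarith)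
    have hl' : 0 < Real.log (x + 1) := by linarith
    have he := (abs_le.1 (abs_sum_vonMangoldt_div_sub_le (n := x) (by omega))).2
    have hs := inv_mul_log_le_log_log_sub (hy.trans hyx)
    have hinv : 1 / Real.log (x + 1) ≤ 1 / Real.log x := one_div_le_one_div_of_le hl hll
    rw [← Finset.insert_Ioc_right_eq_Ioc_add_one (by omega), sum_insert (by simp),
      ← Finset.insert_Ioc_right_eq_Ioc_add_one (a := 0) (by omega), sum_insert (by simp)]
    push_cast
    set e := ∑ k ∈ Ioc 0 x, (Λ k / k - (k : ℝ)⁻¹)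
    set ℓ := Real.log x
    set ℓ' := Real.log (x + 1)
    have key : e * (1 / ℓ - 1 / ℓ') ≤ 6 * (1 / ℓ - 1 / ℓ') := by
      gcongr
    have e1 : (Λ (x + 1) / (x + 1) - ((x : ℝ) + 1)⁻¹ + e) / ℓ' =
      Λ (x + 1) / (x + 1) / ℓ' - ((x : ℝ) + 1)⁻¹ / ℓ' + e * (1 / ℓ') := by ring
    have e2 : e / ℓ = e * (1 / ℓ) := by ring
    rw [e1]
    rw [e2] at ih
    linarith

theorem sum_prime_inv_le {y x : ℕ} (hy : 2 ≤ y) (hyx : y ≤ x) :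
    ∑ q ∈ (Ioc y x).filter Nat.Prime, (q : ℝ)⁻¹ ≤
      Real.log (Real.log x) - Real.log (Real.log y) + 12 / Real.log y := by
  have hy2 : (2 : ℝ) ≤ y := by exact_mod_cast hy
  have hl : 0 < Real.log y := Real.log_pos (by linarith)
  have hx2 : (2 : ℝ) ≤ x := by exact_mod_cast hy.trans hyx
  have hl' : 0 < Real.log x := Real.log_pos (by linarith)
  have h1 := (abs_le.1 (abs_sum_vonMangoldt_div_sub_le (n := x) (by omega))).2
  have h2 := (abs_le.1 (abs_sum_vonMangoldt_div_sub_le (n := y) (by omega))).1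
  have h := sum_vonMangoldt_div_mul_log_le hy hyx
  have h3 : (∑ k ∈ Ioc 0 x, (Λ k / k - (k : ℝ)⁻¹)) / Real.log x ≤ 6 / Real.log x := by gcongr
  have h4 : (-6) / Real.log y ≤ (∑ k ∈ Ioc 0 y, (Λ k / k - (k : ℝ)⁻¹)) / Real.log y := by gcongr
  have h5 : ∑ q ∈ (Ioc y x).filter Nat.Prime, (q : ℝ)⁻¹ ≤
      ∑ k ∈ Ioc y x, Λ k / k / Real.log k := by
    rw [sum_filter]
    refine sum_le_sum fun k hk => ?_
    have hk2 : 2 ≤ k := by have := (mem_Ioc.1 hk).1; omega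
    have hlk : 0 < Real.log k := Real.log_pos (by exact_mod_cast hk2)
    split_ifs with hp
    · rw [vonMangoldt_apply_prime hp]
      apply le_of_eq; field_simp
    · have := vonMangoldt_nonneg (n := k)
      positivity
  have e1 : 6 * (1 / Real.log y - 1 / Real.log x) = 6 / Real.log y - 6 / Real.log x := by ring
  have e2 : -6 / Real.log y = - (6 / Real.log y) := by ring
  have e3 : 12 / Real.log y = 2 * (6 / Real.log y) := by ring
  linarith

end Mertens

section Katai

open Finset

theorem sum_sq_card_filter_dvd_sub_le (P : Finset ℕ) (hP : ∀ q ∈ P, q.Prime) (N : ℕ) :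
    ∑ n ∈ Ioc 0 N, (((P.filter (· ∣ n)).card : ℝ) - ∑ q ∈ P, (q : ℝ)⁻¹) ^ 2 ≤
      N * ∑ q ∈ P, (q : ℝ)⁻¹ + 2 * (∑ q ∈ P, (q : ℝ)⁻¹) * P.card := by
  set L : ℝ := ∑ q ∈ P, (q : ℝ)⁻¹ with hL
  have hL0 : 0 ≤ L := sum_nonneg fun q _ => by positivity
  have ha : ∀ n, ((P.filter (· ∣ n)).card : ℝ) = ∑ q ∈ P, if q ∣ n then (1 : ℝ) else 0 := by
    intro n; rw [card_filter]; push_cast; rfl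
  have h1 : N * L - P.card ≤ ∑ n ∈ Ioc 0 N, ((P.filter (· ∣ n)).card : ℝ) := by
    simp_rw [ha]
    rw [sum_comm, mul_sum, card_eq_sum_ones, Nat.cast_sum, ← sum_sub_distrib]
    refine sum_le_sum fun q hq => ?_
    rw [← sum_filter, sum_const, Nat.Ioc_filter_dvd_card_eq_div, nsmul_eq_mul, mul_one,
      ← Nat.floor_div_eq_div (K := ℝ)]
    have := (Nat.lt_floor_add_one ((N : ℝ) / q)).le
    push_cast
    rw [← div_eq_mul_inv]
    linarith
  have h2 : ∑ n ∈ Ioc 0 N, ((P.filter (· ∣ n)).card : ℝ) ^ 2 ≤ N * L ^ 2 + N * L := by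
    have e : ∀ n, ((P.filter (· ∣ n)).card : ℝ) ^ 2 =
        ∑ q ∈ P, ∑ r ∈ P, if q ∣ n ∧ r ∣ n then (1 : ℝ) else 0 := by
      intro n
      rw [sq, ha, sum_mul_sum]
      refine sum_congr rfl fun q _ => sum_congr rfl fun r _ => ?_
      by_cases h : q ∣ n <;> by_cases h' : r ∣ n <;> simp [h, h']
    simp_rw [e]
    rw [sum_comm]
    have e2 : N * L ^ 2 + N * L =
        ∑ q ∈ P, ∑ r ∈ P, ((N : ℝ) * ((q : ℝ)⁻¹ * (r : ℝ)⁻¹) + if q = r then N * (q : ℝ)⁻¹ else 0) := by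
      simp_rw [sum_add_distrib, ← mul_sum, sq]
      congr 1
      · rw [hL, sum_mul]
      · rw [hL, mul_sum]
        refine sum_congr rfl fun q hq => ?_
        simp [hq]
    rw [e2]
    refine sum_le_sum fun q hq => ?_
    rw [sum_comm]
    refine sum_le_sum fun r hr => ?_
    rw [← sum_filter, sum_const, nsmul_eq_mul, mul_one]
    by_cases hqr : q = r
    · subst hqr
      simp only [and_self, if_true]
      rw [Nat.Ioc_filter_dvd_card_eq_div]
      have : ((N / q : ℕ) : ℝ) ≤ N / q := Nat.cast_div_le
      rw [div_eq_mul_inv] at this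
      have h0 : (0 : ℝ) ≤ N * ((q : ℝ)⁻¹ * (q : ℝ)⁻¹) := by positivity
      linarith
    · have hc : Nat.Coprime q r := (Nat.coprime_primes (hP q hq) (hP r hr)).2 hqr
      have : ∀ n, (q ∣ n ∧ r ∣ n) ↔ q * r ∣ n := fun n =>
        ⟨fun h => hc.mul_dvd_of_dvd_of_dvd h.1 h.2,
          fun h => ⟨(dvd_mul_right _ _).trans h, (dvd_mul_left _ _).trans h⟩⟩
      simp_rw [this]
      rw [Nat.Ioc_filter_dvd_card_eq_div, if_neg hqr, add_zero, ← mul_inv, ← div_eq_mul_inv]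
      refine Nat.cast_div_le.trans (le_of_eq ?_)
      push_cast; rfl
  have e3 : ∑ n ∈ Ioc 0 N, (((P.filter (· ∣ n)).card : ℝ) - L) ^ 2 =
      ∑ n ∈ Ioc 0 N, ((P.filter (· ∣ n)).card : ℝ) ^ 2 -
        2 * L * ∑ n ∈ Ioc 0 N, ((P.filter (· ∣ n)).card : ℝ) + N * L ^ 2 := by
    simp_rw [sub_sq, sum_add_distrib, sum_sub_distrib]
    rw [mul_sum, sum_const, Nat.card_Ioc, nsmul_eq_mul]
    congr 2
    exact sum_congr rfl fun n _ => by ring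
  rw [e3]
  have := mul_le_mul_of_nonneg_left h1 (by positivity : 0 ≤ 2 * L)
  nlinarith

theorem norm_sum_pow_le {w : ℂ} (hw : ‖w‖ = 1) (hw1 : w ≠ 1) (M : ℕ) :
    ‖∑ m ∈ Ioc 0 M, w ^ m‖ ≤ 2 / ‖1 - w‖ := by
  have hpos : 0 < ‖1 - w‖ := norm_pos_iff.2 (sub_ne_zero.2 (Ne.symm hw1))
  have h : (∑ m ∈ Ioc 0 M, w ^ m) * (1 - w) = w * (1 - w ^ M) := by
    induction M with
    | zero => simp
    | succ M ih =>
      rw [← Finset.insert_Ioc_right_eq_Ioc_add_one (by omega), sum_insert (by simp), add_mul, ih]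
      ring
  rw [le_div_iff₀ hpos, ← norm_mul, h, norm_mul, hw, one_mul]
  refine (norm_sub_le _ _).trans ?_
  rw [norm_pow, hw]; norm_num

theorem sum_filter_dvd_Ioc {M : Type*} [AddCommMonoid M] (g : ℕ → M) {q : ℕ} (hq : 0 < q) (N : ℕ) :
    ∑ n ∈ (Ioc 0 N).filter (q ∣ ·), g n = ∑ m ∈ Ioc 0 N, if q * m ≤ N then g (q * m) else 0 := by
  rw [← sum_filter]
  symm
  refine sum_nbij (fun m => q * m) ?_ ?_ ?_ ?_
  · intro m hm
    simp only [mem_filter, mem_Ioc] at hm ⊢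
    exact ⟨⟨Nat.mul_pos hq hm.1.1, hm.2⟩, dvd_mul_right _ _⟩
  · intro a _ b _ h
    exact Nat.eq_of_mul_eq_mul_left hq h
  · intro n hn
    simp only [coe_filter, mem_Ioc, Set.mem_ofPred_eq] at hn
    obtain ⟨⟨h0, h1⟩, m, rfl⟩ := hn
    refine ⟨m, ?_, rfl⟩
    simp only [coe_filter, mem_Ioc, Set.mem_ofPred_eq]
    exact ⟨⟨Nat.pos_of_mul_pos_left h0, (Nat.le_mul_of_pos_left m hq).trans h1⟩, h1⟩
  · intro m _; rfl

theorem sum_norm_sq_sum_pow_le {z : ℂ} (hz : ‖z‖ = 1) (hz1 : ∀ k : ℕ, 0 < k → z ^ k ≠ 1)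
    (P : Finset ℕ) (hP : ∀ q ∈ P, 0 < q) (c : ℕ → ℂ) (hc : ∀ n, ‖c n‖ ≤ 1) (N : ℕ) :
    ∑ m ∈ Ioc 0 N, ‖∑ q ∈ P, if q * m ≤ N then c q * z ^ (q * m) else 0‖ ^ 2 ≤
      N * ∑ q ∈ P, (q : ℝ)⁻¹ + ∑ q ∈ P, ∑ r ∈ P, 2 / ‖1 - z ^ q * (starRingEnd ℂ) z ^ r‖ := by
  have hzc : z * (starRingEnd ℂ) z = 1 := by
    rw [Complex.mul_conj, Complex.normSq_eq_norm_sq, hz]; norm_num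
  have hstar : ‖(starRingEnd ℂ) z‖ = 1 := by rw [Complex.norm_conj, hz]
  have hne : ∀ q r : ℕ, q ≠ r → z ^ q * (starRingEnd ℂ) z ^ r ≠ 1 := by
    have key : ∀ q r : ℕ, r < q → z ^ q * (starRingEnd ℂ) z ^ r = z ^ (q - r) := by
      intro q r h
      obtain ⟨k, rfl⟩ := Nat.exists_eq_add_of_lt h
      rw [show r + k + 1 - r = k + 1 by omega, show r + k + 1 = (k + 1) + r by omega, pow_add,
        mul_assoc, ← mul_pow, hzc, one_pow, mul_one]
    intro q r h
    rcases lt_or_gt_of_ne h with h | h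
    · intro h1
      have := congrArg (starRingEnd ℂ) h1
      rw [map_mul, map_pow, map_pow, Complex.conj_conj, map_one, mul_comm, key r q h] at this
      exact hz1 _ (by omega) this
    · rw [key q r h]; exact hz1 _ (by omega)
  have hexp : ∀ m, ((‖∑ q ∈ P, if q * m ≤ N then c q * z ^ (q * m) else 0‖ ^ 2 : ℝ) : ℂ) =
      ∑ q ∈ P, ∑ r ∈ P, if q * m ≤ N ∧ r * m ≤ N then
        c q * (starRingEnd ℂ) (c r) * (z ^ q * (starRingEnd ℂ) z ^ r) ^ m else 0 := by
    intro m
    rw [Complex.ofReal_pow, ← Complex.mul_conj', map_sum, sum_mul_sum]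
    refine sum_congr rfl fun q _ => sum_congr rfl fun r _ => ?_
    by_cases h : q * m ≤ N <;> by_cases h' : r * m ≤ N <;> simp [h, h']
    rw [mul_pow, pow_mul, pow_mul]; ring
  have hinner : ∀ q ∈ P, ∀ r ∈ P, ‖∑ m ∈ Ioc 0 N, (if q * m ≤ N ∧ r * m ≤ N then
        c q * (starRingEnd ℂ) (c r) * (z ^ q * (starRingEnd ℂ) z ^ r) ^ m else 0)‖ ≤
      (if q = r then N * (q : ℝ)⁻¹ else 0) + 2 / ‖1 - z ^ q * (starRingEnd ℂ) z ^ r‖ := by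
    intro q hq r hr
    have hq0 := hP q hq
    have hr0 := hP r hr
    have hset : (Ioc 0 N).filter (fun m => q * m ≤ N ∧ r * m ≤ N) = Ioc 0 (min (N / q) (N / r)) := by
      ext m
      simp only [mem_filter, mem_Ioc, le_min_iff, Nat.le_div_iff_mul_le hq0,
        Nat.le_div_iff_mul_le hr0, mul_comm m]
      constructor
      · rintro ⟨⟨h1, _⟩, h3⟩; exact ⟨h1, h3⟩
      · rintro ⟨h1, h2, h3⟩
        exact ⟨⟨h1, (Nat.le_mul_of_pos_left m hq0).trans h2⟩, h2, h3⟩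
    rw [← sum_filter, hset, ← mul_sum, norm_mul, norm_mul, Complex.norm_conj]
    have hcc : ‖c q‖ * ‖c r‖ ≤ 1 := mul_le_one₀ (hc q) (norm_nonneg _) (hc r)
    refine (mul_le_of_le_one_left (norm_nonneg _) hcc).trans ?_
    by_cases h : q = r
    · subst h
      have h2 : 0 ≤ 2 / ‖1 - z ^ q * (starRingEnd ℂ) z ^ q‖ := by positivity
      rw [if_pos rfl]
      refine le_trans ?_ (le_add_of_nonneg_right h2)
      rw [← mul_pow, hzc, one_pow]
      simp only [one_pow, sum_const, min_self, Nat.card_Ioc, tsub_zero, nsmul_eq_mul, mul_one]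
      rw [Complex.norm_natCast, ← div_eq_mul_inv]
      exact Nat.cast_div_le
    · rw [if_neg h, zero_add]
      refine norm_sum_pow_le ?_ (hne q r h) _
      rw [norm_mul, norm_pow, norm_pow, hz, hstar]; norm_num
  have hR : (∑ m ∈ Ioc 0 N, ‖∑ q ∈ P, if q * m ≤ N then c q * z ^ (q * m) else 0‖ ^ 2 : ℝ) =
      ‖∑ q ∈ P, ∑ r ∈ P, ∑ m ∈ Ioc 0 N, (if q * m ≤ N ∧ r * m ≤ N then
        c q * (starRingEnd ℂ) (c r) * (z ^ q * (starRingEnd ℂ) z ^ r) ^ m else 0)‖ := by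
    have e : (∑ q ∈ P, ∑ r ∈ P, ∑ m ∈ Ioc 0 N, (if q * m ≤ N ∧ r * m ≤ N then
        c q * (starRingEnd ℂ) (c r) * (z ^ q * (starRingEnd ℂ) z ^ r) ^ m else 0)) =
        ((∑ m ∈ Ioc 0 N, ‖∑ q ∈ P, if q * m ≤ N then c q * z ^ (q * m) else 0‖ ^ 2 : ℝ) : ℂ) := by
      rw [Complex.ofReal_sum]
      simp_rw [hexp]
      symm
      rw [sum_comm]
      exact sum_congr rfl fun q _ => sum_comm
    rw [e, Complex.norm_real, Real.norm_of_nonneg (sum_nonneg fun _ _ => by positivity)]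
  rw [hR]
  have e2 : N * ∑ q ∈ P, (q : ℝ)⁻¹ = ∑ q ∈ P, ∑ r ∈ P, if q = r then N * (q : ℝ)⁻¹ else 0 := by
    rw [mul_sum]
    refine sum_congr rfl fun q hq => ?_
    simp [hq]
  rw [e2, ← sum_add_distrib]
  refine (norm_sum_le _ _).trans (sum_le_sum fun q hq => ?_)
  rw [← sum_add_distrib]
  exact (norm_sum_le _ _).trans (sum_le_sum fun r hr => hinner q hq r hr)

theorem exists_primes_sum_inv_ge (A : ℝ) :
    ∃ P : Finset ℕ, (∀ q ∈ P, q.Prime) ∧ A ≤ ∑ q ∈ P, (q : ℝ)⁻¹ := by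
  by_contra! h
  refine Nat.Primes.not_summable_one_div (summable_of_sum_le (c := A) (fun _ => by positivity) ?_)
  intro u
  have := h (u.image fun x : Nat.Primes => (x : ℕ)) (by
    intro q hq
    obtain ⟨x, _, rfl⟩ := mem_image.1 hq
    exact x.2)
  have hinj : Set.InjOn (fun x : Nat.Primes => (x : ℕ)) (u : Set Nat.Primes) :=
    fun x _ y _ hxy => Nat.Primes.coe_nat_injective hxy
  rw [sum_image hinj] at this
  simpa using this.le

/-- Kátai's orthogonality criterion (after Daboussi) for the exponential phases: a bounded
completely multiplicative function is asymptotically orthogonal to `n ↦ z ^ n`, uniformly in the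
multiplicative function. -/
theorem norm_sum_mul_pow_le {z : ℂ} (hz : ‖z‖ = 1) (hz1 : ∀ k : ℕ, 0 < k → z ^ k ≠ 1)
    {η : ℝ} (hη : 0 < η) :
    ∃ K : ℕ, ∀ f : ℕ → ℝ, (∀ m n, f (m * n) = f m * f n) → (∀ n, |f n| ≤ 1) →
      ∀ N, K ≤ N → ‖∑ n ∈ Ioc 0 N, (f n : ℂ) * z ^ n‖ ≤ η * N := by
  obtain ⟨P, hP, hPL⟩ := exists_primes_sum_inv_ge (9 / η ^ 2)
  set L : ℝ := ∑ q ∈ P, (q : ℝ)⁻¹ with hL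
  have hL0 : 0 < L := lt_of_lt_of_le (by positivity) hPL
  set D : ℝ := ∑ q ∈ P, ∑ r ∈ P, 2 / ‖1 - z ^ q * (starRingEnd ℂ) z ^ r‖ with hD
  refine ⟨max (2 * P.card) ⌈D / L⌉₊, fun f hmul hf N hN => ?_⟩
  have hN1 : 2 * (P.card : ℝ) ≤ N := by exact_mod_cast (le_max_left _ _).trans hN
  have hN2 : D ≤ N * L := by
    rw [← div_le_iff₀ hL0]
    exact (Nat.le_ceil _).trans (by exact_mod_cast (le_max_right _ _).trans hN)
  have hN0 : (0 : ℝ) ≤ N := Nat.cast_nonneg N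
  set a : ℕ → ℝ := fun n => ((P.filter (· ∣ n)).card : ℝ) with ha
  have hfn : ∀ n, ‖(f n : ℂ)‖ ≤ 1 := fun n => by rw [Complex.norm_real]; exact hf n
  set T : ℂ := ∑ n ∈ Ioc 0 N, (f n : ℂ) * z ^ n * (a n : ℂ) with hT
  have hcardN : ((Ioc 0 N).card : ℝ) = N := by simp
  have h1 : ‖∑ n ∈ Ioc 0 N, (f n : ℂ) * z ^ n * ((L - a n : ℝ) : ℂ)‖ ^ 2 ≤ 2 * N ^ 2 * L := by
    have hTK := sum_sq_card_filter_dvd_sub_le P hP N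
    rw [← hL] at hTK
    have hle : ‖∑ n ∈ Ioc 0 N, (f n : ℂ) * z ^ n * ((L - a n : ℝ) : ℂ)‖ ≤
        ∑ n ∈ Ioc 0 N, |a n - L| := by
      refine (norm_sum_le _ _).trans (sum_le_sum fun n _ => ?_)
      rw [norm_mul, norm_mul, norm_pow, hz, one_pow, mul_one, Complex.norm_real (L - a n),
        Real.norm_eq_abs, abs_sub_comm]
      exact mul_le_of_le_one_left (abs_nonneg _) (hfn n)
    calc _ ≤ (∑ n ∈ Ioc 0 N, |a n - L|) ^ 2 := by gcongr
      _ ≤ (Ioc 0 N).card * ∑ n ∈ Ioc 0 N, |a n - L| ^ 2 := sq_sum_le_card_mul_sum_sq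
      _ = N * ∑ n ∈ Ioc 0 N, (a n - L) ^ 2 := by simp_rw [hcardN, sq_abs]
      _ ≤ N * (N * L + 2 * L * P.card) := by gcongr
      _ ≤ 2 * N ^ 2 * L := by nlinarith [mul_nonneg hN0 hL0.le]
  have hT1 : T = ∑ m ∈ Ioc 0 N, (f m : ℂ) *
      ∑ q ∈ P, if q * m ≤ N then (f q : ℂ) * z ^ (q * m) else 0 := by
    have e : T = ∑ q ∈ P, ∑ n ∈ (Ioc 0 N).filter (q ∣ ·), (f n : ℂ) * z ^ n := by
      simp_rw [sum_filter]
      rw [sum_comm, hT]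
      refine sum_congr rfl fun n _ => ?_
      rw [← sum_filter, sum_const, nsmul_eq_mul, mul_comm]
      simp [ha]
    rw [e]
    simp_rw [mul_sum]
    rw [sum_comm]
    refine sum_congr rfl fun q hq => ?_
    rw [sum_filter_dvd_Ioc _ (hP q hq).pos]
    refine sum_congr rfl fun m _ => ?_
    split_ifs
    · rw [hmul]; push_cast; ring
    · simp
  have h2 : ‖T‖ ^ 2 ≤ 2 * N ^ 2 * L := by
    have hS := sum_norm_sq_sum_pow_le hz hz1 P (fun q hq => (hP q hq).pos) (fun n => (f n : ℂ)) hfn N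
    have hle : ‖T‖ ≤ ∑ m ∈ Ioc 0 N, ‖∑ q ∈ P, if q * m ≤ N then (f q : ℂ) * z ^ (q * m) else 0‖ := by
      rw [hT1]
      refine (norm_sum_le _ _).trans (sum_le_sum fun n _ => ?_)
      rw [norm_mul]
      exact mul_le_of_le_one_left (norm_nonneg _) (hfn n)
    calc _ ≤ (∑ m ∈ Ioc 0 N, ‖∑ q ∈ P, if q * m ≤ N then (f q : ℂ) * z ^ (q * m) else 0‖) ^ 2 := by
          gcongr
      _ ≤ (Ioc 0 N).card * ∑ m ∈ Ioc 0 N,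
          ‖∑ q ∈ P, if q * m ≤ N then (f q : ℂ) * z ^ (q * m) else 0‖ ^ 2 :=
          sq_sum_le_card_mul_sum_sq
      _ ≤ N * (N * L + D) := by rw [hcardN]; gcongr
      _ ≤ 2 * N ^ 2 * L := by nlinarith
  set U := ∑ n ∈ Ioc 0 N, (f n : ℂ) * z ^ n * ((L - a n : ℝ) : ℂ) with hU
  set S := ∑ n ∈ Ioc 0 N, (f n : ℂ) * z ^ n with hS
  have hsum : (L : ℂ) * S = U + T := by
    rw [hU, hT, hS, ← sum_add_distrib, mul_sum]
    refine sum_congr rfl fun n _ => ?_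
    push_cast; ring
  have h3 : (L * ‖S‖) ^ 2 ≤ 8 * N ^ 2 * L := by
    have : L * ‖S‖ ≤ ‖U‖ + ‖T‖ := by
      have hLn : ‖(L : ℂ)‖ = L := by rw [Complex.norm_real, Real.norm_of_nonneg hL0.le]
      calc L * ‖S‖ = ‖(L : ℂ) * S‖ := by rw [norm_mul, hLn]
        _ ≤ _ := by rw [hsum]; exact norm_add_le _ _
    calc (L * ‖S‖) ^ 2 ≤ (‖U‖ + ‖T‖) ^ 2 := by gcongr
      _ ≤ 2 * (‖U‖ ^ 2 + ‖T‖ ^ 2) := by nlinarith [sq_nonneg (‖U‖ - ‖T‖)]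
      _ ≤ _ := by linarith
  refine le_of_sq_le_sq ?_ (by positivity)
  have h4 : L * ‖S‖ ^ 2 ≤ 8 * N ^ 2 := by
    refine le_of_mul_le_mul_left ?_ hL0
    calc _ = (L * ‖S‖) ^ 2 := by ring
      _ ≤ _ := h3
      _ = _ := by ring
  have h5 : 9 / η ^ 2 * ‖S‖ ^ 2 ≤ 8 * N ^ 2 := le_trans (by gcongr) h4
  rw [div_mul_eq_mul_div, div_le_iff₀ (by positivity)] at h5
  nlinarith [sq_nonneg (η * N)]

end Katai

section Weyl

open Finset MeasureTheory

/-- Completely multiplicative functions bounded by one do not correlate with the test function `h`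
along the sequence `θ m + u` on the circle, beyond the mean of `h`; the rate is uniform in the
multiplicative function. -/
def UncorrelatedAlong (θ u : ℝ) (h : C(AddCircle (1 : ℝ), ℂ)) : Prop :=
  ∀ η : ℝ, 0 < η → ∃ K : ℕ, ∀ f : ℕ → ℝ, (∀ m n, f (m * n) = f m * f n) → (∀ n, |f n| ≤ 1) →
    ∀ N, K ≤ N → ‖∑ m ∈ Ioc 0 N, (f m : ℂ) * h ((θ * m + u : ℝ) : AddCircle (1 : ℝ)) -
      (∫ t, h t ∂AddCircle.haarAddCircle) * ∑ m ∈ Ioc 0 N, (f m : ℂ)‖ ≤ η * N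

theorem uncorrelatedAlong_fourier {θ : ℝ} (hθ : Irrational θ) (u : ℝ) (k : ℤ) :
    UncorrelatedAlong θ u (fourier k) := by
  intro η hη
  rcases eq_or_ne k 0 with rfl | hk
  · refine ⟨0, fun f _ _ N _ => ?_⟩
    simp only [fourier_zero, mul_one, integral_const, probReal_univ, one_smul, one_mul, sub_self,
      norm_zero]
    positivity
  have hintegral : ∫ t : AddCircle (1 : ℝ), fourier k t ∂AddCircle.haarAddCircle = 0 :=
    integral_eq_zero_of_add_right_eq_neg (μ := AddCircle.haarAddCircle)
      (fourier_add_half_inv_index hk one_pos)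
  set z : ℂ := Complex.exp ((2 * Real.pi * (k * θ) : ℝ) * Complex.I) with hz
  have hz0 : ‖z‖ = 1 := Complex.norm_exp_ofReal_mul_I _
  have hz1 : ∀ j : ℕ, 0 < j → z ^ j ≠ 1 := by
    intro j hj h
    rw [hz, ← Complex.exp_nat_mul, Complex.exp_eq_one_iff] at h
    obtain ⟨n, hn⟩ := h
    have h2 : ((j : ℂ) * (k * θ)) = n := by
      have hpi : (2 * Real.pi * Complex.I : ℂ) ≠ 0 := Complex.two_pi_I_ne_zero
      refine mul_right_cancel₀ hpi ?_
      rw [← hn]; push_cast; ring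
    have h3 : ((j * k : ℤ) : ℝ) * θ = n := by
      have : ((j : ℝ) * (k * θ)) = n := by exact_mod_cast h2
      rw [← this]; push_cast; ring
    exact (hθ.intCast_mul (m := j * k) (mul_ne_zero (by omega) hk)).ne_int n h3
  obtain ⟨K, hK⟩ := norm_sum_mul_pow_le hz0 hz1 hη
  refine ⟨K, fun f hf hf1 N hN => ?_⟩
  rw [hintegral, zero_mul, sub_zero]
  have e : ∑ m ∈ Ioc 0 N, (f m : ℂ) * fourier k ((θ * m + u : ℝ) : AddCircle (1 : ℝ)) =
      Complex.exp ((2 * Real.pi * (k * u) : ℝ) * Complex.I) * ∑ m ∈ Ioc 0 N, (f m : ℂ) * z ^ m := by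
    rw [mul_sum]
    refine sum_congr rfl fun m _ => ?_
    rw [fourier_coe_apply, hz, ← Complex.exp_nat_mul, mul_left_comm, ← Complex.exp_add]
    congr 2
    push_cast; ring
  rw [e, norm_mul, Complex.norm_exp_ofReal_mul_I, one_mul]
  exact hK f hf hf1 N hN

theorem uncorrelatedAlong_of_mem_span {θ : ℝ} (hθ : Irrational θ) (u : ℝ)
    {h : C(AddCircle (1 : ℝ), ℂ)}
    (hh : h ∈ Submodule.span ℂ (Set.range (@fourier (1 : ℝ)))) : UncorrelatedAlong θ u h := by
  have hI : ∀ g : C(AddCircle (1 : ℝ), ℂ), Integrable g AddCircle.haarAddCircle := fun g =>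
    g.continuous.integrable_of_hasCompactSupport (HasCompactSupport.of_compactSpace _)
  induction hh using Submodule.span_induction with
  | mem x hx =>
    obtain ⟨k, rfl⟩ := hx
    exact uncorrelatedAlong_fourier hθ u k
  | zero =>
    refine fun η hη => ⟨0, fun f _ _ N _ => ?_⟩
    simp only [ContinuousMap.zero_apply, mul_zero, sum_const_zero, integral_zero, zero_mul,
      sub_self, norm_zero]
    positivity
  | add x y _ _ hx hy =>
    intro η hη
    obtain ⟨K₁, h₁⟩ := hx (η / 2) (by positivity)
    obtain ⟨K₂, h₂⟩ := hy (η / 2) (by positivity)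
    refine ⟨max K₁ K₂, fun f hf hf1 N hN => ?_⟩
    have a₁ := h₁ f hf hf1 N ((le_max_left _ _).trans hN)
    have a₂ := h₂ f hf hf1 N ((le_max_right _ _).trans hN)
    simp only [ContinuousMap.add_apply, mul_add, sum_add_distrib]
    rw [integral_add (hI x) (hI y), add_mul, add_sub_add_comm]
    refine (norm_add_le _ _).trans ?_
    linarith
  | smul a x _ hx =>
    intro η hη
    obtain ⟨K, h₁⟩ := hx (η / (‖a‖ + 1)) (by positivity)
    refine ⟨K, fun f hf hf1 N hN => ?_⟩
    have a₁ := h₁ f hf hf1 N hN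
    simp only [ContinuousMap.smul_apply, smul_eq_mul, mul_left_comm _ a, ← mul_sum]
    rw [integral_const_mul, mul_assoc, ← mul_sub, norm_mul]
    calc _ ≤ (‖a‖ + 1) * (η / (‖a‖ + 1) * N) := by gcongr; linarith
      _ = η * N := by field_simp

theorem uncorrelatedAlong {θ : ℝ} (hθ : Irrational θ) (u : ℝ) (h : C(AddCircle (1 : ℝ), ℂ)) :
    UncorrelatedAlong θ u h := by
  intro η hη
  have hI : ∀ g : C(AddCircle (1 : ℝ), ℂ), Integrable g AddCircle.haarAddCircle := fun g =>
    g.continuous.integrable_of_hasCompactSupport (HasCompactSupport.of_compactSpace _)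
  have hmem : h ∈ (Submodule.span ℂ (Set.range (@fourier (1 : ℝ)))).topologicalClosure := by
    rw [span_fourier_closure_eq_top]; trivial
  obtain ⟨g, hg, hd⟩ := Metric.mem_closure_iff.1 hmem (η / 4) (by positivity)
  rw [dist_eq_norm] at hd
  obtain ⟨K, hK⟩ := uncorrelatedAlong_of_mem_span hθ u hg (η / 2) (by positivity)
  refine ⟨K, fun f hf hf1 N hN => ?_⟩
  have a₁ := hK f hf hf1 N hN
  have hfn : ∀ n, ‖(f n : ℂ)‖ ≤ 1 := fun n => by rw [Complex.norm_real]; exact hf1 n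
  have hpt : ∀ t, ‖(h - g) t‖ ≤ η / 4 := fun t => ((h - g).norm_coe_le_norm t).trans hd.le
  have b₁ : ‖∑ m ∈ Ioc 0 N, (f m : ℂ) * (h - g) ((θ * m + u : ℝ) : AddCircle (1 : ℝ))‖ ≤
      η / 4 * N := by
    refine (norm_sum_le_of_le (f := fun m : ℕ => (f m : ℂ) * (h - g) ((θ * m + u : ℝ) : AddCircle (1 : ℝ)))
      (Ioc 0 N) (n := fun _ => η / 4) fun m _ => ?_).trans (by simp [mul_comm])
    rw [norm_mul]
    exact (mul_le_of_le_one_left (norm_nonneg _) (hfn m)).trans (hpt _)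
  have b₂ : ‖(∫ t, (h - g) t ∂AddCircle.haarAddCircle) * ∑ m ∈ Ioc 0 N, (f m : ℂ)‖ ≤
      η / 4 * N := by
    rw [norm_mul]
    have c₁ : ‖∫ t, (h - g) t ∂AddCircle.haarAddCircle‖ ≤ η / 4 := by
      refine (norm_integral_le_of_norm_le_const (Filter.Eventually.of_forall hpt)).trans ?_
      simp
    have c₂ : ‖∑ m ∈ Ioc 0 N, (f m : ℂ)‖ ≤ N := by
      refine (norm_sum_le_of_le (Ioc 0 N) (n := fun _ => (1 : ℝ)) fun m _ => hfn m).trans (by simp)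
    gcongr
  have e : ∑ m ∈ Ioc 0 N, (f m : ℂ) * h ((θ * m + u : ℝ) : AddCircle (1 : ℝ)) -
      (∫ t, h t ∂AddCircle.haarAddCircle) * ∑ m ∈ Ioc 0 N, (f m : ℂ) =
      (∑ m ∈ Ioc 0 N, (f m : ℂ) * g ((θ * m + u : ℝ) : AddCircle (1 : ℝ)) -
      (∫ t, g t ∂AddCircle.haarAddCircle) * ∑ m ∈ Ioc 0 N, (f m : ℂ)) +
      ∑ m ∈ Ioc 0 N, (f m : ℂ) * (h - g) ((θ * m + u : ℝ) : AddCircle (1 : ℝ)) -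
      (∫ t, (h - g) t ∂AddCircle.haarAddCircle) * ∑ m ∈ Ioc 0 N, (f m : ℂ) := by
    simp only [ContinuousMap.sub_apply, mul_sub, sum_sub_distrib]
    rw [integral_sub (hI h) (hI g)]
    ring
  rw [e]
  refine (norm_sub_le _ _).trans ?_
  have := norm_add_le (∑ m ∈ Ioc 0 N, (f m : ℂ) * g ((θ * m + u : ℝ) : AddCircle (1 : ℝ)) -
      (∫ t, g t ∂AddCircle.haarAddCircle) * ∑ m ∈ Ioc 0 N, (f m : ℂ))
      (∑ m ∈ Ioc 0 N, (f m : ℂ) * (h - g) ((θ * m + u : ℝ) : AddCircle (1 : ℝ)))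
  linarith

theorem floor_eq_of_norm_addCircle_lt {α β : ℝ} (hα : 1 < α) {m : ℕ}
    (h : ‖((α⁻¹ * m + (α⁻¹ / 2 - α⁻¹ * β) : ℝ) : AddCircle (1 : ℝ))‖ < α⁻¹ / 2) (hm : β ≤ m) :
    ∃ n : ℕ, 0 < n ∧ ⌊α * n + β⌋ = (m : ℤ) := by
  have hα0 : 0 < α := by linarith
  rw [UnitAddCircle.norm_eq, abs_lt] at h
  set x : ℝ := α⁻¹ * m + (α⁻¹ / 2 - α⁻¹ * β) with hx
  have h1 : α⁻¹ * (m - β) < round x := by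
    have : x = α⁻¹ * (m - β) + α⁻¹ / 2 := by rw [hx]; ring
    linarith [h.2]
  have h2 : (round x : ℝ) < α⁻¹ * (m - β) + α⁻¹ := by
    have : x = α⁻¹ * (m - β) + α⁻¹ / 2 := by rw [hx]; ring
    linarith [h.1]
  have h3 : (0 : ℝ) < round x := lt_of_le_of_lt (mul_nonneg (by positivity) (by linarith)) h1
  obtain ⟨n, hn⟩ := Int.eq_ofNat_of_zero_le (a := round x) (by exact_mod_cast h3.le)
  rw [hn] at h1 h2 h3
  simp only [Int.cast_natCast] at h1 h2 h3
  refine ⟨n, by exact_mod_cast h3, ?_⟩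
  rw [inv_mul_lt_iff₀ hα0] at h1
  have h2' := mul_lt_mul_of_pos_left h2 hα0
  rw [mul_add, mul_inv_cancel_left₀ hα0.ne', mul_inv_cancel₀ hα0.ne'] at h2'
  rw [Int.floor_eq_iff]
  push_cast
  constructor <;> linarith

/-- If a completely multiplicative function bounded by one is constant, equal to `-σ`, on the
Beatty sequence, then its mean value is close to `-σ`, uniformly in the function. -/
theorem abs_sum_add_le_of_beatty {α β : ℝ} (hα1 : 1 < α) (hα : Irrational α) {η : ℝ} (hη : 0 < η) :
    ∃ K : ℕ, ∀ (f : ℕ → ℝ) (σ : ℝ), (∀ m n, f (m * n) = f m * f n) → (∀ n, |f n| ≤ 1) → |σ| ≤ 1 →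
      ∀ M, K ≤ M →
        (∀ m n : ℕ, 0 < n → 0 < m → m ≤ M → ⌊α * n + β⌋ = (m : ℤ) → f m = -σ) →
        |∑ m ∈ Ioc 0 M, f m + σ * M| ≤ η * M := by
  have hα0 : 0 < α := by linarith
  set ρ : ℝ := α⁻¹ / 2 with hρ
  have hρ0 : 0 < ρ := by positivity
  have hρ1 : ρ ≤ 1 := by
    have := inv_le_one_of_one_le₀ hα1.le
    rw [hρ]; linarith
  set g : AddCircle (1 : ℝ) → ℝ := fun t => max 0 (ρ - ‖t‖) with hg
  have hgc : Continuous g := by fun_prop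
  have hg0 : ∀ t, 0 ≤ g t := fun t => le_max_left _ _
  have hg1 : ∀ t, g t ≤ 1 := fun t => max_le zero_le_one (by linarith [norm_nonneg t])
  set c : ℝ := ∫ t, g t ∂AddCircle.haarAddCircle with hc
  have hcpos : 0 < c := by
    refine hgc.integral_pos_of_hasCompactSupport_nonneg_nonzero
      (HasCompactSupport.of_compactSpace _) hg0 (x := 0) ?_
    simp [hg, hρ0.not_ge]
  set h : C(AddCircle (1 : ℝ), ℂ) := ⟨fun t => (g t : ℂ), by fun_prop⟩ with hh
  have hintegral : ∫ t, h t ∂AddCircle.haarAddCircle = (c : ℂ) := integral_ofReal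
  set u : ℝ := ρ - α⁻¹ * β with hu
  obtain ⟨K₀, hK₀⟩ := uncorrelatedAlong hα.inv u h (c * η / 4) (by positivity)
  set m₀ : ℕ := ⌈|β|⌉₊ with hm₀
  have hreal : ∀ f : ℕ → ℝ, (∀ m n, f (m * n) = f m * f n) → (∀ n, |f n| ≤ 1) → ∀ N, K₀ ≤ N →
      |∑ m ∈ Ioc 0 N, f m * g ((α⁻¹ * m + u : ℝ) : AddCircle (1 : ℝ)) - c * ∑ m ∈ Ioc 0 N, f m| ≤
        c * η / 4 * N := by
    intro f hf hf1 N hN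
    have := hK₀ f hf hf1 N hN
    rw [hintegral] at this
    rw [← Real.norm_eq_abs, ← Complex.norm_real]
    push_cast
    exact this
  refine ⟨max K₀ ⌈4 * m₀ / (c * η)⌉₊, fun f σ hf hf1 hσ M hM hB => ?_⟩
  have hM₀ : 4 * (m₀ : ℝ) ≤ c * η * M := by
    rw [← div_le_iff₀' (by positivity)]
    exact (Nat.le_ceil _).trans (by exact_mod_cast (le_max_right _ _).trans hM)
  have a₁ := hreal f hf hf1 M ((le_max_left _ _).trans hM)
  have a₂ := hreal (fun _ => 1) (by simp) (by simp) M ((le_max_left _ _).trans hM)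
  have a₃ : |∑ m ∈ Ioc 0 M, (f m + σ) * g ((α⁻¹ * m + u : ℝ) : AddCircle (1 : ℝ))| ≤ 2 * m₀ := by
    have hterm : ∀ m ∈ Ioc 0 M, |(f m + σ) * g ((α⁻¹ * m + u : ℝ) : AddCircle (1 : ℝ))| ≤
        if m < m₀ then 2 else 0 := by
      intro m hm
      split_ifs with hmm
      · rw [abs_mul, abs_of_nonneg (hg0 _)]
        have : |f m + σ| ≤ 2 := (abs_add_le _ _).trans (by linarith [hf1 m])
        calc _ ≤ 2 * (1 : ℝ) := by gcongr; exact hg1 _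
          _ = 2 := by norm_num
      · by_cases hgz : g ((α⁻¹ * m + u : ℝ) : AddCircle (1 : ℝ)) = 0
        · rw [hgz, mul_zero, abs_zero]
        · have hlt : ‖((α⁻¹ * m + u : ℝ) : AddCircle (1 : ℝ))‖ < ρ := by
            by_contra hcon
            exact hgz (max_eq_left (by linarith))
          have hβ : β ≤ m := (le_abs_self β).trans ((Nat.le_ceil _).trans (by
            exact_mod_cast not_lt.1 hmm))
          obtain ⟨n, hn0, hn⟩ := floor_eq_of_norm_addCircle_lt hα1 hlt hβ
          rw [hB m n hn0 (mem_Ioc.1 hm).1 (mem_Ioc.1 hm).2 hn]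
          simp
    refine (abs_sum_le_sum_abs _ _).trans ((sum_le_sum hterm).trans ?_)
    rw [← sum_filter, sum_const, nsmul_eq_mul, mul_comm]
    have : ((Ioc 0 M).filter (· < m₀)).card ≤ m₀ := by
      calc _ ≤ (range m₀).card := card_le_card fun m hm => by
            simp only [mem_filter] at hm; exact mem_range.2 hm.2
        _ = m₀ := card_range _
    gcongr
  simp only [add_mul, sum_add_distrib, ← mul_sum] at a₃
  simp only [one_mul, sum_const, Nat.card_Ioc, tsub_zero, nsmul_eq_mul, mul_one] at a₂
  set G := ∑ m ∈ Ioc 0 M, g ((α⁻¹ * m + u : ℝ) : AddCircle (1 : ℝ))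
  set F := ∑ m ∈ Ioc 0 M, f m * g ((α⁻¹ * m + u : ℝ) : AddCircle (1 : ℝ))
  set S := ∑ m ∈ Ioc 0 M, f m
  have a₄ : |σ * (G - c * M)| ≤ c * η / 4 * M := by
    rw [abs_mul]
    exact (mul_le_of_le_one_left (abs_nonneg _) hσ).trans a₂
  rw [abs_le] at *
  have hcc : c * (-(η * M)) ≤ c * (S + σ * M) ∧ c * (S + σ * M) ≤ c * (η * M) := by
    constructor <;> nlinarith
  exact ⟨le_of_mul_le_mul_left hcc.1 hcpos, le_of_mul_le_mul_left hcc.2 hcpos⟩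

end Weyl

section Vinogradov

open Finset

theorem sum_filter_dvd_Ioc_eq_sum_div {M : Type*} [AddCommMonoid M] (g : ℕ → M) {q : ℕ}
    (hq : 0 < q) (N : ℕ) :
    ∑ n ∈ (Ioc 0 N).filter (q ∣ ·), g n = ∑ m ∈ Ioc 0 (N / q), g (q * m) := by
  rw [sum_filter_dvd_Ioc g hq, ← sum_filter]
  congr 1
  ext m
  simp only [mem_filter, mem_Ioc, Nat.le_div_iff_mul_le hq, mul_comm m]
  constructor
  · rintro ⟨⟨h1, _⟩, h3⟩; exact ⟨h1, h3⟩
  · rintro ⟨h1, h2⟩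
    exact ⟨⟨h1, (Nat.le_mul_of_pos_left m hq).trans h2⟩, h2⟩

/-- A completely multiplicative sign cannot have mean value close to `-1` on all scales. -/
theorem not_forall_mean_near_neg_one {f : ℕ → ℝ} (hmul : ∀ m n, f (m * n) = f m * f n)
    {N K₁ K₂ : ℕ} (hK₁ : 0 < K₁) (hK : K₁ ≤ K₂) (hN : K₁ * K₂ ≤ N)
    (hf : ∀ n, 0 < n → n ≤ N → f n = 1 ∨ f n = -1)
    (h₁ : ∀ M, K₁ ≤ M → M ≤ N → ∑ m ∈ Ioc 0 M, f m ≤ -(3 / 4) * M)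
    (h₂ : ∀ M, K₂ ≤ M → M ≤ N → ∑ m ∈ Ioc 0 M, f m + M ≤ 1 / (4 * K₁) * M) : False := by
  have hK₁' : (0 : ℝ) < K₁ := by exact_mod_cast hK₁
  have hK₂' : (0 : ℝ) < K₂ := by exact_mod_cast hK₁.trans_le hK
  have hK₂N : K₂ ≤ N := (Nat.le_mul_of_pos_left K₂ hK₁).trans hN
  have hone : ∀ d ∈ Ioc 0 K₁, f d = 1 := by
    intro d hd
    obtain ⟨hd0, hd1⟩ := mem_Ioc.1 hd
    have hdN : d * K₂ ≤ N := (Nat.mul_le_mul_right _ hd1).trans hN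
    refine (hf d hd0 ((Nat.le_mul_of_pos_right d (by omega)).trans hdN)).resolve_right fun hneg => ?_
    have b₁ := h₂ (d * K₂) (Nat.le_mul_of_pos_left K₂ hd0) hdN
    have b₂ := h₁ K₂ hK hK₂N
    have b₃ : ∑ m ∈ Ioc 0 K₂, (f (d * m) + 1) ≤ ∑ n ∈ Ioc 0 (d * K₂), (f n + 1) := by
      have e := sum_filter_dvd_Ioc_eq_sum_div (fun n => f n + 1) hd0 (d * K₂)
      rw [Nat.mul_div_cancel_left _ hd0] at e
      rw [← e]
      refine sum_le_sum_of_subset_of_nonneg (filter_subset _ _) fun n hn _ => ?_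
      obtain ⟨hn0, hn1⟩ := mem_Ioc.1 hn
      rcases hf n hn0 (hn1.trans hdN) with h | h <;> rw [h] <;> norm_num
    simp only [hmul, hneg, neg_mul, one_mul, sum_add_distrib, sum_neg_distrib, sum_const,
      Nat.card_Ioc, tsub_zero, nsmul_eq_mul, mul_one] at b₃
    have b₄ : 1 / (4 * (K₁ : ℝ)) * ((d * K₂ : ℕ) : ℝ) ≤ K₂ / 4 := by
      have hd1' : (d : ℝ) ≤ K₁ := by exact_mod_cast hd1
      push_cast
      rw [one_div_mul_eq_div, div_le_div_iff₀ (by positivity) (by norm_num)]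
      nlinarith
    linarith
  have := h₁ K₁ le_rfl (hK.trans hK₂N)
  rw [sum_congr rfl hone] at this
  simp only [sum_const, Nat.card_Ioc, tsub_zero, nsmul_eq_mul, mul_one] at this
  linarith

theorem sum_inv_sub_le_of_neg {f : ℕ → ℝ} (hmul : ∀ m n, f (m * n) = f m * f n)
    (hf : ∀ n, |f n| ≤ 1) {N K : ℕ} (hK : 0 < K) {η : ℝ} (hη1 : η ≤ 1 / 32)
    (h : ∀ M, K ≤ M → M ≤ N → ∑ m ∈ Ioc 0 M, (1 - f m) ≤ η * M) (hKN : K ≤ N)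
    (Q : Finset ℕ) (hQ : ∀ q ∈ Q, q.Prime ∧ q * K ≤ N ∧ f q = -1) :
    3 / 4 * ∑ q ∈ Q, (q : ℝ)⁻¹ -
      2 * ∑ q ∈ Q, ∑ r ∈ Q, (if q = r then 0 else (q : ℝ)⁻¹ * (r : ℝ)⁻¹) ≤ η := by
  have hN0 : (0 : ℝ) < N := by exact_mod_cast hK.trans_le hKN
  have hnn : ∀ n, 0 ≤ 1 - f n := fun n => by linarith [(abs_le.1 (hf n)).2]
  have hle2 : ∀ n, 1 - f n ≤ 2 := fun n => by linarith [(abs_le.1 (hf n)).1]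
  have hpt : ∀ n, ∑ q ∈ Q, (if q ∣ n then (1 : ℝ) else 0) -
      ∑ q ∈ Q, ∑ r ∈ Q, (if q = r then 0 else if q ∣ n ∧ r ∣ n then (1 : ℝ) else 0) ≤ 1 := by
    intro n
    set a := ∑ q ∈ Q, (if q ∣ n then (1 : ℝ) else 0) with ha
    have e : ∑ q ∈ Q, ∑ r ∈ Q, (if q = r then 0 else if q ∣ n ∧ r ∣ n then (1 : ℝ) else 0) =
        a * a - a := by
      have e₀ : a * a - a = ∑ q ∈ Q, ((if q ∣ n then (1 : ℝ) else 0) * a -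
          (if q ∣ n then (1 : ℝ) else 0)) := by rw [sum_sub_distrib, ← sum_mul]
      rw [e₀]
      refine sum_congr rfl fun q hq => ?_
      have : ∀ r, (if q = r then (0 : ℝ) else if q ∣ n ∧ r ∣ n then (1 : ℝ) else 0) =
          (if q ∣ n then (1 : ℝ) else 0) * (if r ∣ n then (1 : ℝ) else 0) -
            if q = r then (if q ∣ n then (1 : ℝ) else 0) else 0 := by
        intro r
        by_cases h1 : q = r
        · subst h1; by_cases h2 : q ∣ n <;> simp [h2]
        · by_cases h2 : q ∣ n <;> by_cases h3 : r ∣ n <;> simp [h1, h2, h3]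
      simp_rw [this, sum_sub_distrib, ← mul_sum]
      rw [sum_ite_eq, if_pos hq]
    rw [e]
    nlinarith [sq_nonneg (a - 1)]
  have hA : 3 / 4 * N * ∑ q ∈ Q, (q : ℝ)⁻¹ ≤
      ∑ n ∈ Ioc 0 N, (1 - f n) * ∑ q ∈ Q, (if q ∣ n then (1 : ℝ) else 0) := by
    simp_rw [mul_sum]
    rw [sum_comm]
    refine sum_le_sum fun q hq => ?_
    obtain ⟨hp, hqN, hfq⟩ := hQ q hq
    have hq0 : (0 : ℝ) < q := by exact_mod_cast hp.pos
    have hKq : K ≤ N / q := (Nat.le_div_iff_mul_le hp.pos).2 (by rwa [mul_comm])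
    have e : ∑ n ∈ Ioc 0 N, (1 - f n) * (if q ∣ n then (1 : ℝ) else 0) =
        ∑ m ∈ Ioc 0 (N / q), (2 - (1 - f m)) := by
      simp_rw [mul_ite, mul_one, mul_zero]
      rw [← sum_filter, sum_filter_dvd_Ioc_eq_sum_div _ hp.pos]
      refine sum_congr rfl fun m _ => ?_
      rw [hmul, hfq]; ring
    rw [e, sum_sub_distrib, sum_const, Nat.card_Ioc, tsub_zero, nsmul_eq_mul]
    have b₁ := h _ hKq (Nat.div_le_self _ _)
    have b₂ : (N : ℝ) / q / 2 ≤ ((N / q : ℕ) : ℝ) := by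
      rw [← Nat.floor_div_eq_div (K := ℝ)]
      refine half_le_natFloor ?_
      rw [le_div_iff₀ hq0, one_mul]
      exact_mod_cast (Nat.le_mul_of_pos_right q hK).trans hqN
    have b₃ : (0 : ℝ) ≤ ((N / q : ℕ) : ℝ) := Nat.cast_nonneg _
    have e₂ : 3 / 4 * (N : ℝ) * (q : ℝ)⁻¹ = 3 / 2 * ((N : ℝ) / q / 2) := by field_simp; norm_num
    rw [e₂]
    nlinarith
  have hB : ∑ n ∈ Ioc 0 N, (1 - f n) *
      ∑ q ∈ Q, ∑ r ∈ Q, (if q = r then 0 else if q ∣ n ∧ r ∣ n then (1 : ℝ) else 0) ≤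
      2 * N * ∑ q ∈ Q, ∑ r ∈ Q, (if q = r then 0 else (q : ℝ)⁻¹ * (r : ℝ)⁻¹) := by
    simp_rw [mul_sum]
    rw [sum_comm]
    refine sum_le_sum fun q hq => ?_
    rw [sum_comm]
    refine sum_le_sum fun r hr => ?_
    by_cases hqr : q = r
    · simp [hqr]
    simp only [if_neg hqr]
    have hc : Nat.Coprime q r := (Nat.coprime_primes (hQ q hq).1 (hQ r hr).1).2 hqr
    have hiff : ∀ n, (q ∣ n ∧ r ∣ n) ↔ q * r ∣ n := fun n =>
      ⟨fun h => hc.mul_dvd_of_dvd_of_dvd h.1 h.2,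
        fun h => ⟨(dvd_mul_right _ _).trans h, (dvd_mul_left _ _).trans h⟩⟩
    simp_rw [hiff]
    calc _ ≤ ∑ n ∈ Ioc 0 N, 2 * (if q * r ∣ n then (1 : ℝ) else 0) :=
          sum_le_sum fun n _ => mul_le_mul_of_nonneg_right (hle2 n) (by positivity)
      _ = 2 * ((N / (q * r) : ℕ) : ℝ) := by
          rw [← mul_sum, ← sum_filter, sum_const, Nat.Ioc_filter_dvd_card_eq_div, nsmul_eq_mul,
            mul_one]
      _ ≤ 2 * ((N : ℝ) / ((q * r : ℕ) : ℝ)) := by gcongr; exact Nat.cast_div_le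
      _ = _ := by push_cast; rw [div_eq_mul_inv, mul_inv]; ring
  have hC : ∑ n ∈ Ioc 0 N, (1 - f n) * (∑ q ∈ Q, (if q ∣ n then (1 : ℝ) else 0) -
      ∑ q ∈ Q, ∑ r ∈ Q, (if q = r then 0 else if q ∣ n ∧ r ∣ n then (1 : ℝ) else 0)) ≤ η * N :=
    (sum_le_sum fun n _ => mul_le_of_le_one_right (hnn n) (hpt n)).trans (h N hKN le_rfl)
  simp_rw [mul_sub (1 - f _), sum_sub_distrib] at hC
  refine le_of_mul_le_mul_right ?_ hN0
  nlinarith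

/-- If a completely multiplicative sign has mean value close to `1` on all scales, then the primes
where it is negative are sparse. -/
theorem sum_inv_le_of_neg {f : ℕ → ℝ} (hmul : ∀ m n, f (m * n) = f m * f n)
    (hf : ∀ n, |f n| ≤ 1) {N K : ℕ} (hK : 0 < K) {η : ℝ} (hη : 0 < η) (hη1 : η ≤ 1 / 32)
    (h : ∀ M, K ≤ M → M ≤ N → ∑ m ∈ Ioc 0 M, (1 - f m) ≤ η * M) (hKN : K ≤ N)
    (Q : Finset ℕ) (hQ : ∀ q ∈ Q, q.Prime ∧ q * K ≤ N ∧ f q = -1) :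
    ∑ q ∈ Q, (q : ℝ)⁻¹ ≤ 2 * η := by
  induction Q using Finset.induction_on with
  | empty => simp; linarith
  | insert q Q hq ih =>
    have ih' := ih fun r hr => hQ r (mem_insert_of_mem hr)
    have h1 := sum_inv_sub_le_of_neg hmul hf hK hη1 h hKN {q} (by
      intro r hr; rw [mem_singleton] at hr; subst hr; exact hQ r (mem_insert_self _ _))
    have h2 := sum_inv_sub_le_of_neg hmul hf hK hη1 h hKN _ hQ
    simp only [sum_singleton, if_true, mul_zero, sub_zero] at h1
    set S := ∑ r ∈ insert q Q, (r : ℝ)⁻¹ with hS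
    have h3 : S ≤ 1 / 8 := by rw [hS, sum_insert hq]; linarith
    have h0 : 0 ≤ S := sum_nonneg fun _ _ => by positivity
    have h4 : ∑ q' ∈ insert q Q, ∑ r ∈ insert q Q,
        (if q' = r then 0 else (q' : ℝ)⁻¹ * (r : ℝ)⁻¹) ≤ S * S := by
      rw [hS, sum_mul_sum]
      refine sum_le_sum fun a _ => sum_le_sum fun b _ => ?_
      split_ifs
      · positivity
      · exact le_rfl
    nlinarith

theorem eq_one_of_forall_prime {f : ℕ → ℝ} (hmul : ∀ m n, f (m * n) = f m * f n) (h1 : f 1 = 1)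
    {n : ℕ} (hn : n ≠ 0) (h : ∀ q, q.Prime → q ∣ n → f q = 1) : f n = 1 := by
  induction n using induction_on_primes with
  | zero => exact absurd rfl hn
  | one => exact h1
  | prime_mul p a hp ih =>
    rw [hmul, h p hp (dvd_mul_right _ _), one_mul]
    exact ih (right_ne_zero_of_mul hn) fun q hq hqa => h q hq (hqa.mul_left p)

theorem sum_one_sub_le_sum_prime_inv {f : ℕ → ℝ} (hmul : ∀ m n, f (m * n) = f m * f n)
    (h1 : f 1 = 1) {x : ℕ} (hf : ∀ n, 0 < n → n ≤ x → f n = 1 ∨ f n = -1) :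
    ∑ n ∈ Ioc 0 x, (1 - f n) ≤
      2 * x * ∑ q ∈ (Ioc 0 x).filter (fun q => q.Prime ∧ f q = -1), (q : ℝ)⁻¹ := by
  classical
  set B := (Ioc 0 x).filter (fun q => q.Prime ∧ f q = -1) with hB
  calc ∑ n ∈ Ioc 0 x, (1 - f n) ≤ ∑ n ∈ Ioc 0 x, 2 * ∑ q ∈ B, (if q ∣ n then (1 : ℝ) else 0) := by
        refine sum_le_sum fun n hn => ?_
        obtain ⟨hn0, hnx⟩ := mem_Ioc.1 hn
        have h0 : 0 ≤ ∑ q ∈ B, (if q ∣ n then (1 : ℝ) else 0) :=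
          sum_nonneg fun _ _ => by positivity
        rcases hf n hn0 hnx with h | h
        · rw [h]; linarith
        · obtain ⟨q, hq, hqn, hfq⟩ : ∃ q, q.Prime ∧ q ∣ n ∧ f q ≠ 1 := by
            by_contra! hcon
            have := eq_one_of_forall_prime hmul h1 hn0.ne' hcon
            rw [h] at this; norm_num at this
          have hqx : q ≤ x := (Nat.le_of_dvd hn0 hqn).trans hnx
          have hqB : q ∈ B := mem_filter.2 ⟨mem_Ioc.2 ⟨hq.pos, hqx⟩, hq,
            (hf q hq.pos hqx).resolve_left hfq⟩
          have := single_le_sum (f := fun q => if q ∣ n then (1 : ℝ) else 0)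
            (fun _ _ => by positivity) hqB
          simp only [hqn, if_true] at this
          rw [h]; linarith
    _ = ∑ q ∈ B, 2 * ((x / q : ℕ) : ℝ) := by
        rw [← mul_sum, sum_comm, mul_sum]
        refine sum_congr rfl fun q _ => ?_
        rw [← sum_filter, sum_const, Nat.Ioc_filter_dvd_card_eq_div, nsmul_eq_mul, mul_one]
    _ ≤ ∑ q ∈ B, 2 * (x * (q : ℝ)⁻¹) := by
        refine sum_le_sum fun q _ => ?_
        rw [← div_eq_mul_inv]
        gcongr
        exact Nat.cast_div_le
    _ = _ := by rw [← mul_sum, ← mul_sum]; ring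

/-- Vinogradov's trick: a completely multiplicative sign with mean value close to `1` on all
scales up to `N` retains a positive mean value on the longer range `x`. -/
theorem sum_one_sub_le_of_mean_near_one {f : ℕ → ℝ} (hmul : ∀ m n, f (m * n) = f m * f n)
    (h1 : f 1 = 1) (hf1 : ∀ n, |f n| ≤ 1) {N K x : ℕ} (hK : 0 < K) (hKN : 2 * K ≤ N) (hNx : N ≤ x)
    (hf : ∀ n, 0 < n → n ≤ x → f n = 1 ∨ f n = -1) {η : ℝ} (hη : 0 < η) (hη1 : η ≤ 1 / 32)
    (h : ∀ M, K ≤ M → M ≤ N → ∑ m ∈ Ioc 0 M, (1 - f m) ≤ η * M) :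
    ∑ n ∈ Ioc 0 x, (1 - f n) ≤ 2 * x * (2 * η + (Real.log (Real.log x) -
      Real.log (Real.log (N / K : ℕ)) + 12 / Real.log (N / K : ℕ))) := by
  refine (sum_one_sub_le_sum_prime_inv hmul h1 hf).trans ?_
  gcongr
  have hy2 : 2 ≤ N / K := (Nat.le_div_iff_mul_le hK).2 hKN
  have hyx : N / K ≤ x := (Nat.div_le_self _ _).trans hNx
  rw [← sum_filter_add_sum_filter_not _ (fun q => q ≤ N / K)]
  refine add_le_add ?_ ?_
  · refine sum_inv_le_of_neg hmul hf1 hK hη hη1 h (by omega) _ fun q hq => ?_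
    simp only [mem_filter] at hq
    exact ⟨hq.1.2.1, (Nat.le_div_iff_mul_le hK).1 hq.2, hq.1.2.2⟩
  · refine le_trans ?_ (sum_prime_inv_le hy2 hyx)
    refine sum_le_sum_of_subset_of_nonneg (fun q hq => ?_) fun _ _ _ => by positivity
    simp only [mem_filter, mem_Ioc] at hq ⊢
    exact ⟨⟨not_le.1 hq.2, hq.1.1.2⟩, hq.1.2.1⟩

end Vinogradov

section PrescribedValue

open Finset Filter

/-- The quadratic character modulo `p`, as a real-valued function on the natural numbers. -/
noncomputable def realQuadraticChar (p : ℕ) [Fact p.Prime] (n : ℕ) : ℝ :=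
  (quadraticChar (ZMod p) (n : ZMod p) : ℝ)

theorem realQuadraticChar_mul (p : ℕ) [Fact p.Prime] (m n : ℕ) :
    realQuadraticChar p (m * n) = realQuadraticChar p m * realQuadraticChar p n := by
  unfold realQuadraticChar
  rw [Nat.cast_mul, map_mul, Int.cast_mul]

theorem realQuadraticChar_one (p : ℕ) [Fact p.Prime] : realQuadraticChar p 1 = 1 := by
  simp [realQuadraticChar]

theorem realQuadraticChar_eq_one_or {p : ℕ} [Fact p.Prime] {n : ℕ} (hn : 0 < n) (hnp : n < p) :
    realQuadraticChar p n = 1 ∨ realQuadraticChar p n = -1 := by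
  have hne : (n : ZMod p) ≠ 0 := by
    rw [Ne, ZMod.natCast_eq_zero_iff]
    exact Nat.not_dvd_of_pos_of_lt hn hnp
  unfold realQuadraticChar
  rcases quadraticChar_dichotomy hne with h | h <;> simp [h]

theorem abs_realQuadraticChar_le_one (p : ℕ) [Fact p.Prime] (n : ℕ) :
    |realQuadraticChar p n| ≤ 1 :=
  abs_quadraticChar_le_one _

theorem abs_sum_realQuadraticChar_add_le {α β : ℝ} (hα1 : 1 < α) (hα : Irrational α) {σ : ℤ}
    (hσ : σ = 1 ∨ σ = -1) {η : ℝ} (hη : 0 < η) :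
    ∃ K : ℕ, 0 < K ∧ ∀ (p : ℕ) (_ : Fact p.Prime) (N : ℕ), N < p →
      (∀ n : ℕ, 0 < n → n ≤ N → legendreSym p ⌊α * n + β⌋ ≠ σ) →
      ∀ M, K ≤ M → M ≤ N → |∑ m ∈ Ioc 0 M, realQuadraticChar p m + σ * M| ≤ η * M := by
  obtain ⟨K, hK⟩ := abs_sum_add_le_of_beatty (β := β) hα1 hα hη
  refine ⟨max (K + 1) ⌈|1 - β| / (α - 1)⌉₊, by positivity, fun p _ N hNp hno M hKM hMN => ?_⟩
  have hα' : 0 < α - 1 := by linarith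
  have hM : |1 - β| ≤ (α - 1) * M := by
    rw [← div_le_iff₀' hα']
    exact (Nat.le_ceil _).trans (by exact_mod_cast (le_max_right _ _).trans hKM)
  refine hK (realQuadraticChar p) σ (realQuadraticChar_mul p) (abs_realQuadraticChar_le_one p)
    (by rcases hσ with rfl | rfl <;> simp) M (by have := (le_max_left _ _).trans hKM; omega) ?_
  intro m n hn hm hmM hmn
  have hnN : n ≤ N := by
    have h1 : α * n + β < m + 1 := by
      have := Int.lt_floor_add_one (α * n + β)
      rw [hmn] at this
      exact_mod_cast this
    have h2 : (m : ℝ) ≤ M := by exact_mod_cast hmM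
    have h3 : α * n < α * M := by
      have := le_abs_self (1 - β)
      linarith
    have h4 : (n : ℝ) < M := lt_of_mul_lt_mul_left h3 (by linarith)
    exact (Nat.cast_lt.1 h4).le.trans hMN
  have hne := hno n hn hnN
  rw [hmn] at hne
  have hχ : realQuadraticChar p m = (legendreSym p (m : ℤ) : ℝ) := by
    simp [realQuadraticChar, legendreSym]
  have hdich := realQuadraticChar_eq_one_or (p := p) hm (hmM.trans_lt (hMN.trans_lt hNp))
  have hneR : realQuadraticChar p m ≠ (σ : ℝ) := by
    rw [hχ]; exact_mod_cast hne
  rcases hσ with rfl | rfl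
  · simpa using hdich.resolve_left (by simpa using hneR)
  · simpa using hdich.resolve_right (by simpa using hneR)

theorem eventually_exists_legendreSym_eq_one {α β : ℝ} (hα1 : 1 < α) (hα : Irrational α)
    {b : ℝ} (hb : 0 < b) (hb1 : b < 1) :
    ∀ᶠ p : ℕ in atTop, ∀ _ : Fact p.Prime,
      ∃ n : ℕ, 0 < n ∧ n ≤ ⌊(p : ℝ) ^ b⌋₊ ∧ legendreSym p ⌊α * n + β⌋ = 1 := by
  obtain ⟨K₁, hK₁, h₁⟩ := abs_sum_realQuadraticChar_add_le (β := β) hα1 hα (σ := 1) (Or.inl rfl)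
    (η := 1 / 4) (by norm_num)
  obtain ⟨K₂, hK₂, h₂⟩ := abs_sum_realQuadraticChar_add_le (β := β) hα1 hα (σ := 1) (Or.inl rfl)
    (η := 1 / (4 * K₁)) (by positivity)
  have hlim : Tendsto (fun p : ℕ => (p : ℝ) ^ b) atTop atTop :=
    (tendsto_rpow_atTop hb).comp tendsto_natCast_atTop_atTop
  filter_upwards [hlim.eventually_ge_atTop ((K₁ * max K₁ K₂ : ℕ) : ℝ)] with p hp hpp
  by_contra! hno
  have hp1 : (1 : ℝ) < p := by exact_mod_cast hpp.out.one_lt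
  set N := ⌊(p : ℝ) ^ b⌋₊ with hN
  have hNp : N < p := by
    have : (N : ℝ) < p := (Nat.floor_le (by positivity)).trans_lt (by
      simpa using Real.rpow_lt_rpow_of_exponent_lt hp1 hb1)
    exact_mod_cast this
  refine not_forall_mean_near_neg_one (realQuadraticChar_mul p) hK₁ (le_max_left K₁ K₂)
    (N := N) (Nat.le_floor hp) (fun n hn hnN => realQuadraticChar_eq_one_or hn (hnN.trans_lt hNp))
    (fun M hM hMN => ?_) (fun M hM hMN => ?_)
  · have := (abs_le.1 (h₁ p hpp N hNp hno M hM hMN)).2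
    push_cast at this
    linarith
  · have := (abs_le.1 (h₂ p hpp N hNp hno M ((le_max_right _ _).trans hM) hMN)).2
    push_cast at this
    linarith

theorem eventually_exists_legendreSym_eq_neg_one {α β : ℝ} (hα1 : 1 < α) (hα : Irrational α)
    {b b' δ : ℝ} (hb' : 0 < b') (hbb' : b' < b) (hδ : 0 < δ) (hδ1 : δ ≤ 1 / 4)
    (hbδ : b ≤ 1 / 4 + δ) (hlog : Real.log ((1 / 4 + δ) / b') < 1 / 2) :
    ∀ᶠ p : ℕ in atTop, ∀ _ : Fact p.Prime,
      ∃ n : ℕ, 0 < n ∧ n ≤ ⌊(p : ℝ) ^ b⌋₊ ∧ legendreSym p ⌊α * n + β⌋ = -1 := by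
  set γ : ℝ := 1 / 2 - Real.log ((1 / 4 + δ) / b') with hγ
  have hγ0 : 0 < γ := by linarith
  obtain ⟨p₀, hp₀⟩ := burgess_initial δ (γ / 2) hδ hδ1 (by positivity)
  set η : ℝ := min (1 / 32) (γ / 8) with hη
  have hη0 : 0 < η := by positivity
  have hη1 : η ≤ 1 / 32 := min_le_left _ _
  have hη2 : η ≤ γ / 8 := min_le_right _ _
  obtain ⟨K, hK, h₁⟩ := abs_sum_realQuadraticChar_add_le (β := β) hα1 hα (σ := -1) (Or.inr rfl) hη0
  have hlim : ∀ c : ℝ, 0 < c → Tendsto (fun p : ℕ => (p : ℝ) ^ c) atTop atTop := fun c hc =>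
    (tendsto_rpow_atTop hc).comp tendsto_natCast_atTop_atTop
  have hlogl : Tendsto (fun p : ℕ => b' * Real.log (p : ℝ)) atTop atTop :=
    (Real.tendsto_log_atTop.comp tendsto_natCast_atTop_atTop).const_mul_atTop hb'
  filter_upwards [eventually_ge_atTop p₀, (hlim (b - b') (by linarith)).eventually_ge_atTop (4 * K),
    hlogl.eventually_gt_atTop (12 / (γ / 4))] with p hpp₀ hpK hplog hpp
  by_contra! hno
  have hp1 : (1 : ℝ) < p := by exact_mod_cast hpp.out.one_lt
  have hp0 : (0 : ℝ) < p := by linarith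
  set y : ℝ := (p : ℝ) with hy
  set N := ⌊y ^ b⌋₊ with hN
  set x := ⌊y ^ (1 / 4 + δ)⌋₊ with hx
  have hK' : (1 : ℝ) ≤ K := by exact_mod_cast hK
  have hlogp : 0 < Real.log y := Real.log_pos hp1
  have hyb' : 1 ≤ y ^ b' := Real.one_le_rpow hp1.le hb'.le
  have hNx : N ≤ x := Nat.floor_mono (Real.rpow_le_rpow_of_exponent_le hp1.le hbδ)
  have hxp : x < p := by
    have : (x : ℝ) < p := (Nat.floor_le (by positivity)).trans_lt (by
      have := Real.rpow_lt_rpow_of_exponent_lt hp1 (show 1 / 4 + δ < 1 by linarith)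
      simpa using this)
    exact_mod_cast this
  have hbig : 4 * K * y ^ b' ≤ y ^ b := by
    have e : y ^ b = y ^ (b - b') * y ^ b' := by rw [← Real.rpow_add hp0]; congr 1; ring
    rw [e]; gcongr
  have hNhalf : y ^ b / 2 ≤ N := half_le_natFloor (by nlinarith)
  have hNK : 2 * y ^ b' ≤ (N : ℝ) / K := by
    rw [le_div_iff₀ (by linarith)]; linarith
  have h2K : 2 * K ≤ N := by
    have : (2 * K : ℝ) ≤ N := by nlinarith
    exact_mod_cast this
  have hfl : y ^ b' ≤ ((N / K : ℕ) : ℝ) := by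
    have h := half_le_natFloor (t := (N : ℝ) / K) (by linarith)
    rw [Nat.floor_div_eq_div] at h
    linarith
  have hmain := sum_one_sub_le_of_mean_near_one (realQuadraticChar_mul p) (realQuadraticChar_one p)
    (abs_realQuadraticChar_le_one p) hK h2K hNx
    (fun n hn hnx => realQuadraticChar_eq_one_or hn (hnx.trans_lt hxp)) hη0 hη1 (by
      intro M hM hMN
      have h := (abs_le.1 (h₁ p hpp N (hNx.trans_lt hxp) hno M hM hMN)).1
      rw [sum_sub_distrib, sum_const, Nat.card_Ioc, tsub_zero, nsmul_eq_mul, mul_one]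
      push_cast at h
      linarith)
  have hbur : ∑ n ∈ Ioc 0 x, realQuadraticChar p n ≤ γ / 2 * x :=
    (abs_le.1 (hp₀ p hpp₀ hpp)).2
  rw [sum_sub_distrib, sum_const, Nat.card_Ioc, tsub_zero, nsmul_eq_mul, mul_one] at hmain
  have hx0 : (0 : ℝ) < x := by
    have : 0 < x := by omega
    exact_mod_cast this
  have hly : b' * Real.log y ≤ Real.log ((N / K : ℕ) : ℝ) := by
    rw [← Real.log_rpow hp0]
    exact Real.log_le_log (by positivity) hfl
  have hly0 : 0 < b' * Real.log y := by positivity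
  have hlx : Real.log x ≤ (1 / 4 + δ) * Real.log y := by
    rw [← Real.log_rpow hp0]
    exact Real.log_le_log hx0 (Nat.floor_le (by positivity))
  have hlx0 : 0 < Real.log x := Real.log_pos (by
    have : 1 < x := by omega
    exact_mod_cast this)
  have hll : Real.log (Real.log x) - Real.log (Real.log ((N / K : ℕ) : ℝ)) ≤
      Real.log ((1 / 4 + δ) / b') := by
    have e : (1 / 4 + δ) / b' = ((1 / 4 + δ) * Real.log y) / (b' * Real.log y) := by
      field_simp
    rw [e, Real.log_div (by positivity) (by positivity)]
    have a₁ := Real.log_le_log hlx0 hlx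
    have a₂ := Real.log_le_log hly0 hly
    linarith
  have h12 : 12 / Real.log ((N / K : ℕ) : ℝ) ≤ γ / 4 := by
    calc 12 / Real.log ((N / K : ℕ) : ℝ) ≤ 12 / (b' * Real.log y) := by gcongr
      _ ≤ γ / 4 := by
        rw [div_le_iff₀ hly0, ← div_le_iff₀' (by positivity)]
        exact hplog.le
  have hfin : (x : ℝ) * (1 - γ / 2) ≤ x * (2 * (2 * η + (Real.log (Real.log x) -
      Real.log (Real.log (N / K : ℕ)) + 12 / Real.log (N / K : ℕ)))) := by linarith
  have := le_of_mul_le_mul_left hfin hx0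
  linarith

end PrescribedValue

/-- Let α > 1 be irrational, β real, and σ ∈ {+1, −1}. For every ε > 0, for all
sufficiently large primes p there is a positive integer n ≤ p^{1/(4√e) + ε} with
(⌊αn + β⌋ | p) = σ. -/
theorem beatty_prescribed_legendre_value
    (α β : ℝ) (hα1 : 1 < α) (hα : Irrational α)
    (σ : ℤ) (hσ : σ = 1 ∨ σ = -1) (ε : ℝ) (hε : 0 < ε) :
    ∃ p₀ : ℕ, ∀ p : ℕ, p₀ ≤ p → ∀ hp : p.Prime,
      ∃ n : ℕ, 0 < n ∧ (n : ℝ) ≤ (p : ℝ) ^ (1 / (4 * Real.sqrt (Real.exp 1)) + ε) ∧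
        @legendreSym p ⟨hp⟩ ⌊α * n + β⌋ = σ := by
  set s : ℝ := Real.sqrt (Real.exp 1) with hs
  have hs1 : 5 / 4 ≤ s := by
    apply Real.le_sqrt_of_sq_le
    have := Real.exp_one_gt_d9
    norm_num; linarith
  have hs0 : 0 < s := by linarith
  set ε' : ℝ := min ε (1 / 10) with hε'
  have hε'0 : 0 < ε' := lt_min hε (by norm_num)
  have hε'1 : ε' ≤ 1 / 10 := min_le_right _ _
  have hinv : 1 / (4 * s) ≤ 1 / 5 := one_div_le_one_div_of_le (by norm_num) (by linarith)
  have hinv0 : 0 < 1 / (4 * s) := by positivity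
  set b : ℝ := 1 / (4 * s) + ε' with hb
  have hev : ∀ᶠ p : ℕ in Filter.atTop, ∀ _ : Fact p.Prime,
      ∃ n : ℕ, 0 < n ∧ n ≤ ⌊(p : ℝ) ^ b⌋₊ ∧ legendreSym p ⌊α * n + β⌋ = σ := by
    rcases hσ with rfl | rfl
    · exact eventually_exists_legendreSym_eq_one hα1 hα (by linarith) (by linarith)
    · refine eventually_exists_legendreSym_eq_neg_one hα1 hα (b' := b - ε' / 4) (δ := ε' / 2)
        (by linarith) (by linarith) (by linarith) (by linarith) (by linarith) ?_
      have hb'0 : 0 < b - ε' / 4 := by linarith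
      have hlt : (1 / 4 + ε' / 2) / (b - ε' / 4) < s := by
        rw [div_lt_iff₀ hb'0]
        have e : s * (b - ε' / 4) = 1 / 4 + 3 / 4 * (s * ε') := by
          rw [hb]; field_simp; ring
        rw [e]
        nlinarith
      calc Real.log ((1 / 4 + ε' / 2) / (b - ε' / 4)) < Real.log s :=
            Real.log_lt_log (by positivity) hlt
        _ = 1 / 2 := by rw [hs, Real.log_sqrt (Real.exp_pos 1).le, Real.log_exp]
  obtain ⟨p₀, hp₀⟩ := Filter.eventually_atTop.1 hev
  refine ⟨p₀, fun p hp hprime => ?_⟩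
  obtain ⟨n, hn0, hn, hleg⟩ := hp₀ p hp ⟨hprime⟩
  refine ⟨n, hn0, ?_, hleg⟩
  have hp1 : (1 : ℝ) ≤ p := by exact_mod_cast hprime.one_lt.le
  calc (n : ℝ) ≤ (p : ℝ) ^ b := (Nat.le_floor_iff (by positivity)).1 hn
    _ ≤ _ := Real.rpow_le_rpow_of_exponent_le hp1 (by rw [hb]; gcongr; exact min_le_left _ _)
end

section
/- For every ε > 0, for all sufficiently large primes p, there exists a positive integer n with n ≤ p^{1/4 + ε} such that 3n + 1 is a quadratic non-residue modulo p. -/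
open Polynomial Finset

/-- The quadratic extension `K(y)` of a subfield `K`, for `y` with square in `K`. -/
def Subfield.adjoinSqrt {E : Type*} [Field E] (K : Subfield E) (y : E) (hy : y ^ 2 ∈ K)
    (hyK : y ∉ K) : Subfield E where
  carrier := {z | ∃ u ∈ K, ∃ v ∈ K, z = u + v * y}
  mul_mem' := by
    rintro _ _ ⟨u, hu, v, hv, rfl⟩ ⟨u', hu', v', hv', rfl⟩
    refine ⟨u * u' + v * v' * y ^ 2, ?_, u * v' + v * u', ?_, by ring⟩
    · exact K.add_mem (K.mul_mem hu hu') (K.mul_mem (K.mul_mem hv hv') hy)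
    · exact K.add_mem (K.mul_mem hu hv') (K.mul_mem hv hu')
  one_mem' := ⟨1, K.one_mem, 0, K.zero_mem, by ring⟩
  add_mem' := by
    rintro _ _ ⟨u, hu, v, hv, rfl⟩ ⟨u', hu', v', hv', rfl⟩
    exact ⟨u + u', K.add_mem hu hu', v + v', K.add_mem hv hv', by ring⟩
  zero_mem' := ⟨0, K.zero_mem, 0, K.zero_mem, by ring⟩
  neg_mem' := by
    rintro _ ⟨u, hu, v, hv, rfl⟩
    exact ⟨-u, K.neg_mem hu, -v, K.neg_mem hv, by ring⟩
  inv_mem' := by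
    rintro _ ⟨u, hu, v, hv, rfl⟩
    by_cases h0 : u + v * y = 0
    · exact ⟨0, K.zero_mem, 0, K.zero_mem, by simp [h0]⟩
    have h1 : u - v * y ≠ 0 := by
      intro h1
      have hv0 : v ≠ 0 := by
        rintro rfl
        apply h0
        linear_combination h1
      apply hyK
      have : y = u / v := by
        field_simp
        linear_combination -h1
      rw [this]
      exact K.div_mem hu hv
    have hd : u ^ 2 - v ^ 2 * y ^ 2 ∈ K :=
      K.sub_mem (K.pow_mem hu 2) (K.mul_mem (K.pow_mem hv 2) hy)
    have hd0 : u ^ 2 - v ^ 2 * y ^ 2 ≠ 0 := by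
      have : u ^ 2 - v ^ 2 * y ^ 2 = (u + v * y) * (u - v * y) := by ring
      rw [this]
      exact mul_ne_zero h0 h1
    refine ⟨u / (u ^ 2 - v ^ 2 * y ^ 2), K.div_mem hu hd, -v / (u ^ 2 - v ^ 2 * y ^ 2),
      K.div_mem (K.neg_mem hv) hd, ?_⟩
    refine inv_eq_of_mul_eq_one_right ?_
    rw [div_mul_eq_mul_div, ← add_div, mul_div_assoc', div_eq_one_iff_eq hd0]
    ring

theorem Subfield.mem_adjoinSqrt {E : Type*} [Field E] {K : Subfield E} {y : E} {hy : y ^ 2 ∈ K}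
    {hyK : y ∉ K} {z : E} :
    z ∈ K.adjoinSqrt y hy hyK ↔ ∃ u ∈ K, ∃ v ∈ K, z = u + v * y := Iff.rfl

/-- Products of square roots are linearly independent over `K` as soon as no nonempty product
lies in `K`. -/
theorem Subfield.coeff_eq_zero_of_sum_prod_sqrt_eq_zero {E ι : Type*} [Field E] [DecidableEq ι]
    (h2 : (2 : E) ≠ 0) (y : ι → E) (s : Finset ι) :
    ∀ K : Subfield E, (∀ i ∈ s, y i ^ 2 ∈ K) →
      (∀ t ⊆ s, t.Nonempty → ∏ i ∈ t, y i ∉ K) → ∀ c : Finset ι → E, (∀ t, c t ∈ K) →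
      ∑ t ∈ s.powerset, c t * ∏ i ∈ t, y i = 0 → ∀ t ⊆ s, c t = 0 := by
  induction s using Finset.induction_on with
  | empty =>
    intro K _ _ c _ h t ht
    rw [subset_empty] at ht
    simpa [ht] using h
  | insert i s his ih =>
    intro K hK hprod c hc h
    have hyK : y i ∉ K := by
      simpa using hprod {i} (by simp) (by simp)
    have hy : y i ^ 2 ∈ K := hK i (by simp)
    have hle : ∀ z ∈ K, z ∈ K.adjoinSqrt (y i) hy hyK := fun z hz =>
      Subfield.mem_adjoinSqrt.2 ⟨z, hz, 0, K.zero_mem, by ring⟩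
    have key := ih (K.adjoinSqrt (y i) hy hyK) (fun j hj => hle _ (hK j (by simp [hj]))) ?_
      (fun t => c t + c (insert i t) * y i)
      (fun t => Subfield.mem_adjoinSqrt.2 ⟨_, hc _, _, hc _, rfl⟩) ?_
    · have key2 : ∀ t ⊆ s, c t = 0 ∧ c (insert i t) = 0 := by
        intro t ht
        have h1 := key t ht
        by_cases h0 : c (insert i t) = 0
        · simp only [h0] at h1 ⊢
          simpa using h1
        · exfalso
          apply hyK
          have : y i = - c t / c (insert i t) := by
            field_simp
            linear_combination h1
          rw [this]
          exact K.div_mem (K.neg_mem (hc _)) (hc _)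
      intro t ht
      by_cases hit : i ∈ t
      · have := (key2 (t.erase i) (by rwa [← subset_insert_iff])).2
        rwa [insert_erase hit] at this
      · exact (key2 t ((subset_insert_iff_of_notMem hit).1 ht)).1
    · rintro t ht hne ⟨u, hu, v, hv, hw⟩
      have hit : i ∉ t := fun h => his (ht h)
      have hwK : (∏ j ∈ t, y j) ^ 2 ∈ K := by
        rw [← prod_pow]
        exact K.prod_mem fun j hj => hK j (by simp [ht hj])
      have ht' : t ⊆ insert i s := ht.trans (subset_insert _ _)
      by_cases hv0 : v = 0
      · apply hprod t ht' hne
        rw [hw, hv0]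
        simpa using hu
      by_cases hu0 : u = 0
      · apply hprod (insert i t) (insert_subset_insert i ht) (by simp)
        rw [prod_insert hit, hw, hu0]
        have : y i * (0 + v * y i) = v * y i ^ 2 := by ring
        rw [this]
        exact K.mul_mem hv hy
      · apply hyK
        have : y i = ((∏ j ∈ t, y j) ^ 2 - u ^ 2 - v ^ 2 * y i ^ 2) / (2 * u * v) := by
          rw [hw]
          field_simp
          ring
        rw [this]
        refine K.div_mem (K.sub_mem (K.sub_mem hwK (K.pow_mem hu 2))
          (K.mul_mem (K.pow_mem hv 2) hy)) (K.mul_mem (K.mul_mem ?_ hu) hv)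
        exact ofNat_mem K 2
    · rw [← h, sum_powerset_insert his, ← sum_add_distrib]
      refine sum_congr rfl fun t ht => ?_
      rw [prod_insert fun h => his (mem_powerset.1 ht h)]
      ring

/-- In the algebra generated by elements `z i` with `z i ^ 2 = d i`, the matrix of multiplication by
`∑ I, c I * ∏ i ∈ I, z i` on the family of products of the `z i`. -/
def multiquadraticMatrix {R ι : Type*} [CommRing R] [DecidableEq ι] (d : ι → R)
    (c : Finset ι → R) : Matrix (Finset ι) (Finset ι) R :=
  fun J K => c (symmDiff J K) * ∏ i ∈ J \ K, d i

section Matrix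

variable {R S ι : Type*} [CommRing R] [CommRing S] [Fintype ι] [DecidableEq ι]

theorem sum_multiquadraticMatrix (φ : R →+* S) (d : ι → R) (c : Finset ι → R) (z : ι → S)
    (hz : ∀ i, z i ^ 2 = φ (d i)) (J : Finset ι) :
    ∑ K, φ (multiquadraticMatrix d c J K) * ∏ i ∈ K, z i =
      (∑ I, φ (c I) * ∏ i ∈ I, z i) * ∏ i ∈ J, z i := by
  rw [sum_mul]
  refine Fintype.sum_equiv (Equiv.ofBijective _ (symmDiff_right_involutive J).bijective) _ _
    fun K => ?_
  simp only [Equiv.ofBijective_apply, multiquadraticMatrix, map_mul, map_prod, ← hz, prod_pow]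
  have h1 : ∏ i ∈ symmDiff J K, z i = (∏ i ∈ J \ K, z i) * ∏ i ∈ K \ J, z i := by
    rw [← prod_union disjoint_sdiff_sdiff, symmDiff_def]
    rfl
  have h2 : ∏ i ∈ J, z i = (∏ i ∈ J ∩ K, z i) * ∏ i ∈ J \ K, z i :=
    (prod_inter_mul_prod_sdiff _ _ _).symm
  have h3 : ∏ i ∈ K, z i = (∏ i ∈ K ∩ J, z i) * ∏ i ∈ K \ J, z i :=
    (prod_inter_mul_prod_sdiff _ _ _).symm
  rw [h1, h2, h3, inter_comm K J]
  ring

theorem dvd_det_multiquadraticMatrix (φ : R →+* S) (d : ι → R) (c : Finset ι → R) (z : ι → S)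
    (hz : ∀ i, z i ^ 2 = φ (d i)) :
    (∑ I, φ (c I) * ∏ i ∈ I, z i) ∣ φ (multiquadraticMatrix d c).det := by
  set M := (multiquadraticMatrix d c).map φ with hM
  set w : Finset ι → S := fun K => ∏ i ∈ K, z i with hw
  have h1 : M.mulVec w = (∑ I, φ (c I) * ∏ i ∈ I, z i) • w := by
    ext J
    exact sum_multiquadraticMatrix φ d c z hz J
  have h2 := congrFun (congrArg (M.adjugate.mulVec) h1) ∅
  rw [Matrix.mulVec_mulVec, Matrix.adjugate_mul, Matrix.mulVec_smul] at h2
  simp only [Matrix.smul_mulVec, Matrix.one_mulVec, Pi.smul_apply, smul_eq_mul, hw,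
    prod_empty, mul_one] at h2
  rw [RingHom.map_det, RingHom.mapMatrix_apply, ← hM, h2]
  exact Dvd.intro _ rfl

theorem natDegree_det_le_card_mul {n : Type*} [Fintype n] [DecidableEq n] (M : Matrix n n R[X])
    (D : ℕ) (h : ∀ i j, (M i j).natDegree ≤ D) : M.det.natDegree ≤ Fintype.card n * D := by
  rw [Matrix.det_apply]
  refine natDegree_sum_le_of_forall_le _ _ fun σ _ => ?_
  refine (natDegree_smul_le _ _).trans ((natDegree_prod_le _ _).trans ?_)
  refine (sum_le_card_nsmul _ _ D fun i _ => h _ _).trans ?_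
  simp

end Matrix

section Independence

variable {F ι : Type*} [Field F] [DecidableEq ι]

theorem not_isSquare_prod_C_mul_X_add_C {a : ι → F} (ha : Function.Injective a)
    (ha0 : ∀ i, a i ≠ 0) {t : Finset ι} (ht : t.Nonempty) :
    ¬ IsSquare (∏ i ∈ t, C (a i) * (X + C (a i))) := by
  rintro ⟨g, hg⟩
  obtain ⟨i, hi⟩ := ht
  have h1 : (∏ j ∈ t, C (a j) * (X + C (a j))) =
      (X + C (a i)) * (C (a i) * ∏ j ∈ t.erase i, C (a j) * (X + C (a j))) := by
    rw [← mul_prod_erase t _ hi]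
    ring
  have h2 : g.eval (-a i) = 0 := by
    have := congrArg (eval (-a i)) hg
    rw [h1] at this
    simpa using this
  obtain ⟨q, hq⟩ := dvd_iff_isRoot.2 h2
  rw [C_neg, sub_neg_eq_add] at hq
  have h3 : C (a i) * ∏ j ∈ t.erase i, C (a j) * (X + C (a j)) = (X + C (a i)) * (q * q) := by
    have hX : (X + C (a i) : F[X]) ≠ 0 := X_add_C_ne_zero _
    apply mul_left_cancel₀ hX
    rw [← h1, hg, hq]
    ring
  have h4 := congrArg (eval (-a i)) h3
  simp only [eval_mul, eval_C, eval_prod, eval_add, eval_X, neg_add_cancel, zero_mul,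
    mul_eq_zero, ha0, false_or, prod_eq_zero_iff, mem_erase] at h4
  obtain ⟨j, ⟨hji, -⟩, h5⟩ := h4
  exact hji (ha (by linear_combination h5))

theorem det_multiquadraticMatrix_ne_zero [Fintype ι] (h2 : (2 : F) ≠ 0) {a : ι → F}
    (ha : Function.Injective a) (ha0 : ∀ i, a i ≠ 0) {c : Finset ι → F[X]} (hc : c ≠ 0) :
    (multiquadraticMatrix (fun i => C (a i) * (X + C (a i))) c).det ≠ 0 := by
  intro hdet
  let E := AlgebraicClosure (RatFunc F)
  let K : Subfield E := (algebraMap (RatFunc F) E).fieldRange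
  let φ : F[X] →+* E := (algebraMap (RatFunc F) E).comp (algebraMap F[X] (RatFunc F))
  have hφ : Function.Injective φ :=
    (algebraMap (RatFunc F) E).injective.comp (IsFractionRing.injective F[X] (RatFunc F))
  have hφK : ∀ q, φ q ∈ K := fun q => ⟨_, rfl⟩
  have hsq : ∀ i, ∃ z : E, z ^ 2 = φ (C (a i) * (X + C (a i))) := fun i =>
    IsAlgClosed.exists_pow_nat_eq _ (by norm_num)
  choose z hz using hsq
  have h2E : (2 : E) ≠ 0 := by
    have := (map_ne_zero_iff (φ.comp C) (φ.comp C).injective).2 h2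
    rwa [map_ofNat] at this
  have hind : ∀ v : Finset ι → F[X], ∑ t, φ (v t) * ∏ i ∈ t, z i = 0 → v = 0 := by
    intro v hv
    have := Subfield.coeff_eq_zero_of_sum_prod_sqrt_eq_zero h2E z univ K
      (fun i _ => by rw [hz]; exact hφK _) ?_ (fun t => φ (v t)) (fun t => hφK _)
      (by simpa using hv)
    · funext t
      exact (map_eq_zero_iff φ hφ).1 (this t (subset_univ _))
    · rintro t - ht ⟨f, hf⟩
      have h1 : f ^ 2 = algebraMap F[X] (RatFunc F) (∏ i ∈ t, C (a i) * (X + C (a i))) := by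
        apply (algebraMap (RatFunc F) E).injective
        rw [map_pow, hf, ← prod_pow]
        simp_rw [hz]
        rw [← map_prod]
        rfl
      obtain ⟨g, rfl⟩ := IsIntegrallyClosed.exists_algebraMap_eq_of_isIntegral_pow (R := F[X])
        (n := 2) (by norm_num) (by rw [h1]; exact isIntegral_algebraMap)
      rw [← map_pow] at h1
      exact not_isSquare_prod_C_mul_X_add_C ha ha0 ht
        ⟨g, by rw [← IsFractionRing.injective F[X] (RatFunc F) h1, sq]⟩
  obtain ⟨v, hv0, hv⟩ := Matrix.exists_vecMul_eq_zero_iff.2 hdet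
  have h3 : (∑ I, φ (c I) * ∏ i ∈ I, z i) * ∑ J, φ (v J) * ∏ i ∈ J, z i = 0 := by
    have : ∀ J, (∑ I, φ (c I) * ∏ i ∈ I, z i) * (φ (v J) * ∏ i ∈ J, z i) =
        ∑ K, φ (v J * multiquadraticMatrix (fun i => C (a i) * (X + C (a i))) c J K) *
          ∏ i ∈ K, z i := by
      intro J
      have := sum_multiquadraticMatrix φ (fun i => C (a i) * (X + C (a i))) c z hz J
      rw [mul_left_comm, ← this, mul_sum]
      simp only [map_mul, mul_assoc]
    rw [mul_sum]
    simp_rw [this]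
    rw [sum_comm]
    refine sum_eq_zero fun K _ => ?_
    rw [← sum_mul, ← map_sum]
    have h4 := congrFun hv K
    simp only [Matrix.vecMul, dotProduct, Pi.zero_apply] at h4
    rw [h4, map_zero, zero_mul]
  rcases mul_eq_zero.1 h3 with h | h
  · exact hc (hind c h)
  · exact hv0 (hind v h)

end Independence

section Stepanov

variable {p : ℕ} [Fact p.Prime] {ι : Type*} [Fintype ι] [DecidableEq ι]

theorem sum_mul_prod_pow_ne_zero (hp : p ≠ 2) {a : ι → ZMod p} (ha : Function.Injective a)
    (ha0 : ∀ i, a i ≠ 0) {A : ℕ} (hA : 2 ^ Fintype.card ι * (A + 2 * Fintype.card ι) < p)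
    {c : Finset ι → (ZMod p)[X]} (hc : c ≠ 0) (hdeg : ∀ t, (c t).natDegree ≤ A) :
    ∑ t, c t * ∏ i ∈ t, (X + C (a i)) ^ (p / 2) ≠ 0 := by
  intro h0
  have hprime : p.Prime := Fact.out
  have h2 : (2 : ZMod p) ≠ 0 := by
    intro h
    have : ((2 : ℕ) : ZMod p) = 0 := by exact_mod_cast h
    rw [ZMod.natCast_eq_zero_iff] at this
    exact hp ((Nat.prime_dvd_prime_iff_eq hprime Nat.prime_two).1 this)
  have hodd : p / 2 + p / 2 + 1 = p := by
    have := hprime.eq_two_or_odd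
    omega
  set d : Finset ι → (ZMod p)[X] := fun t => c t * ∏ i ∈ tᶜ, (X + C (a i)) with hd
  have hd0 : d ≠ 0 := by
    intro h
    apply hc
    funext t
    have h1 := congrFun h t
    simp only [hd, Pi.zero_apply, mul_eq_zero] at h1
    refine h1.resolve_right (prod_ne_zero_iff.2 fun i _ => X_add_C_ne_zero _)
  have hprod : ∀ t : Finset ι, (∏ i ∈ t, (X + C (a i))).natDegree ≤ Fintype.card ι := by
    intro t
    refine (natDegree_prod_le _ _).trans ?_
    simpa using card_le_univ t
  have hddeg : ∀ t, (d t).natDegree ≤ A + Fintype.card ι := fun t =>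
    natDegree_mul_le.trans (add_le_add (hdeg t) (hprod _))
  set e : ι → (ZMod p)[X] := fun i => C (a i) * (X + C (a i)) with he
  have hdet := det_multiquadraticMatrix_ne_zero h2 ha ha0 hd0
  have hdetdeg : (multiquadraticMatrix e d).det.natDegree < p := by
    refine (natDegree_det_le_card_mul _ (A + 2 * Fintype.card ι) fun J K => ?_).trans_lt
      (by simpa using hA)
    refine natDegree_mul_le.trans ?_
    have : (∏ i ∈ J \ K, e i).natDegree ≤ Fintype.card ι := by
      refine (natDegree_prod_le _ _).trans ?_
      refine (sum_le_card_nsmul _ _ 1 fun i _ => ?_).trans (by simpa using card_le_univ _)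
      exact (natDegree_C_mul_le _ _).trans (natDegree_X_add_C _).le
    have := hddeg (symmDiff J K)
    omega
  have hdvd := dvd_det_multiquadraticMatrix (Ideal.Quotient.mk (Ideal.span {(X : (ZMod p)[X]) ^ p}))
    e d (fun i => Ideal.Quotient.mk _ ((X + C (a i)) ^ (p / 2 + 1))) ?_
  · have hsum : ∑ t, d t * ∏ i ∈ t, (X + C (a i)) ^ (p / 2 + 1) = 0 := by
      rw [← zero_mul (∏ i, (X + C (a i))), ← h0, sum_mul]
      refine sum_congr rfl fun t _ => ?_
      rw [hd, ← prod_mul_prod_compl t]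
      simp only [pow_succ, prod_mul_distrib]
      ring
    have h1 := congrArg (Ideal.Quotient.mk (Ideal.span {(X : (ZMod p)[X]) ^ p})) hsum
    rw [map_sum, map_zero] at h1
    simp only [map_mul, map_prod] at h1 hdvd
    rw [h1, zero_dvd_iff, Ideal.Quotient.eq_zero_iff_mem, Ideal.mem_span_singleton] at hdvd
    have := natDegree_le_of_dvd hdvd hdet
    rw [natDegree_X_pow] at this
    omega
  · intro i
    rw [← map_pow, Ideal.Quotient.eq, Ideal.mem_span_singleton]
    have : ((X + C (a i)) ^ (p / 2 + 1)) ^ 2 = (X + C (a i)) ^ p * (X + C (a i)) := by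
      rw [← pow_mul, ← pow_succ]
      congr 1
      omega
    rw [this, add_pow_char, ← C_pow, ZMod.pow_card]
    exact ⟨X + C (a i), by rw [he]; ring⟩

end Stepanov

section Derivative

variable {F ι : Type*} [Field F] [Fintype ι] [DecidableEq ι]

/-- The operator sending `q` to `L ^ k * (q * g)⁽ᵏ⁾ / g`, where `L = ∏ i, (X + a i)` and
`g = ∏ i ∈ t, (X + a i) ^ m`. -/
noncomputable def clearedDerivative (a : ι → F) (m : ℕ) (t : Finset ι) : ℕ → F[X] →ₗ[F] F[X]
  | 0 => LinearMap.id
  | k + 1 =>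
    (LinearMap.mulLeft F (∏ i, (X + C (a i))) ∘ₗ (derivative : F[X] →ₗ[F] F[X])
      - LinearMap.mulLeft F ((k : F[X]) * derivative (∏ i, (X + C (a i))))
      + LinearMap.mulLeft F ((m : F[X]) * ∑ i ∈ t, ∏ j ∈ univ.erase i, (X + C (a j)))) ∘ₗ
      clearedDerivative a m t k

theorem prod_mul_derivative_prod_pow (a : ι → F) (m : ℕ) (t : Finset ι) :
    (∏ i, (X + C (a i))) * derivative (∏ i ∈ t, (X + C (a i)) ^ m) =
      (m * ∑ i ∈ t, ∏ j ∈ univ.erase i, (X + C (a j))) * ∏ i ∈ t, (X + C (a i)) ^ m := by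
  rw [derivative_prod_finset, mul_sum, mul_sum, sum_mul]
  refine sum_congr rfl fun i hi => ?_
  rw [← mul_prod_erase t _ hi, ← mul_prod_erase univ _ (mem_univ i)]
  rcases m with _ | m
  · simp
  · rw [derivative_X_add_C_pow, Nat.add_sub_cancel, C_eq_natCast, pow_succ (X + C (a i)) m]
    ring

theorem clearedDerivative_mul (a : ι → F) (m : ℕ) (t : Finset ι) (k : ℕ) (q : F[X]) :
    clearedDerivative a m t k q * ∏ i ∈ t, (X + C (a i)) ^ m =
      (∏ i, (X + C (a i))) ^ k * derivative^[k] (q * ∏ i ∈ t, (X + C (a i)) ^ m) := by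
  induction k with
  | zero => simp [clearedDerivative]
  | succ k ih =>
    have h1 := congrArg (fun f => (∏ i, (X + C (a i))) * derivative f) ih
    have h2 := prod_mul_derivative_prod_pow a m t
    simp only [derivative_mul] at h1
    rw [Function.iterate_succ_apply']
    simp only [clearedDerivative, LinearMap.comp_apply, LinearMap.add_apply, LinearMap.sub_apply,
      LinearMap.mulLeft_apply]
    set L : F[X] := ∏ i, (X + C (a i))
    set g : F[X] := ∏ i ∈ t, (X + C (a i)) ^ m
    have h3 : L * derivative (L ^ k) = k * derivative L * L ^ k := by
      rcases k with _ | k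
      · simp
      · rw [derivative_pow]
        simp only [Nat.add_sub_cancel, pow_succ, C_eq_natCast]
        ring
    linear_combination h1 - clearedDerivative a m t k q * h2 - (k : F[X]) * derivative L * ih +
      derivative^[k] (q * g) * h3

theorem natDegree_clearedDerivative_le (a : ι → F) (m : ℕ) (t : Finset ι) (k : ℕ) (q : F[X]) :
    (clearedDerivative a m t k q).natDegree ≤ q.natDegree + Fintype.card ι * k := by
  have hprod : ∀ t : Finset ι, (∏ i ∈ t, (X + C (a i))).natDegree ≤ Fintype.card ι := by
    intro t
    refine (natDegree_prod_le _ _).trans ?_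
    simpa using card_le_univ t
  induction k with
  | zero => simp [clearedDerivative]
  | succ k ih =>
    simp only [clearedDerivative, LinearMap.comp_apply, LinearMap.add_apply, LinearMap.sub_apply,
      LinearMap.mulLeft_apply]
    have hnat : ∀ (n : ℕ) (f : F[X]), ((n : F[X]) * f).natDegree ≤ f.natDegree := fun n f => by
      rw [← C_eq_natCast]; exact natDegree_C_mul_le _ _
    have hbound : ∀ f g : F[X], f.natDegree ≤ Fintype.card ι →
        g.natDegree ≤ q.natDegree + Fintype.card ι * k →
        (f * g).natDegree ≤ q.natDegree + Fintype.card ι * (k + 1) := fun f g hf hg => by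
      refine natDegree_mul_le.trans ?_
      rw [mul_add]
      omega
    refine natDegree_add_le_of_degree_le
      ((natDegree_sub_le_of_le (n := q.natDegree + Fintype.card ι * (k + 1))
        (m := q.natDegree + Fintype.card ι * (k + 1)) ?_ ?_).trans (max_self _).le) ?_
    · exact hbound _ _ (hprod _) ((natDegree_derivative_le _).trans ((Nat.sub_le _ _).trans ih))
    · refine hbound _ _ ((hnat _ _).trans ?_) ih
      exact (natDegree_derivative_le _).trans ((Nat.sub_le _ _).trans (hprod _))
    · refine hbound _ _ ((hnat _ _).trans ?_) ih
      exact natDegree_sum_le_of_forall_le _ _ fun i _ => hprod _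

/-- Linear algebra produces an auxiliary polynomial, with prescribed vanishing order at all points
where every `(x + a i) ^ m` equals one. -/
theorem exists_sum_clearedDerivative_eq_zero (a : ι → F) (m A M : ℕ)
    (hM : M * (A + Fintype.card ι * M) < 2 ^ Fintype.card ι * A) :
    ∃ c : Finset ι → F[X], c ≠ 0 ∧ (∀ t, (c t).natDegree ≤ A) ∧
      ∀ k < M, ∑ t, clearedDerivative a m t k (c t) = 0 := by
  let Φ : (Finset ι → degreeLT F A) →ₗ[F] (Fin M → Fin (A + Fintype.card ι * M) → F) :=
    LinearMap.pi fun k => LinearMap.pi fun j => lcoeff F j ∘ₗ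
      ∑ t, clearedDerivative a m t k ∘ₗ (degreeLT F A).subtype ∘ₗ LinearMap.proj t
  have : FiniteDimensional F (degreeLT F A) := (degreeLTEquiv F A).symm.finiteDimensional
  have hker : LinearMap.ker Φ ≠ ⊥ := by
    apply LinearMap.ker_ne_bot_of_finrank_lt
    simpa [Module.finrank_pi_fintype, (degreeLTEquiv F A).finrank_eq] using hM
  obtain ⟨c, hc, hc0⟩ := Submodule.exists_mem_ne_zero_of_ne_bot hker
  have hdeg : ∀ t, ((c t : F[X])).natDegree ≤ A := fun t =>
    natDegree_le_of_degree_le (mem_degreeLT.1 (c t).2).le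
  refine ⟨fun t => c t, ?_, hdeg, fun k hk => ?_⟩
  · intro h
    apply hc0
    funext t
    exact Subtype.ext (congrFun h t)
  · ext j
    by_cases hj : j < A + Fintype.card ι * M
    · have := congrFun (congrFun (LinearMap.mem_ker.1 hc) ⟨k, hk⟩) ⟨j, hj⟩
      simpa [Φ] using this
    · rw [coeff_zero]
      apply coeff_eq_zero_of_natDegree_lt
      have hA : ∀ t, ((c t : F[X])).natDegree ≤ A - 1 := by
        intro t
        by_cases h0 : (c t : F[X]) = 0
        · simp [h0]
        · have := (natDegree_lt_iff_degree_lt h0).2 (mem_degreeLT.1 (c t).2)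
          omega
      have hA0 : 0 < A := by
        rcases Nat.eq_zero_or_pos A with rfl | h
        · simp at hM
        · exact h
      refine (natDegree_sum_le_of_forall_le (n := A - 1 + Fintype.card ι * k) _ _
        fun t _ => ?_).trans_lt ?_
      · exact (natDegree_clearedDerivative_le _ _ _ _ _).trans
          (add_le_add (hA t) le_rfl)
      · have := Nat.mul_le_mul_left (Fintype.card ι) hk.le
        omega

end Derivative

/-- A finite set of `x` for which all `x + a i` are nonzero squares has size
`O(r * p / 2 ^ r)`, as long as `4 ^ r` is slightly smaller than `p`. -/
theorem card_mul_two_pow_le {p : ℕ} [Fact p.Prime] {r : ℕ} (hr : r ≠ 0) (hrp : 2 * r * 4 ^ r < p)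
    {a : Fin r → ZMod p} (ha : Function.Injective a) (ha0 : ∀ i, a i ≠ 0) (S : Finset (ZMod p))
    (hS : ∀ x ∈ S, ∀ i, (x + a i) ^ (p / 2) = 1) : S.card * 2 ^ r ≤ 2 * r * p := by
  obtain ⟨s, hrs⟩ : ∃ s, r = s + 1 := Nat.exists_eq_succ_of_ne_zero hr
  have h2r : 2 ^ r = 2 * 2 ^ s := by rw [hrs, pow_succ]; ring
  have h4r : 4 ^ r = 2 ^ r * 2 ^ r := by rw [← mul_pow]; norm_num
  have hr1 : 1 ≤ r := by omega
  have hs1 : 1 ≤ 2 ^ s := Nat.one_le_two_pow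
  have hp4 : 4 < p := by
    have : 4 ^ 1 ≤ 4 ^ r := Nat.pow_le_pow_right (by norm_num) hr1
    nlinarith
  obtain ⟨c, hc0, hcdeg, hc⟩ := exists_sum_clearedDerivative_eq_zero a (p / 2) (r * 2 ^ r) (2 ^ s)
    (by rw [Fintype.card_fin, h2r]; nlinarith [Nat.mul_pos hr1 (Nat.mul_pos hs1 hs1)])
  set f : (ZMod p)[X] := ∑ t, c t * ∏ i ∈ t, (X + C (a i)) ^ (p / 2) with hf
  have hf0 : f ≠ 0 := by
    refine sum_mul_prod_pow_ne_zero (by omega) ha ha0 (A := r * 2 ^ r) ?_ hc0 hcdeg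
    rw [Fintype.card_fin]
    refine lt_of_le_of_lt ?_ hrp
    rw [h4r, h2r]
    nlinarith [Nat.mul_pos hr1 hs1, Nat.mul_le_mul_left (r * 2 ^ s) hs1]
  have hsp : 2 ^ s < p := by nlinarith [Nat.mul_pos hr1 hs1]
  have hmult : ∀ x ∈ S, 2 ^ s ≤ f.rootMultiplicity x := by
    intro x hx
    have : 2 ^ s - 1 < f.rootMultiplicity x := by
      refine lt_rootMultiplicity_of_isRoot_iterate_derivative_of_mem_nonZeroDivisors hf0
        (fun k hk => ?_) ?_
      · have hL : (∏ i, (X + C (a i))).eval x ≠ 0 := by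
          rw [eval_prod, prod_ne_zero_iff]
          intro i _ h0
          have := hS x hx i
          simp only [eval_add, eval_X, eval_C] at h0
          rw [h0, zero_pow (by omega)] at this
          exact zero_ne_one this
        have h1 : (∏ i, (X + C (a i))) ^ k * derivative^[k] f =
            ∑ t, clearedDerivative a (p / 2) t k (c t) * ∏ i ∈ t, (X + C (a i)) ^ (p / 2) := by
          simp_rw [clearedDerivative_mul]
          rw [hf, iterate_derivative_sum, mul_sum]
        have h2 := congrArg (eval x) h1
        rw [eval_finsetSum] at h2
        have h3 : ∀ t : Finset (Fin r), eval x (∏ i ∈ t, (X + C (a i)) ^ (p / 2)) = 1 := by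
          intro t
          rw [eval_prod]
          refine prod_eq_one fun i _ => ?_
          simpa using hS x hx i
        simp only [eval_mul, h3, mul_one] at h2
        rw [← eval_finsetSum, hc k (by omega), eval_zero, eval_pow] at h2
        exact (mul_eq_zero.1 h2).resolve_left (pow_ne_zero _ hL)
      · rw [mem_nonZeroDivisors_iff_ne_zero, Ne, ZMod.natCast_eq_zero_iff,
          (Fact.out : p.Prime).dvd_factorial]
        omega
    omega
  have hroots : (2 ^ s • S.val) ≤ f.roots := by
    rw [Multiset.le_iff_count]
    intro x
    rw [Multiset.count_nsmul, count_roots]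
    by_cases hx : x ∈ S
    · rw [Multiset.count_eq_one_of_mem S.nodup hx, mul_one]
      exact hmult x hx
    · rw [Multiset.count_eq_zero_of_notMem hx]
      simp
  have hcard := (Multiset.card_le_card hroots).trans (card_roots' f)
  rw [Multiset.card_nsmul, card_val] at hcard
  have hfdeg : f.natDegree ≤ r * 2 ^ r + r * (p / 2) := by
    refine natDegree_sum_le_of_forall_le _ _ fun t _ => natDegree_mul_le.trans ?_
    refine add_le_add (hcdeg t) ((natDegree_prod_le _ _).trans ?_)
    refine (sum_le_card_nsmul _ _ (p / 2) fun i _ => ?_).trans ?_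
    · exact natDegree_pow_le.trans (by simp)
    · rw [smul_eq_mul]
      exact Nat.mul_le_mul_right _ (by simpa using card_le_univ t)
  have h5 : 2 * 2 ^ r ≤ p := by
    have : 2 ≤ 2 ^ r := by omega
    nlinarith [Nat.mul_le_mul hr1 (Nat.le_refl (2 ^ r * 2 ^ r))]
  have h6 : 2 * (p / 2) ≤ p := Nat.mul_div_le p 2
  have h7 := hcard.trans hfdeg
  calc S.card * 2 ^ r = 2 * (2 ^ s * S.card) := by rw [h2r]; ring
    _ ≤ 2 * (r * 2 ^ r + r * (p / 2)) := by omega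
    _ = r * (2 * 2 ^ r) + r * (2 * (p / 2)) := by ring
    _ ≤ r * p + r * p := add_le_add (Nat.mul_le_mul_left _ h5) (Nat.mul_le_mul_left _ h6)
    _ = 2 * r * p := by ring

theorem ZMod.natCast_inj_of_lt {p m n : ℕ} (hm : m < p) (hn : n < p)
    (h : (m : ZMod p) = (n : ZMod p)) : m = n := by
  rwa [ZMod.natCast_eq_natCast_iff', Nat.mod_eq_of_lt hm, Nat.mod_eq_of_lt hn] at h

section Nonresidue

variable {p : ℕ} [Fact p.Prime] {N : ℕ}

theorem div_pow_half_eq_one_of_forall_legendreSym_ne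
    (h : ∀ n : ℕ, 0 < n → n ≤ N → legendreSym p (3 * (n : ℤ) + 1) ≠ -1) (hN : 3 * N + 1 < p)
    {v w : ℕ} (hv : v ≤ N) (hw : w ≤ N) (hvw : v % 3 = w % 3) (hw3 : w % 3 ≠ 0) :
    ((v : ZMod p) / (w : ZMod p)) ^ (p / 2) = 1 := by
  have h1 : ∀ n ≤ N, ((3 * n + 1 : ℕ) : ZMod p) ^ (p / 2) = 1 := by
    intro n hn
    rcases Nat.eq_zero_or_pos n with rfl | hn0
    · simp
    have h0 : (((3 * (n : ℤ) + 1 : ℤ)) : ZMod p) ≠ 0 := by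
      intro h0
      have : ((3 * n + 1 : ℕ) : ZMod p) = ((0 : ℕ) : ZMod p) := by
        push_cast at h0 ⊢
        exact h0
      have := ZMod.natCast_inj_of_lt (by omega) (by omega) this
      omega
    have h2 := (legendreSym.eq_one_or_neg_one p h0).resolve_right (h n hn0 hn)
    have h3 := legendreSym.eq_pow p (3 * (n : ℤ) + 1)
    rw [h2] at h3
    push_cast at h3 ⊢
    exact h3.symm
  have h2 : ∃ κ : ZMod p, ∀ u ≤ N, u % 3 = w % 3 → κ * (u : ZMod p) ^ (p / 2) = 1 := by
    obtain hw1 | hw2 : w % 3 = 1 ∨ w % 3 = 2 := by omega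
    · refine ⟨1, fun u hu hu3 => ?_⟩
      rw [one_mul]
      have := h1 (u / 3) (by omega)
      rwa [show 3 * (u / 3) + 1 = u by omega] at this
    · refine ⟨((2 : ℕ) : ZMod p) ^ (p / 2), fun u hu hu3 => ?_⟩
      have := h1 (2 * u / 3) (by omega)
      rwa [show 3 * (2 * u / 3) + 1 = 2 * u by omega, Nat.cast_mul, mul_pow] at this
  obtain ⟨κ, hκ⟩ := h2
  have hκv := hκ v hv hvw
  have hκw := hκ w hw rfl
  have hκ0 : κ ≠ 0 := left_ne_zero_of_mul_eq_one hκv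
  have : (v : ZMod p) ^ (p / 2) = (w : ZMod p) ^ (p / 2) :=
    mul_left_cancel₀ hκ0 (hκv.trans hκw.symm)
  rw [div_pow, this, div_self (right_ne_zero_of_mul_eq_one hκw)]

theorem mul_two_pow_le_of_forall_legendreSym_ne
    (h : ∀ n : ℕ, 0 < n → n ≤ N → legendreSym p (3 * (n : ℤ) + 1) ≠ -1) (hN : N * N < p)
    {r Q U : ℕ} (hr : r ≠ 0) (hrp : 2 * r * 4 ^ r < p) (hQ : 4 * r * Q ≤ N)
    (hU : 6 * U + 6 ≤ Nat.primeCounting Q) : U * U * 2 ^ r ≤ 2 * r * p := by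
  rcases Nat.eq_zero_or_pos U with rfl | hU0
  · simp
  have hr1 : 1 ≤ r := Nat.one_le_iff_ne_zero.2 hr
  have hπ : Nat.primeCounting Q = ((range (Q + 1)).filter Nat.Prime).card := by
    rw [Nat.primeCounting, Nat.primeCounting', Nat.count_eq_card_filter_range]
  have hQ1 : 1 ≤ Q := by
    rcases Nat.eq_zero_or_pos Q with rfl | hq
    · simp at hU
    · exact hq
  have hrQ : r ≤ r * Q := Nat.le_mul_of_pos_right _ hQ1
  have hQr : Q ≤ r * Q := Nat.le_mul_of_pos_left _ hr1
  rw [mul_assoc] at hQ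
  have hN4 : 4 ≤ N := by omega
  have hN3 : 3 * N + 1 < p := by nlinarith
  set T := ((range (Q + 1)).filter Nat.Prime).filter (3 * U + 3 ≤ ·) with hT
  have hTcard : U ≤ T.card := by
    have hsub : (range (Q + 1)).filter Nat.Prime ⊆ range (3 * U + 3) ∪ T := by
      intro q hq
      simp only [hT, mem_union, mem_range, mem_filter] at hq ⊢
      by_cases hq3 : 3 * U + 3 ≤ q
      · exact Or.inr ⟨hq, hq3⟩
      · exact Or.inl (by omega)
    have := (card_le_card hsub).trans (card_union_le _ _)
    rw [card_range] at this
    omega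
  have hTmem : ∀ q ∈ T, q ≤ Q ∧ q.Prime ∧ 3 * U + 3 ≤ q ∧ q % 3 ≠ 0 := by
    intro q hq
    simp only [hT, mem_range, mem_filter] at hq
    obtain ⟨⟨hq1, hq2⟩, hq3⟩ := hq
    refine ⟨by omega, hq2, hq3, fun h0 => ?_⟩
    have h3 := (Nat.prime_dvd_prime_iff_eq Nat.prime_three hq2).1 (Nat.dvd_of_mod_eq_zero h0)
    omega
  have hq0 : ∀ q ∈ T, (q : ZMod p) ≠ 0 := by
    intro q hq h0
    obtain ⟨h1, h2, -⟩ := hTmem q hq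
    have := ZMod.natCast_inj_of_lt (p := p) (m := q) (n := 0) (by omega) (by omega)
      (by simpa using h0)
    exact h2.ne_zero this
  let F : ℕ × ℕ → ZMod p := fun x => ((3 * x.1 + x.2 % 3 : ℕ) : ZMod p) / (x.2 : ZMod p)
  have hinj : Set.InjOn F (range U ×ˢ T : Finset (ℕ × ℕ)) := by
    rintro ⟨s, q⟩ hx ⟨s', q'⟩ hx' heq
    simp only [coe_product, Set.mem_prod, mem_coe, mem_range] at hx hx'
    obtain ⟨hs, hq⟩ := hx
    obtain ⟨hs', hq'⟩ := hx'
    obtain ⟨h1, h2, h3, h4⟩ := hTmem q hq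
    obtain ⟨h1', h2', h3', h4'⟩ := hTmem q' hq'
    simp only [F] at heq
    rw [div_eq_div_iff (hq0 q hq) (hq0 q' hq'), ← Nat.cast_mul, ← Nat.cast_mul] at heq
    have heq' := ZMod.natCast_inj_of_lt
      ((Nat.mul_le_mul (by omega : _ ≤ N) (by omega : _ ≤ N)).trans_lt hN)
      ((Nat.mul_le_mul (by omega : _ ≤ N) (by omega : _ ≤ N)).trans_lt hN) heq
    have hdvd : q ∣ (3 * s + q % 3) * q' := by
      rw [heq']
      exact dvd_mul_left _ _
    have hqq : q = q' := by
      rcases h2.dvd_mul.1 hdvd with hd | hd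
      · have := Nat.le_of_dvd (by omega) hd
        omega
      · exact (Nat.prime_dvd_prime_iff_eq h2 h2').1 hd
    subst hqq
    have := Nat.eq_of_mul_eq_mul_right h2.pos heq'
    ext <;> simp
    omega
  let a : Fin r → ZMod p := fun i => ((3 * (i + 1) : ℕ) : ZMod p)
  have key := card_mul_two_pow_le hr hrp (a := a) ?_ ?_ ((range U ×ˢ T).image F) ?_
  · rw [card_image_of_injOn hinj, card_product, card_range] at key
    exact le_trans (Nat.mul_le_mul_right _ (Nat.mul_le_mul_left _ hTcard)) key
  · intro i j hij
    have := ZMod.natCast_inj_of_lt (by omega) (by omega) hij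
    omega
  · intro i h0
    have := ZMod.natCast_inj_of_lt (p := p) (m := 3 * (i + 1)) (n := 0) (by omega) (by omega)
      (by simpa [a] using h0)
    omega
  · intro x hx i
    obtain ⟨⟨s, q⟩, hsq, rfl⟩ := mem_image.1 hx
    simp only [mem_product, mem_range] at hsq
    obtain ⟨h1, h2, h3, h4⟩ := hTmem q hsq.2
    have hle : 3 * s + q % 3 + 3 * (i + 1) * q ≤ N := by
      have : 3 * ((i + 1 : ℕ) * q) ≤ 3 * (r * Q) :=
        Nat.mul_le_mul_left _ (Nat.mul_le_mul (by omega) h1)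
      rw [mul_assoc]
      omega
    have := div_pow_half_eq_one_of_forall_legendreSym_ne h hN3 hle (by omega : q ≤ N)
      (by rw [mul_assoc]; omega) h4
    rw [← this]
    congr 1
    have hq := hq0 q hsq.2
    simp only [F, a]
    field_simp
    push_cast
    ring

end Nonresidue

theorem le_primeCounting_floor {P w : ℝ} (hP : 1 ≤ P) (hw : 1000 ≤ w)
    (hlog : Real.log (P * w ^ 6 + 1) ≤ w) :
    6 * ⌊P * w ^ 4⌋₊ + 6 ≤ Nat.primeCounting ⌊P * w ^ 6⌋₊ := by
  set Q := ⌊P * w ^ 6⌋₊ with hQ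
  have hw5 : 1 ≤ w ^ 5 := one_le_pow₀ (by linarith)
  have hw4 : 1 ≤ w ^ 4 := one_le_pow₀ (by linarith)
  have hww : w ≤ w ^ 5 := le_self_pow₀ (by linarith) (by norm_num)
  have hPw : w ^ 5 ≤ P * w ^ 5 := le_mul_of_one_le_left (by linarith) hP
  have hPw4 : w ^ 4 ≤ P * w ^ 4 := le_mul_of_one_le_left (by linarith) hP
  have hPw6 : 1000 * (P * w ^ 5) ≤ P * w ^ 6 := by
    have : P * w ^ 6 = w * (P * w ^ 5) := by ring
    rw [this]
    exact mul_le_mul_of_nonneg_right hw (by linarith)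
  have hPw54 : P * w ^ 4 * w = P * w ^ 5 := by ring
  have hQle : (Q : ℝ) ≤ P * w ^ 6 := Nat.floor_le (by linarith)
  have hQge : P * w ^ 6 < Q + 1 := Nat.lt_floor_add_one _
  have hU : (⌊P * w ^ 4⌋₊ : ℝ) ≤ P * w ^ 4 := Nat.floor_le (by linarith)
  have hQ2 : (2 : ℝ) ≤ Q := by linarith
  have hlogQ0 : 0 < Real.log Q := Real.log_pos (by linarith)
  have hlogQ1 : Real.log (Q + 1) ≤ w :=
    (Real.log_le_log (by linarith) (by linarith)).trans hlog
  have hlogQ : Real.log Q ≤ w := (Real.log_le_log (by linarith) (by linarith)).trans hlogQ1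
  have h := Chebyshev.pi_ge Q
  rw [div_le_iff₀ hlogQ0] at h
  have hl2 : 1 / 2 ≤ Real.log 2 := by linarith [Real.log_two_gt_d9]
  have h1 : (Q : ℝ) * (1 / 2) ≤ Q * Real.log 2 := mul_le_mul_of_nonneg_left hl2 (by linarith)
  by_contra! hcon
  have hcon' : (Nat.primeCounting Q : ℝ) ≤ 6 * ⌊P * w ^ 4⌋₊ + 6 := by exact_mod_cast hcon.le
  have h2 : (Nat.primeCounting Q : ℝ) * Real.log Q ≤ (12 * (P * w ^ 4)) * w :=
    mul_le_mul (by linarith) hlogQ hlogQ0.le (by linarith)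
  linarith

theorem exists_four_pow_mul_le_and_sq_lt {P w : ℝ} (hP : 1 ≤ P) (hw : 1000 ≤ w) (hwP : w ^ 16 ≤ P)
    (hlog : Real.log (P ^ 4) ≤ w) :
    ∃ r : ℕ, r ≠ 0 ∧ (r : ℝ) ≤ w ∧ (4 : ℝ) ^ r * w ^ 8 ≤ P ^ 4 ∧ P ^ 2 < 2 * 2 ^ r * w ^ 4 := by
  have hw8 : 0 < w ^ 8 := by positivity
  have hy : 1 ≤ P ^ 4 / w ^ 8 := by
    rw [one_le_div hw8]
    calc w ^ 8 ≤ w ^ 16 := pow_le_pow_right₀ (by linarith) (by norm_num)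
      _ ≤ P := hwP
      _ ≤ P ^ 4 := le_self_pow₀ hP (by norm_num)
  obtain ⟨r, hr1, hr2⟩ := exists_nat_pow_near hy (by norm_num : (1 : ℝ) < 4)
  rw [le_div_iff₀ hw8] at hr1
  rw [div_lt_iff₀ hw8] at hr2
  refine ⟨r, ?_, ?_, hr1, ?_⟩
  · rintro rfl
    have h1 : w ^ 16 ≤ P ^ 4 := hwP.trans (le_self_pow₀ hP (by norm_num))
    have h2 : 1000 ≤ w ^ 8 := hw.trans (le_self_pow₀ (by linarith) (by norm_num))
    have h3 : w ^ 16 = w ^ 8 * w ^ 8 := by ring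
    have h4 := mul_le_mul_of_nonneg_right h2 hw8.le
    rw [zero_add, pow_one] at hr2
    linarith
  · have h1 : (4 : ℝ) ^ r ≤ P ^ 4 :=
      le_trans (le_mul_of_one_le_right (by positivity) (one_le_pow₀ (by linarith))) hr1
    have h2 := Real.log_le_log (by positivity) h1
    rw [Real.log_pow] at h2
    have h3 : 1 ≤ Real.log 4 := by
      rw [show (4 : ℝ) = 2 ^ 2 by norm_num, Real.log_pow]
      push_cast
      linarith [Real.log_two_gt_d9]
    have h4 : (r : ℝ) ≤ r * Real.log 4 := le_mul_of_one_le_right (by positivity) h3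
    linarith
  · apply lt_of_pow_lt_pow_left₀ 2 (by positivity)
    have : (4 : ℝ) ^ r = 2 ^ r * 2 ^ r := by rw [← mul_pow]; norm_num
    calc (P ^ 2) ^ 2 = P ^ 4 := by ring
      _ < 4 ^ (r + 1) * w ^ 8 := hr2
      _ = (2 * 2 ^ r * w ^ 4) ^ 2 := by rw [pow_succ, this]; ring

theorem exists_legendreSym_three_mul_add_one_eq_neg_one {p : ℕ} [Fact p.Prime] {P w : ℝ}
    (hp : (p : ℝ) = P ^ 4) (hP : 1 ≤ P) (hw : 1000 ≤ w) (hwP : w ^ 16 ≤ P)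
    (hlog : Real.log p ≤ w) :
    ∃ n : ℕ, 0 < n ∧ (n : ℝ) ≤ P * w ^ 8 ∧ legendreSym p (3 * (n : ℤ) + 1) = -1 := by
  by_contra! hcon
  have hw0 : 0 < w := by linarith
  have hP0 : 0 < P := by linarith
  have hP1 : 1 < P :=
    lt_of_lt_of_le (by linarith) (hw.trans ((le_self_pow₀ (by linarith) (by norm_num)).trans hwP))
  obtain ⟨r, hr0, hrw, hr4, hr2⟩ := exists_four_pow_mul_le_and_sq_lt hP hw hwP (hp ▸ hlog)
  have hNle : (⌊P * w ^ 8⌋₊ : ℝ) ≤ P * w ^ 8 := Nat.floor_le (by positivity)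
  have hQle : (⌊P * w ^ 6⌋₊ : ℝ) ≤ P * w ^ 6 := Nat.floor_le (by positivity)
  have hw7 : w ≤ w ^ 7 := le_self_pow₀ (by linarith) (by norm_num)
  have hPP : P ^ 3 < P ^ 4 := pow_lt_pow_right₀ hP1 (by norm_num)
  have key := mul_two_pow_le_of_forall_legendreSym_ne (p := p) (N := ⌊P * w ^ 8⌋₊) (r := r)
    (Q := ⌊P * w ^ 6⌋₊) (U := ⌊P * w ^ 4⌋₊)
    (fun n hn hnN => hcon n hn ((Nat.cast_le.2 hnN).trans hNle)) ?_ hr0 ?_ ?_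
    (le_primeCounting_floor hP hw ?_)
  · have key' : (⌊P * w ^ 4⌋₊ : ℝ) * ⌊P * w ^ 4⌋₊ * 2 ^ r ≤ 2 * r * P ^ 4 := by
      rw [← hp]
      exact_mod_cast key
    have hPw4 : 2 ≤ P * w ^ 4 := by
      have : w ≤ w ^ 4 := le_self_pow₀ (by linarith) (by norm_num)
      nlinarith
    have hU : P * w ^ 4 / 2 ≤ (⌊P * w ^ 4⌋₊ : ℝ) := by
      have := Nat.lt_floor_add_one (P * w ^ 4)
      linarith
    have h1 : P * w ^ 4 / 2 * (P * w ^ 4 / 2) * 2 ^ r ≤ 2 * w * P ^ 4 := by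
      refine le_trans ?_ (key'.trans ?_)
      · gcongr
      · gcongr
    have h2 : P ^ 2 * w ^ 4 * P ^ 2 ≤ P ^ 2 * w ^ 4 * (2 * 2 ^ r * w ^ 4) := by gcongr
    have h3 : P ^ 4 * w * w ^ 3 ≤ P ^ 4 * w * 16 := by nlinarith
    have h4 : w ^ 3 ≤ 16 := le_of_mul_le_mul_left h3 (by positivity)
    have h5 : w ≤ w ^ 3 := le_self_pow₀ (by linarith) (by norm_num)
    linarith
  · have : (⌊P * w ^ 8⌋₊ : ℝ) * ⌊P * w ^ 8⌋₊ < p := by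
      calc (⌊P * w ^ 8⌋₊ : ℝ) * ⌊P * w ^ 8⌋₊ ≤ (P * w ^ 8) * (P * w ^ 8) := by gcongr
        _ = P ^ 2 * w ^ 16 := by ring
        _ ≤ P ^ 2 * P := by gcongr
        _ = P ^ 3 := by ring
        _ < p := hp ▸ hPP
    exact_mod_cast this
  · have : (2 : ℝ) * r * 4 ^ r < p := by
      have h0 : (0 : ℝ) < 4 ^ r := by positivity
      calc (2 : ℝ) * r * 4 ^ r ≤ 2 * w * 4 ^ r := by gcongr
        _ < w * w ^ 7 * 4 ^ r := by
          have : 2 * w < w * w ^ 7 := by nlinarith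
          exact mul_lt_mul_of_pos_right this h0
        _ = 4 ^ r * w ^ 8 := by ring
        _ ≤ p := hp ▸ hr4
    exact_mod_cast this
  · apply Nat.le_floor
    push_cast
    calc (4 : ℝ) * r * ⌊P * w ^ 6⌋₊ ≤ w * w * (P * w ^ 6) := by
          gcongr
          linarith
      _ = P * w ^ 8 := by ring
  · refine le_trans (Real.log_le_log (by positivity) ?_) hlog
    rw [hp]
    have h1 : w ^ 6 ≤ P := (pow_le_pow_right₀ (by linarith) (by norm_num)).trans hwP
    have h2 : 1000 ≤ P := hw.trans ((le_self_pow₀ (by linarith) (by norm_num)).trans hwP)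
    have h3 : P * w ^ 6 ≤ P * P := by gcongr
    have h4 : P ^ 4 = P * P * (P * P) := by ring
    nlinarith

/-- For every ε > 0, for all sufficiently large primes p, there exists a positive
integer n ≤ p^{1/4 + ε} such that 3n + 1 is a quadratic non-residue modulo p. -/
theorem least_nonresidue_three_n_plus_one
    (ε : ℝ) (hε : 0 < ε) :
    ∃ p₀ : ℕ, ∀ p : ℕ, p₀ ≤ p → ∀ hp : p.Prime,
      ∃ n : ℕ, 0 < n ∧ (n : ℝ) ≤ (p : ℝ) ^ ((1 : ℝ) / 4 + ε) ∧
        @legendreSym p ⟨hp⟩ (3 * (n : ℤ) + 1) = -1 := by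
  set δ : ℝ := min ε (1 / 8) with hδ
  have hδ0 : 0 < δ := lt_min hε (by norm_num)
  have h1 : ∀ᶠ x : ℝ in Filter.atTop, Real.log x ≤ x ^ (δ / 8) := by
    filter_upwards [(isLittleO_log_rpow_atTop (by positivity : 0 < δ / 8)).bound one_pos,
      Filter.eventually_ge_atTop 0] with x hx hx0
    rw [one_mul, Real.norm_of_nonneg (Real.rpow_nonneg hx0 _)] at hx
    exact (Real.le_norm_self _).trans hx
  have h2 : ∀ᶠ x : ℝ in Filter.atTop, 1000 ≤ x ^ (δ / 8) :=
    (tendsto_rpow_atTop (by positivity)).eventually_ge_atTop 1000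
  obtain ⟨p₀, hp₀⟩ := Filter.eventually_atTop.1 (tendsto_natCast_atTop_atTop.eventually (h1.and h2))
  refine ⟨p₀, fun p hpp hp => ?_⟩
  obtain ⟨hlog, hw⟩ := hp₀ p hpp
  have : Fact p.Prime := ⟨hp⟩
  have hp1 : (1 : ℝ) ≤ p := by exact_mod_cast hp.one_lt.le
  have hp0 : (0 : ℝ) < p := by linarith
  have hpow : ∀ (s : ℝ) (n : ℕ), ((p : ℝ) ^ s) ^ n = (p : ℝ) ^ (s * n) := fun s n => by
    rw [Real.rpow_mul hp0.le, Real.rpow_natCast]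
  obtain ⟨n, hn0, hn, hleg⟩ := exists_legendreSym_three_mul_add_one_eq_neg_one
    (p := p) (P := (p : ℝ) ^ ((1 : ℝ) / 4)) (w := (p : ℝ) ^ (δ / 8))
    (by rw [hpow]; norm_num) (Real.one_le_rpow hp1 (by norm_num)) hw
    (by
      rw [hpow]
      refine Real.rpow_le_rpow_of_exponent_le hp1 ?_
      push_cast
      linarith [min_le_right ε (1 / 8)]) hlog
  refine ⟨n, hn0, hn.trans ?_, hleg⟩
  rw [hpow, ← Real.rpow_add hp0]
  refine Real.rpow_le_rpow_of_exponent_le hp1 ?_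
  push_cast
  linarith [min_le_left ε (1 / 8)]
end
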